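/- Let G = Gr(k,m) ⊂ P be the Plücker embedding of the Grassmannian of k-dimensional subspaces of an m-dimensional complex vector space, with k ≠ 1 and k ≠ m−1, and let X ⊂ G be a very general hypersurface in the linear system |O_G(d)|. If d ≥ 3m − 5, then irr(X) = d. -/

import Mathlib

open MvPolynomial

noncomputable section

/-- Points of the complex projective space whose homogeneous coordinates are
indexed by `ι` (so for `ι = Fin (N+1)` this is `ℙ^N`). -/
abbrev PPt (ι : Type) : Type := Projectivization ℂ (ι → ℂ)

/-- A polynomial vanishes at a projective point if it vanishes at every
representative vector of the point. -/
def PVanish {ι : Type} (f : MvPolynomial ι ℂ) (x : PPt ι) : Prop :=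
  ∀ (v : ι → ℂ) (hv : v ≠ 0), Projectivization.mk ℂ v hv = x → eval v f = 0

/-- The zero locus of a polynomial in projective space. -/
def ZeroSet {ι : Type} (f : MvPolynomial ι ℂ) : Set (PPt ι) :=
  {x | PVanish f x}

/-- Zariski-closed subsets of projective space: common zero loci of families of
homogeneous polynomials. -/
def IsZClosed {ι : Type} (Y : Set (PPt ι)) : Prop :=
  ∃ fs : Set (MvPolynomial ι ℂ),
    (∀ f ∈ fs, ∃ e, f.IsHomogeneous e) ∧ Y = {x | ∀ f ∈ fs, PVanish f x}

/-- `U` contains a dense (Zariski-)open subset of `X`: there is a Zariski-closed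
set `Y` not containing `X` with `X \ Y ⊆ U`.  Taking `X = Set.univ` this is the
notion of a set containing "the general point" of the ambient projective space. -/
def ContainsDenseOpenOf {ι : Type} (X U : Set (PPt ι)) : Prop :=
  ∃ Y : Set (PPt ι), IsZClosed Y ∧ ¬ X ⊆ Y ∧ X \ Y ⊆ U

/-- The set of projective points lying in (the projectivization of) a linear
subspace `W`. -/
def LinSet {ι : Type} (W : Submodule ℂ (ι → ℂ)) : Set (PPt ι) :=
  {x | x.submodule ≤ W}

/-- A line in projective space: the projectivization of a 2-dimensional
linear subspace. -/
def IsLine {ι : Type} (L : Set (PPt ι)) : Prop :=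
  ∃ W : Submodule ℂ (ι → ℂ), Module.finrank ℂ W = 2 ∧ L = LinSet W

/-- A smooth plane conic with supporting plane `P(W)`: the zero locus, inside the
projective plane `P(W)`, of a quadric which does not vanish identically on `W`
and whose restriction to `W` has no singular points. -/
def IsConicIn {ι : Type} [Fintype ι] (W : Submodule ℂ (ι → ℂ))
    (C : Set (PPt ι)) : Prop :=
  Module.finrank ℂ W = 3 ∧
  ∃ f : MvPolynomial ι ℂ, f.IsHomogeneous 2 ∧
    C = {x | x.submodule ≤ W ∧ PVanish f x} ∧
    (∃ v ∈ W, eval v f ≠ 0) ∧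
    (∀ v ∈ W, v ≠ 0 → eval v f = 0 →
      ∃ w ∈ W, (∑ i, eval v (pderiv i f) * w i) ≠ 0)

/-- A smooth plane conic in projective space. -/
def IsSmoothConic {ι : Type} [Fintype ι] (C : Set (PPt ι)) : Prop :=
  ∃ W, IsConicIn W C

/-- The Cayley–Bacharach condition `CB(m)`: every degree-`m` hypersurface
containing all points of `S` but one contains all of `S`. -/
def SatisfiesCB {ι : Type} (m : ℕ) (S : Finset (PPt ι)) : Prop :=
  ∀ f : MvPolynomial ι ℂ, f.IsHomogeneous m →
    ∀ p ∈ S, (∀ q ∈ S, q ≠ p → PVanish f q) → PVanish f p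

/-- A smooth projective hypersurface of degree `e`: the partial derivatives of
its (homogeneous) equation have no common nontrivial zero. -/
def IsSmoothHyp {ι : Type} [Fintype ι] (f : MvPolynomial ι ℂ) (e : ℕ) : Prop :=
  f.IsHomogeneous e ∧ f ≠ 0 ∧
    ∀ v : ι → ℂ, v ≠ 0 → ¬ (∀ i, eval v (pderiv i f) = 0)

/-- `{f = g = 0}` is a smooth complete intersection: at every common nontrivial
zero the two gradients are linearly independent. -/
def IsSmoothCI2 {ι : Type} [Fintype ι] (f g : MvPolynomial ι ℂ) : Prop :=
  ∀ v : ι → ℂ, v ≠ 0 → eval v f = 0 → eval v g = 0 →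
    ∀ a b : ℂ, (∀ i, a * eval v (pderiv i f) + b * eval v (pderiv i g) = 0) →
      a = 0 ∧ b = 0

/-- `{f = g = h = 0}` is a smooth complete intersection: at every common
nontrivial zero the three gradients are linearly independent. -/
def IsSmoothCI3 {ι : Type} [Fintype ι] (f g h : MvPolynomial ι ℂ) : Prop :=
  ∀ v : ι → ℂ, v ≠ 0 → eval v f = 0 → eval v g = 0 → eval v h = 0 →
    ∀ a b c : ℂ,
      (∀ i, a * eval v (pderiv i f) + b * eval v (pderiv i g)
        + c * eval v (pderiv i h) = 0) →
      a = 0 ∧ b = 0 ∧ c = 0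

/-- A rational map from (a subvariety of) the projective space with coordinates
`ι` to `ℙ^n`, given by an `(n+1)`-tuple of homogeneous polynomials of a common
degree `e`. -/
structure RatMapTo (ι : Type) (n : ℕ) where
  F : Fin (n + 1) → MvPolynomial ι ℂ
  e : ℕ
  homog : ∀ j, (F j).IsHomogeneous e

namespace RatMapTo

variable {ι : Type} {n : ℕ}

def evalVec (φ : RatMapTo ι n) (v : ι → ℂ) : Fin (n + 1) → ℂ :=
  fun j => eval v (φ.F j)

/-- `φ` is defined at `x` and sends `x` to `y`. -/
def mapsTo (φ : RatMapTo ι n) (x : PPt ι) (y : PPt (Fin (n + 1))) : Prop :=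
  ∀ (v : ι → ℂ) (hv : v ≠ 0), Projectivization.mk ℂ v hv = x →
    ∃ hw : φ.evalVec v ≠ 0, Projectivization.mk ℂ (φ.evalVec v) hw = y

/-- The fiber over `y` of the restriction of `φ` to `X`. -/
def fiber (φ : RatMapTo ι n) (X : Set (PPt ι)) (y : PPt (Fin (n + 1))) :
    Set (PPt ι) :=
  {x ∈ X | φ.mapsTo x y}

/-- The restriction of `φ` to `X` is a dominant rational map of degree `δ`:
the fiber over a general point of `ℙ^n` consists of exactly `δ` points. -/
def DominantOfDegree (φ : RatMapTo ι n) (X : Set (PPt ι)) (δ : ℕ) : Prop :=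
  0 < δ ∧
  ∃ V : Set (PPt (Fin (n + 1))), ContainsDenseOpenOf Set.univ V ∧
    ∀ y ∈ V, (φ.fiber X y).Finite ∧ (φ.fiber X y).ncard = δ

end RatMapTo

/-- The degree of irrationality of `X`: the minimal degree of a dominant
rational map `X ⇢ ℙ^n`. -/
def irr {ι : Type} (n : ℕ) (X : Set (PPt ι)) : ℕ :=
  sInf {δ : ℕ | ∃ φ : RatMapTo ι n, φ.DominantOfDegree X δ}

/-- `ψ` is the linear projection away from the linear subspace `P(W)`:
it is given by linear forms whose common kernel is exactly `W`. -/
def IsLinearProjectionFrom {ι : Type} {n : ℕ} (ψ : RatMapTo ι n)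
    (W : Submodule ℂ (ι → ℂ)) : Prop :=
  ψ.e = 1 ∧ ∀ v : ι → ℂ, ψ.evalVec v = 0 ↔ v ∈ W

/-- The rational maps `φ` and `ψ` on `X` are birationally equivalent: they
differ by composition with a birational automorphism `τ` of the target `ℙ^n`. -/
def BirEquivTo {ι : Type} {n : ℕ} (X : Set (PPt ι)) (φ ψ : RatMapTo ι n) : Prop :=
  ∃ τ : RatMapTo (Fin (n + 1)) n, τ.DominantOfDegree Set.univ 1 ∧
    ∃ U : Set (PPt ι), ContainsDenseOpenOf X U ∧
      ∀ x ∈ U, ∃ y z, φ.mapsTo x y ∧ ψ.mapsTo x z ∧ τ.mapsTo z y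

/-- `A` is contained in a proper Zariski-closed subset of the (projective) space
of degree-`d` forms: it is cut out by a polynomial in the coefficients which is
not identically zero on degree-`d` forms. -/
def CoeffPolyProperClosed {ι : Type} (d : ℕ) (A : Set (MvPolynomial ι ℂ)) : Prop :=
  ∃ (κ : ℕ) (mons : Fin κ → (ι →₀ ℕ)) (Q : MvPolynomial (Fin κ) ℂ),
    (∀ g ∈ A, eval (fun j => coeff (mons j) g) Q = 0) ∧
    (∃ g : MvPolynomial ι ℂ, g.IsHomogeneous d ∧
      eval (fun j => coeff (mons j) g) Q ≠ 0)

end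

/-- Plücker coordinate index: `k`-element subsets of `Fin m`. -/
abbrev PluckIdx (k m : ℕ) : Type := {s : Finset (Fin m) // s.card = k}

/-- The Plücker coordinates of a `k`-tuple of vectors in `ℂ^m`. -/
def pluckerCoord (k m : ℕ) (w : Fin k → Fin m → ℂ) : PluckIdx k m → ℂ :=
  fun S => Matrix.det (Matrix.of fun i j => w i (↑(S.1.orderIsoOfFin S.2 j)))

/-- The Plücker-embedded Grassmannian `Gr(k,m)` as a subset of the
projectivization of `Λ^k ℂ^m`: the locus of (classes of) nonzero decomposable
Plücker vectors. -/
def GrassSet (k m : ℕ) : Set (PPt (PluckIdx k m)) :=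
  {x | ∃ (w : Fin k → Fin m → ℂ) (hw : pluckerCoord k m w ≠ 0),
        Projectivization.mk ℂ (pluckerCoord k m w) hw = x}

section
open MvPolynomial
noncomputable section
namespace Irr

section DerBasics
variable {F : Type*} [Field F] [CharZero F]

/-- constants of a derivation -/
def Dconst (D : Derivation ℚ F F) : IntermediateField ℚ F where
  carrier := {x | D x = 0}
  mul_mem' := by intro a b ha hb; simp only [Set.mem_ofPred_eq] at *; simp [ha, hb]
  add_mem' := by intro a b ha hb; simp only [Set.mem_ofPred_eq] at *; simp [ha, hb]
  algebraMap_mem' := by intro r; exact D.map_algebraMap r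
  inv_mem' := by intro x hx; simp only [Set.mem_ofPred_eq] at *; simp [Derivation.leibniz_inv, hx]

lemma mem_Dconst {D : Derivation ℚ F F} {x : F} : x ∈ Dconst D ↔ D x = 0 := Iff.rfl

/-- a derivation is linear over its constants -/
def Dlin (D : Derivation ℚ F F) (κ : IntermediateField ℚ F) (h : ∀ x ∈ κ, D x = 0) :
    Derivation κ F F where
  toFun := D
  map_add' := by simp
  map_smul' := by
    intro r x
    simp only [IntermediateField.smul_def, smul_eq_mul, RingHom.id_apply, Derivation.leibniz,
      h r.1 r.2, mul_zero, add_zero]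
  map_one_eq_zero' := by simp
  leibniz' := by simp

lemma der_alg_zero (D : Derivation ℚ F F) (κ : IntermediateField ℚ F) (h : ∀ x ∈ κ, D x = 0)
    (x : F) (hx : IsAlgebraic κ x) : D x = 0 := by
  have h1 : (Dlin D κ h) (Polynomial.aeval x (minpoly κ x)) =
     Polynomial.aeval x (minpoly κ x).derivative • (Dlin D κ h) x :=
    Derivation.map_aeval _ _ _
  rw [minpoly.aeval, map_zero] at h1
  have hsep : (minpoly κ x).Separable := (minpoly.irreducible hx.isIntegral).separable
  have h2 := hsep.aeval_derivative_ne_zero (minpoly.aeval κ x)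
  have h3 := (smul_eq_zero.1 h1.symm).resolve_left h2
  exact h3

lemma exists_ext_der {R S T : Type*} [CommRing R] [CommRing S] [CommRing T] [Algebra R S]
    [Algebra S T] [Algebra R T] [IsScalarTower R S T] [Algebra.FormallyEtale S T]
    (d : Derivation R S T) : ∃ D : Derivation R T T, ∀ s, D (algebraMap S T s) = d s := by
  let e := KaehlerDifferential.tensorKaehlerEquivOfFormallyEtale R S T
  let l : TensorProduct S T (Ω[S⁄R]) →ₗ[T] T := (d.liftKaehlerDifferential).liftBaseChange T
  refine ⟨(l ∘ₗ e.symm.toLinearMap).compDer (KaehlerDifferential.D R T), fun s => ?_⟩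
  change l (e.symm (KaehlerDifferential.D R T (algebraMap S T s))) = _
  rw [KaehlerDifferential.tensorKaehlerEquivOfFormallyEtale_symm_D_algebraMap]
  simp [l]

lemma exists_der {I : Type*} (b : I → F) (hb : IsTranscendenceBasis ℚ b) (v : I → F) :
    ∃ D : Derivation ℚ F F, ∀ i, D (b i) = v i := by
  let S := MvPolynomial I ℚ
  letI : Algebra S F := (aeval b).toAlgebra
  haveI : IsScalarTower ℚ S F := IsScalarTower.of_algebraMap_eq (fun r => by
    exact ((aeval b).commutes r).symm)
  have hinj : Function.Injective (algebraMap S F) := hb.1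
  haveI : FaithfulSMul S F := (faithfulSMul_iff_algebraMap_injective S F).2 hinj
  letI : Algebra (FractionRing S) F := FractionRing.liftAlgebra S F
  haveI : IsScalarTower S (FractionRing S) F := FractionRing.isScalarTower_liftAlgebra S F
  haveI : Algebra.IsAlgebraic S F := by
    constructor
    intro x
    have h1 := (hb.isAlgebraic).isAlgebraic x
    obtain ⟨p, hp, hpx⟩ := h1
    let f : Algebra.adjoin ℚ (Set.range b) ≃ₐ[ℚ] S := hb.1.aevalEquiv.symm
    refine ⟨p.map f.toRingEquiv.toRingHom, ?_, ?_⟩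
    · rwa [Ne, Polynomial.map_eq_zero_iff f.injective]
    · rw [← hpx, Polynomial.aeval_def, Polynomial.eval₂_map, Polynomial.aeval_def]
      congr 1
      ext ⟨y, hy⟩
      exact hb.1.aeval_repr ⟨y, hy⟩
  haveI : Algebra.IsAlgebraic (FractionRing S) F := by
    exact Algebra.IsAlgebraic.extendScalars (R := S) (S := FractionRing S) (A := F)
      (IsFractionRing.injective S (FractionRing S))
  haveI : Algebra.IsSeparable (FractionRing S) F := inferInstance
  haveI : Algebra.FormallyEtale (FractionRing S) F := Algebra.FormallyEtale.of_isSeparable _ _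
  haveI : Algebra.FormallyEtale S (FractionRing S) :=
    Algebra.FormallyEtale.of_isLocalization (nonZeroDivisors S)
  haveI : Algebra.FormallyEtale S F := Algebra.FormallyEtale.comp S (FractionRing S) F
  let d0 : Derivation ℚ S F := mkDerivation ℚ v
  obtain ⟨D, hD⟩ := exists_ext_der d0
  refine ⟨D, fun i => ?_⟩
  have := hD (X i)
  rw [mkDerivation_X] at this
  rw [← this]
  congr 1
  change _ = aeval b (X i)
  simp

/-- A family of commuting coordinate derivations attached to a transcendence basis. -/
structure DB (F : Type*) [Field F] [CharZero F] (I : Type*) where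
  b : I → F
  tb : IsTranscendenceBasis ℚ b
  d : I → Derivation ℚ F F
  d_self : ∀ i, d i (b i) = 1
  d_ne : ∀ i j, i ≠ j → d i (b j) = 0

lemma exists_DB {I : Type*} (b : I → F) (hb : IsTranscendenceBasis ℚ b) :
    ∃ Δ : DB F I, Δ.b = b := by
  classical
  choose d hd using fun i => exists_der b hb (Pi.single i 1)
  exact ⟨⟨b, hb, d, fun i => by simp [hd], fun i j h => by
    rw [hd]; simp [Pi.single_apply, h.symm]⟩, rfl⟩

lemma alg_of_le {K : Type*} [Field K] [Algebra K F] (A : Subalgebra ℚ F)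
    (B : IntermediateField K F) (hle : ∀ y ∈ A, y ∈ B) (hA : Algebra.IsAlgebraic A F) :
    Algebra.IsAlgebraic B F := by
  constructor
  intro x
  obtain ⟨p, hp, hpx⟩ := hA.isAlgebraic x
  let f : A →+* B :=
    { toFun := fun y => ⟨y.1, hle y.1 y.2⟩
      map_one' := rfl
      map_mul' := fun _ _ => rfl
      map_zero' := rfl
      map_add' := fun _ _ => rfl }
  have hf : Function.Injective f := fun y z h => by
    apply Subtype.ext
    exact congrArg (fun w : B => w.1) h
  refine ⟨p.map f, ?_, ?_⟩
  · rwa [Ne, Polynomial.map_eq_zero_iff hf]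
  · rw [← hpx, Polynomial.aeval_def, Polynomial.eval₂_map, Polynomial.aeval_def]
    congr 1

namespace DB
variable {I : Type*} (Δ : DB F I)
include Δ

lemma der_eq_zero (D : Derivation ℚ F F) (h : ∀ i, D (Δ.b i) = 0) : D = 0 := by
  ext x
  have h1 := (Δ.tb.isAlgebraic).isAlgebraic x
  have hle : Algebra.adjoin ℚ (Set.range Δ.b) ≤ (Dconst D).toSubalgebra := by
    rw [Algebra.adjoin_le_iff]
    rintro _ ⟨i, rfl⟩
    exact h i
  refine der_alg_zero D (Dconst D) (fun _ h => h) x ?_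
  letI := (Subalgebra.inclusion hle).toAlgebra
  obtain ⟨p, hp, hpx⟩ := h1
  refine ⟨p.map (Subalgebra.inclusion hle).toRingHom, ?_, ?_⟩
  · rwa [Ne, Polynomial.map_eq_zero_iff (Subalgebra.inclusion_injective hle)]
  · rw [← hpx, Polynomial.aeval_def, Polynomial.eval₂_map, Polynomial.aeval_def]
    congr 1

lemma comm (i j : I) (x : F) : Δ.d i (Δ.d j x) = Δ.d j (Δ.d i x) := by
  have h := Δ.der_eq_zero ⁅Δ.d i, Δ.d j⁆ (fun l => by
    rw [Derivation.commutator_apply]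
    have : ∀ a c, Δ.d a (Δ.d c (Δ.b l)) = 0 := by
      intro a c
      by_cases hc : c = l
      · subst hc; rw [Δ.d_self]; simp
      · rw [Δ.d_ne c l hc]; simp
    simp [this])
  have := congrArg (fun D => D x) h
  simp only [Derivation.commutator_apply, Derivation.coe_zero, Pi.zero_apply] at this
  exact sub_eq_zero.1 this

/-- elements killed by almost all derivations, off the finite set -/
lemma finite_supp (x : F) : {i | Δ.d i x ≠ 0}.Finite := by
  classical
  let κ : IntermediateField ℚ F :=
  { carrier := {x | {i | Δ.d i x ≠ 0}.Finite}
    mul_mem' := by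
      intro a b ha hb
      refine (Set.Finite.union ha hb).subset ?_
      intro i hi
      by_contra hc
      simp only [Set.mem_union, Set.mem_ofPred_eq, not_or, not_not] at hc
      exact hi (by simp [hc.1, hc.2])
    add_mem' := by
      intro a b ha hb
      refine (Set.Finite.union ha hb).subset ?_
      intro i hi
      by_contra hc
      simp only [Set.mem_union, Set.mem_ofPred_eq, not_or, not_not] at hc
      exact hi (by simp [hc.1, hc.2])
    algebraMap_mem' := by
      intro r
      have : {i | Δ.d i (algebraMap ℚ F r) ≠ 0} = ∅ := by
        ext i
        simp only [Set.mem_ofPred_eq, Set.mem_empty_iff_false, iff_false, not_not]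
        exact (Δ.d i).map_algebraMap r
      change {i | Δ.d i (algebraMap ℚ F r) ≠ 0}.Finite
      rw [this]
      exact Set.finite_empty
    inv_mem' := by
      intro a ha
      refine Set.Finite.subset ha ?_
      intro i hi hc
      exact hi (by simp [Derivation.leibniz_inv, hc]) }
  have hle : Algebra.adjoin ℚ (Set.range Δ.b) ≤ κ.toSubalgebra := by
    rw [Algebra.adjoin_le_iff]
    rintro _ ⟨j, rfl⟩
    refine (Set.finite_singleton j).subset ?_
    intro i hi
    by_contra hc
    exact hi (Δ.d_ne i j hc)
  obtain ⟨p, hp, hpx⟩ := (Δ.tb.isAlgebraic).isAlgebraic x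
  have hfin : (⋃ n ∈ p.support, {i | Δ.d i (p.coeff n : F) ≠ 0}).Finite := by
    refine Set.Finite.biUnion p.support.finite_toSet ?_
    intro n _
    exact hle (p.coeff n).2
  refine hfin.subset ?_
  intro i hi
  by_contra hc
  simp only [Set.mem_iUnion, not_exists, Set.mem_ofPred_eq, not_not] at hc
  apply hi
  have hcoef : ∀ n, Δ.d i (p.coeff n : F) = 0 := by
    intro n
    by_cases hn : n ∈ p.support
    · exact hc n hn
    · rw [Polynomial.notMem_support_iff.1 hn]; simp
  refine der_alg_zero (Δ.d i) (Dconst (Δ.d i)) (fun _ h => h) x ?_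
  let q : Polynomial (Dconst (Δ.d i)) := ∑ n ∈ p.support,
    Polynomial.monomial n ⟨(p.coeff n : F), hcoef n⟩
  have hq : q.map (algebraMap _ F) = p.map (algebraMap _ F) := by
    conv_rhs => rw [p.as_sum_support]
    simp only [q, Polynomial.map_sum, Polynomial.map_monomial]
    rfl
  refine ⟨q, ?_, ?_⟩
  · intro h0
    rw [h0, Polynomial.map_zero] at hq
    exact hp ((Polynomial.map_eq_zero_iff Subtype.val_injective).1 hq.symm)
  · rw [Polynomial.aeval_def, ← Polynomial.eval_map, hq, Polynomial.eval_map,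
      ← Polynomial.aeval_def, hpx]

lemma alg_over (i : I) :
    Algebra.IsAlgebraic (IntermediateField.adjoin (Dconst (Δ.d i)) {Δ.b i}) F := by
  refine alg_of_le (Algebra.adjoin ℚ (Set.range Δ.b)) _ ?_ Δ.tb.isAlgebraic
  intro y hy
  induction hy using Algebra.adjoin_induction with
  | mem x hx =>
    obtain ⟨j, rfl⟩ := hx
    by_cases hij : i = j
    · rw [← hij]
      exact IntermediateField.mem_adjoin_simple_self _ _
    · have : Δ.b j ∈ Dconst (Δ.d i) := Δ.d_ne i j hij
      exact IntermediateField.algebraMap_mem _ (⟨Δ.b j, this⟩ : Dconst (Δ.d i))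
  | algebraMap r =>
    have : (algebraMap ℚ F r) ∈ Dconst (Δ.d i) := (Δ.d i).map_algebraMap r
    exact IntermediateField.algebraMap_mem _ (⟨_, this⟩ : Dconst (Δ.d i))
  | add x y _ _ h1 h2 => exact add_mem h1 h2
  | mul x y _ _ h1 h2 => exact mul_mem h1 h2

lemma presconst (i j : I) (x : F) (h : Δ.d i x = 0) : Δ.d i (Δ.d j x) = 0 := by
  rw [Δ.comm, h, map_zero]

end DB
end DerBasics
end Irr
end
end

section
open WithZero
namespace Irr

lemma val_core {L : Type*} [Field L] [CharZero L] (v : Valuation L ℤᵐ⁰) (D : Derivation ℚ L L)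
    (K0 : Set L) (hK0 : ∀ c ∈ K0, v c ≤ 1) (hDK : ∀ c ∈ K0, D c ∈ K0)
    (hQ : ∀ n : ℕ, n ≠ 0 → v (n : L) = 1)
    (hres : ∀ x, v x ≤ 1 → ∃ c ∈ K0, v (x - c) < 1)
    (π : L) (hπ : v π = exp (-1 : ℤ)) (C : ℕ) (hC : ∀ x, v x ≤ 1 → v (D x) ≤ exp (C : ℤ))
    (u : L) (hu0 : u ≠ 0) (hu : v u < 1) (hDu : ∃ c ∈ K0, D u = c * u) :
    (∀ x, v x ≤ 1 → v (D x) ≤ 1) ∧ ((∀ c ∈ K0, D c = 0) → ∀ x, v x ≤ 1 → v (D x) < 1) := by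
  have hπ0 : π ≠ 0 := by
    intro h; rw [h, map_zero] at hπ; exact absurd hπ.symm exp_ne_zero
  have hlt : ∀ y : L, v y < 1 → v (y / π) ≤ 1 := by
    intro y hy
    by_cases h0 : y = 0
    · simp [h0]
    have hy0 : v y ≠ 0 := (Valuation.ne_zero_iff v).2 h0
    rw [map_div₀, hπ]
    rw [← exp_log hy0] at hy ⊢
    rw [← exp_zero, exp_lt_exp] at hy
    rw [div_eq_mul_inv, ← exp_neg, ← exp_add, ← exp_zero, exp_le_exp]
    omega
  have hdec : ∀ x, v x ≤ 1 → ∃ c ∈ K0, ∃ x', v x' ≤ 1 ∧ x = c + π * x' := by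
    intro x hx
    obtain ⟨c, hc, hxc⟩ := hres x hx
    exact ⟨c, hc, (x - c) / π, hlt _ hxc, by field_simp; ring⟩
  have hstar : ∀ N : ℕ, ∀ x, v x ≤ 1 → v (D x) ≤ max (max 1 (v (D π))) (exp ((C : ℤ) - N)) := by
    intro N
    induction N with
    | zero => intro x hx; exact (hC x hx).trans (by simp)
    | succ N ih =>
      intro x hx
      obtain ⟨c, hc, x', hx', rfl⟩ := hdec x hx
      have e1 : D (c + π * x') = D c + (x' * D π + π * D x') := by
        simp; ring
      rw [e1]
      refine (v.map_add _ _).trans (max_le ?_ ((v.map_add _ _).trans (max_le ?_ ?_)))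
      · exact (hK0 _ (hDK c hc)).trans (by simp)
      · rw [map_mul]
        calc v x' * v (D π) ≤ 1 * v (D π) := by gcongr
          _ ≤ _ := by simp
      · rw [map_mul, hπ]
        have h1 := ih x' hx'
        have hm : exp (-1 : ℤ) ≤ 1 := by rw [← exp_zero, exp_le_exp]; omega
        rcases le_max_iff.1 h1 with h2 | h2
        · calc exp (-1 : ℤ) * v (D x') ≤ 1 * v (D x') := by gcongr
            _ = v (D x') := one_mul _
            _ ≤ _ := h2.trans (le_max_left _ _)
        · refine le_max_of_le_right ?_
          calc exp (-1 : ℤ) * v (D x') ≤ exp (-1 : ℤ) * exp ((C : ℤ) - N) := by gcongr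
            _ = exp ((C : ℤ) - (N + 1 : ℕ)) := by
              rw [← exp_add]; congr 1; push_cast; ring
  have hb : ∀ x, v x ≤ 1 → v (D x) ≤ max 1 (v (D π)) := by
    intro x hx
    refine (hstar C x hx).trans (max_le le_rfl ?_)
    simp
  -- write u = ε π ^ e
  have hvu0 : v u ≠ 0 := (Valuation.ne_zero_iff v).2 hu0
  obtain ⟨e, he, hve⟩ : ∃ e : ℕ, e ≠ 0 ∧ v u = v π ^ e := by
    have h1 : v u = exp (log (v u)) := (exp_log hvu0).symm
    have h2 : log (v u) < 0 := by
      rw [h1, ← exp_zero, exp_lt_exp] at hu; exact hu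
    refine ⟨(-(log (v u))).toNat, by omega, ?_⟩
    rw [hπ, ← exp_nsmul]
    conv_lhs => rw [h1]
    congr 1
    simp; omega
  have hDπ : v (D π) < 1 := by
    obtain ⟨c, hc, hDu⟩ := hDu
    set ε := u / π ^ e with hε
    have hvε : v ε = 1 := by
      rw [hε, map_div₀, map_pow, hve, div_self]
      rw [← hve]; exact hvu0
    have hε0 : ε ≠ 0 := by intro h; rw [h, map_zero] at hvε; exact zero_ne_one hvε
    have hue : u = ε * π ^ e := by rw [hε]; field_simp
    clear_value ε
    have hε2 : ε * (D ε / ε) = D ε := by field_simp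
    have key : (e : L) * D π = π * (c - D ε / ε) := by
      have h1 := hDu
      rw [hue] at h1
      rw [Derivation.leibniz, Derivation.leibniz_pow] at h1
      simp only [smul_eq_mul, nsmul_eq_mul] at h1
      obtain ⟨e', rfl⟩ := Nat.exists_eq_succ_of_ne_zero he
      simp only [Nat.succ_eq_add_one, Nat.add_sub_cancel, pow_succ] at h1
      have hp : π ^ e' ≠ 0 := pow_ne_zero _ hπ0
      have : (ε * π ^ e') * (((e' + 1 : ℕ) : L) * D π) = (ε * π ^ e') * (π * (c - D ε / ε)) := by
        linear_combination h1 + π ^ e' * π * hε2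
      exact mul_left_cancel₀ (mul_ne_zero hε0 hp) this
    have h3 : v (D π) = exp (-1 : ℤ) * v (c - D ε / ε) := by
      have := congrArg v key
      rwa [map_mul, map_mul, hQ e he, one_mul, hπ] at this
    have h4 : v (c - D ε / ε) ≤ max 1 (v (D π)) := by
      refine (v.map_sub _ _).trans (max_le ((hK0 c hc).trans (le_max_left _ _)) ?_)
      rw [map_div₀, hvε, div_one]
      exact hb ε hvε.le
    have hm : exp (-1 : ℤ) < (1 : ℤᵐ⁰) := by rw [← exp_zero, exp_lt_exp]; omega
    by_contra hcon
    rw [not_lt] at hcon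
    rw [max_eq_right hcon] at h4
    have : v (D π) < v (D π) := by
      calc v (D π) = exp (-1 : ℤ) * v (c - D ε / ε) := h3
        _ ≤ exp (-1 : ℤ) * v (D π) := by gcongr
        _ < 1 * v (D π) := by
          have : 0 < v (D π) := lt_of_lt_of_le zero_lt_one hcon
          gcongr
        _ = v (D π) := one_mul _
    exact lt_irrefl _ this
  have hA : ∀ x, v x ≤ 1 → v (D x) ≤ 1 := by
    intro x hx
    refine (hb x hx).trans (max_le le_rfl hDπ.le)
  refine ⟨hA, fun hK x hx => ?_⟩
  obtain ⟨c, hc, x', hx', rfl⟩ := hdec x hx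
  have e1 : D (c + π * x') = x' * D π + π * D x' := by
    simp [hK c hc]; ring
  rw [e1]
  refine v.map_add_lt ?_ ?_
  · rw [map_mul]
    calc v x' * v (D π) ≤ 1 * v (D π) := by gcongr
      _ < 1 := by simpa using hDπ
  · rw [map_mul, hπ]
    calc exp (-1 : ℤ) * v (D x') ≤ exp (-1 : ℤ) * 1 := by gcongr; exact hA x' hx'
      _ < 1 := by rw [mul_one, ← exp_zero, exp_lt_exp]; omega

end Irr
end

section
open WithZero
namespace Irr

lemma dvr_core {K A M L : Type*} [Field K] [IsAlgClosed K] [CommRing A] [IsDomain A]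
    [IsDedekindDomain A] [Field M] [Field L] [CharZero L] [Algebra A M] [IsFractionRing A M]
    [Algebra M L] [Algebra A L] [IsScalarTower A M L] [FiniteDimensional M L]
    [Algebra.IsSeparable M L] [Algebra K A] [Algebra K L] [IsScalarTower K A L]
    (O : ValuationSubring L) (hA : ∀ a : A, algebraMap A L a ∈ O) (t : A)
    (ht0 : algebraMap A L t ≠ 0)
    (ht : O.valuation (algebraMap A L t) < 1)
    (hev : ∀ a : A, ∃ c : K, ∃ a' : A, a = algebraMap K A c + t * a')
    (D : Derivation ℚ L L) (hDA : ∀ a : A, ∃ b : A, D (algebraMap A L a) = algebraMap A L b)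
    (hDK : ∀ c : K, ∃ c' : K, D (algebraMap K L c) = algebraMap K L c')
    (hDt : ∃ c : K, D (algebraMap A L t) = algebraMap K L c * algebraMap A L t) :
    (∀ x ∈ O, D x ∈ O) ∧
    ((∀ c : K, D (algebraMap K L c) = 0) → ∀ x ∈ O, O.valuation (D x) < 1) := by
  let B := integralClosure A L
  haveI : IsDedekindDomain B := integralClosure.isDedekindDomain A M L
  haveI : IsFractionRing B L := integralClosure.isFractionRing_of_finite_extension M L
  haveI : Module.Finite A B := IsIntegralClosure.finite A M L B
  have hK : ∀ c : K, algebraMap K L c ∈ O := fun c => by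
    rw [IsScalarTower.algebraMap_apply K A L]; exact hA _
  have hB : ∀ b : B, (b : L) ∈ O := by
    intro b
    have hb : IsIntegral A (b : L) := b.2
    obtain ⟨p, hp, hpb⟩ := hb
    let f : A →+* O := (algebraMap A L).codRestrict O hA
    have h2 : IsIntegral O (b : L) := by
      refine ⟨p.map f, hp.map f, ?_⟩
      rw [Polynomial.eval₂_map]
      exact hpb
    obtain ⟨y, hy⟩ := (IsIntegrallyClosed.isIntegral_iff (R := O) (K := L)).1 h2
    rw [← hy]; exact y.2
  let φ : B →+* O := (algebraMap B L).codRestrict O hB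
  let P : Ideal B := (IsLocalRing.maximalIdeal O).comap φ
  have hPmem : ∀ b : B, b ∈ P ↔ O.valuation (b : L) < 1 := by
    intro b
    rw [Ideal.mem_comap, O.valuation_lt_one_iff]; rfl
  have hPpr : P.IsPrime := Ideal.comap_isPrime _ _
  let tB : B := algebraMap A B t
  have htB : (tB : L) = algebraMap A L t := rfl
  have hPbot : P ≠ ⊥ := by
    intro h
    have : tB ∈ P := (hPmem _).2 (by rw [htB]; exact ht)
    rw [h, Ideal.mem_bot] at this
    exact ht0 (by rw [← htB, this]; rfl)
  let w : IsDedekindDomain.HeightOneSpectrum B := ⟨P, hPpr, hPbot⟩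
  let v := w.valuation L
  have hvB : ∀ b : B, v (b : L) ≤ 1 := fun b => w.valuation_le_one b
  have hvBlt : ∀ b : B, v (b : L) < 1 ↔ O.valuation (b : L) < 1 := fun b => by
    rw [← hPmem]; exact w.valuation_lt_one_iff_mem b
  have hfrac : ∀ x, v x ≤ 1 → ∃ a s : B, v (s : L) = 1 ∧ O.valuation (s : L) = 1 ∧ x * s = a := by
    intro x hx
    obtain ⟨n, d, h⟩ := w.exists_primeCompl_mul_eq_or_mul_eq x
    have hd1 : ∀ d : B, d ∉ P → v (d : L) = 1 ∧ O.valuation (d : L) = 1 := by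
      intro d hd
      have h1 : ¬ O.valuation (d : L) < 1 := fun h => hd ((hPmem _).2 h)
      have h2 : ¬ v (d : L) < 1 := fun h => h1 ((hvBlt _).1 h)
      exact ⟨le_antisymm (hvB d) (not_lt.1 h2),
        le_antisymm ((O.valuation_le_one_iff _).2 (hB d)) (not_lt.1 h1)⟩
    have hd := hd1 d.1 d.2
    rcases h with h | h
    · exact ⟨n, d.1, hd.1, hd.2, h⟩
    · have h' : x * (n : L) = ((d.1 : B) : L) := h
      have hvn : v (n : L) = 1 := by
        refine le_antisymm (hvB n) ?_
        have := congrArg v h'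
        rw [map_mul, hd.1] at this
        calc (1 : ℤᵐ⁰) = v x * v (n : L) := this.symm
          _ ≤ 1 * v (n : L) := by gcongr
          _ = _ := one_mul _
      have hnP : n ∉ P := fun hn => by
        have := (hvBlt n).2 ((hPmem n).1 hn)
        exact absurd hvn this.ne
      have hn := hd1 n hnP
      have hn0 : (n : L) ≠ 0 := by intro h0; rw [h0, map_zero] at hvn; exact zero_ne_one hvn
      have hx1 : v x = 1 := by
        have := congrArg v h'
        rwa [map_mul, hd.1, hvn, mul_one] at this
      exact ⟨d.1, n, hn.1, hn.2, h'⟩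
  have hle : ∀ x, v x ≤ 1 → x ∈ O := by
    intro x hx
    obtain ⟨a, s, hs, hs', h⟩ := hfrac x hx
    rw [← O.valuation_le_one_iff]
    have := congrArg O.valuation h
    rw [map_mul, hs', mul_one] at this
    rw [this]; exact (O.valuation_le_one_iff _).2 (hB a)
  have hlt : ∀ x, v x < 1 → O.valuation x < 1 := by
    intro x hx
    obtain ⟨a, s, hs, hs', h⟩ := hfrac x hx.le
    have h1 := congrArg O.valuation h
    have h2 := congrArg v h
    rw [map_mul, hs', mul_one] at h1
    rw [map_mul, hs, mul_one] at h2
    rw [h1, ← hvBlt, ← h2]; exact hx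
  have hle' : ∀ x, x ∈ O → v x ≤ 1 := by
    intro x hx
    by_contra hc
    rw [not_le] at hc
    have hx0 : x ≠ 0 := by intro h; rw [h, map_zero] at hc; exact absurd hc (by simp)
    have h1 : v x⁻¹ < 1 := by rw [map_inv₀]; exact inv_lt_one_of_one_lt₀ hc
    have h2 := hlt _ h1
    rw [map_inv₀] at h2
    have h3 := (O.valuation_le_one_iff x).2 hx
    have h4 : O.valuation x ≠ 0 := (Valuation.ne_zero_iff _).2 hx0
    have h5 : (O.valuation x)⁻¹ * O.valuation x < 1 * 1 := by
      exact mul_lt_mul'' h2 (lt_of_le_of_ne h3 (fun h => by rw [h] at h2; simp at h2))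
        (zero_le) (zero_le)
    rw [inv_mul_cancel₀ h4] at h5
    simp at h5
  -- residues
  have hlt' : ∀ x, O.valuation x < 1 → v x < 1 := by
    intro x hx
    have h1 := hle' x ((O.valuation_le_one_iff x).1 hx.le)
    refine lt_of_le_of_ne h1 (fun h => ?_)
    have hx0 : x ≠ 0 := by intro h0; rw [h0, map_zero] at h; exact zero_ne_one h
    have h2 : v x⁻¹ ≤ 1 := by rw [map_inv₀, h, inv_one]
    have h3 := (O.valuation_le_one_iff _).2 (hle _ h2)
    rw [map_inv₀] at h3
    have h4 : O.valuation x ≠ 0 := (Valuation.ne_zero_iff _).2 hx0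
    have := (inv_le_one₀ (zero_lt_iff.2 h4)).1 h3
    exact absurd hx (not_lt.2 this)
  have hresB : ∀ b : B, ∃ c : K, v ((b : L) - algebraMap K L c) < 1 := by
    intro b
    obtain ⟨p, hp, hpb⟩ : IsIntegral A (b : L) := b.2
    -- reduction of A
    choose c a' hca using hev
    by_contra hcon
    push Not at hcon
    let q : Polynomial K := ∑ i ∈ Finset.range p.natDegree, Polynomial.monomial i (c (p.coeff i))
      + Polynomial.X ^ p.natDegree
    have hqlt : (∑ i ∈ Finset.range p.natDegree,
        Polynomial.monomial i (c (p.coeff i))).degree < p.natDegree := by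
      refine (Polynomial.degree_sum_le _ _).trans_lt ?_
      rw [Finset.sup_lt_iff (by exact_mod_cast WithBot.bot_lt_coe _)]
      intro i hi
      exact (Polynomial.degree_monomial_le _ _).trans_lt
        (by exact_mod_cast Finset.mem_range.1 hi)
    have hqm : q.Monic := by
      simp only [q]
      rw [add_comm]
      exact Polynomial.monic_X_pow_add hqlt
    have hval : v (Polynomial.aeval (b : L) q) < 1 := by
      have h1 : Polynomial.aeval (b : L) q =
          - (algebraMap A L t * ∑ i ∈ Finset.range p.natDegree,
              algebraMap A L (a' (p.coeff i)) * (b : L) ^ i) := by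
        rw [Polynomial.eval₂_eq_sum_range, Finset.sum_range_succ,
          hp.coeff_natDegree, map_one, one_mul] at hpb
        simp only [q, map_add, map_sum, Polynomial.aeval_monomial, map_pow, Polynomial.aeval_X]
        rw [eq_neg_iff_add_eq_zero, ← hpb, Finset.mul_sum, add_right_comm,
          ← Finset.sum_add_distrib]
        congr 1
        refine Finset.sum_congr rfl fun i _ => ?_
        conv_rhs => rw [hca (p.coeff i)]
        rw [map_add, map_mul, ← IsScalarTower.algebraMap_apply K A L]
        ring
      rw [h1, Valuation.map_neg, map_mul]
      have h2 : v (∑ i ∈ Finset.range p.natDegree,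
              algebraMap A L (a' (p.coeff i)) * (b : L) ^ i) ≤ 1 := by
        apply hle'
        exact sum_mem fun i _ => mul_mem (hA _) (pow_mem (hB b) _)
      calc v (algebraMap A L t) * _ ≤ v (algebraMap A L t) * 1 := by gcongr
        _ < 1 := by rw [mul_one]; exact hlt' _ ht
    have hsplit : q.Splits := IsAlgClosed.splits q
    have hms : ∀ s : Multiset K, 1 ≤ v (Polynomial.aeval (b : L)
        (s.map (fun a => Polynomial.X - Polynomial.C a)).prod) := by
      intro s
      induction s using Multiset.induction_on with
      | empty => simp
      | cons a s ih =>
        rw [Multiset.map_cons, Multiset.prod_cons, map_mul, map_mul]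
        refine one_le_mul (α := ℤᵐ⁰) ?_ ih
        simpa using hcon a
    have := hms q.roots
    rw [← hsplit.eq_prod_roots_of_monic hqm] at this
    exact absurd hval (not_lt.2 this)
  have hres : ∀ x, v x ≤ 1 → ∃ c ∈ Set.range (algebraMap K L), v (x - c) < 1 := by
    intro x hx
    obtain ⟨a, s, hs, hs', h⟩ := hfrac x hx
    obtain ⟨α, hα⟩ := hresB a
    obtain ⟨β, hβ⟩ := hresB s
    have hvK : ∀ c : K, v (algebraMap K L c) ≤ 1 := fun c => hle' _ (hK c)
    have hβ0 : β ≠ 0 := by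
      rintro rfl
      rw [map_zero, sub_zero, hs] at hβ
      exact lt_irrefl _ hβ
    refine ⟨algebraMap K L (α / β), ⟨_, rfl⟩, ?_⟩
    have hs0 : (s : L) ≠ 0 := by intro h0; rw [h0, map_zero] at hs; exact zero_ne_one hs
    have hb0 : algebraMap K L β ≠ 0 := by simpa using hβ0
    have e : (x - algebraMap K L (α / β)) * s = ((a : L) - algebraMap K L α)
        - algebraMap K L (α / β) * ((s : L) - algebraMap K L β) := by
      rw [sub_mul, h, map_div₀]; field_simp; ring
    have h2 : v ((x - algebraMap K L (α / β)) * s) < 1 := by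
      rw [e]
      refine v.map_sub_lt hα ?_
      rw [map_mul]
      calc v (algebraMap K L (α / β)) * _ ≤ 1 * v ((s : L) - algebraMap K L β) := by
            gcongr; exact hvK _
        _ < 1 := by simpa using hβ
    rwa [map_mul, hs, mul_one] at h2
  obtain ⟨π, hπ⟩ := w.valuation_exists_uniformizer L
  obtain ⟨C, hC1⟩ : ∃ C : ℕ, ∀ b : B, v (D (b : L)) ≤ exp (C : ℤ) := by
    obtain ⟨S, hS⟩ := (inferInstance : Module.Finite A B).fg_top
    have hfin : ∀ S : Finset B, ∃ C : ℕ, ∀ b ∈ S, v (D (b : L)) ≤ exp (C : ℤ) := by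
      classical
      intro S
      induction S using Finset.induction_on with
      | empty => exact ⟨0, by simp⟩
      | insert b S _ ih =>
        obtain ⟨C, hC⟩ := ih
        refine ⟨max C (log (v (D (b : L)))).toNat, fun x hx => ?_⟩
        rcases Finset.mem_insert.1 hx with rfl | hx
        · by_cases h0 : v (D (x : L)) = 0
          · rw [h0]; exact zero_le
          · conv_lhs => rw [← exp_log h0]
            rw [exp_le_exp]; push_cast; omega
        · refine (hC x hx).trans ?_
          rw [exp_le_exp]; push_cast; omega
    obtain ⟨C, hC⟩ := hfin S
    refine ⟨C, fun b => ?_⟩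
    have h1C : (1 : ℤᵐ⁰) ≤ exp (C : ℤ) := by rw [← exp_zero, exp_le_exp]; omega
    have hb : b ∈ Submodule.span A (S : Set B) := by rw [hS]; trivial
    induction hb using Submodule.span_induction with
    | mem x hx => exact hC x hx
    | zero => simp
    | add x y _ _ h1 h2 =>
      have : D ((x + y : B) : L) = D (x : L) + D (y : L) := by
        rw [← map_add]; rfl
      rw [this]
      exact (v.map_add _ _).trans (max_le h1 h2)
    | smul a x _ h1 =>
      have e1 : ((a • x : B) : L) = algebraMap A L a * (x : L) := Algebra.smul_def a (x : L)
      obtain ⟨a', ha'⟩ := hDA a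
      rw [e1, Derivation.leibniz, ha', smul_eq_mul, smul_eq_mul]
      refine (v.map_add _ _).trans (max_le ?_ ?_)
      · rw [map_mul]
        calc _ ≤ 1 * v (D (x : L)) := by gcongr; exact hle' _ (hA a)
          _ ≤ _ := by rw [one_mul]; exact h1
      · refine le_trans ?_ h1C
        exact hle' _ (mul_mem (hB x) (hA a'))
  have hC : ∀ x, v x ≤ 1 → v (D x) ≤ exp (C : ℤ) := by
    intro x hx
    obtain ⟨a, s, hs, hs', h⟩ := hfrac x hx
    have e := congrArg D h
    rw [Derivation.leibniz, smul_eq_mul, smul_eq_mul] at e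
    have e2 : (s : L) * D x = D (a : L) - x * D (s : L) := by rw [← e]; ring
    have : v ((s : L) * D x) ≤ exp (C : ℤ) := by
      rw [e2]
      refine (v.map_sub _ _).trans (max_le (hC1 a) ?_)
      rw [map_mul]
      calc _ ≤ 1 * v (D (s : L)) := by gcongr
        _ ≤ _ := by rw [one_mul]; exact hC1 s
    rwa [map_mul, hs, one_mul] at this
  have hKn : ∀ n : ℕ, n ≠ 0 → v (n : L) = 1 := by
    intro n hn
    have hchar : (n : K) ≠ 0 := by
      intro h
      have := congrArg (algebraMap K L) h
      rw [map_natCast, map_zero] at this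
      exact hn (by exact_mod_cast this)
    refine le_antisymm (hle' _ (by simpa using hK n)) ?_
    have h2 : v (n : L)⁻¹ ≤ 1 := hle' _ (by simpa using hK (n : K)⁻¹)
    rw [map_inv₀] at h2
    have h4 : v (n : L) ≠ 0 := (Valuation.ne_zero_iff _).2 (by exact_mod_cast hn)
    exact (inv_le_one₀ (zero_lt_iff.2 h4)).1 h2
  obtain ⟨c, hc⟩ := hDt
  obtain ⟨r1, r2⟩ := val_core v D (Set.range (algebraMap K L))
    (by rintro _ ⟨c, rfl⟩; exact hle' _ (hK c))
    (by rintro _ ⟨c, rfl⟩; obtain ⟨c', h⟩ := hDK c; exact ⟨c', h.symm⟩)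
    hKn hres π hπ C hC (algebraMap A L t) ht0 (hlt' _ ht) ⟨_, ⟨c, rfl⟩, hc⟩
  refine ⟨fun x hx => hle _ (r1 x (hle' x hx)), fun h x hx => hlt _ (r2 ?_ x (hle' x hx))⟩
  rintro _ ⟨c, rfl⟩; exact h c
end Irr
end

section
open WithZero Polynomial
namespace Irr

section
variable {F : Type*} [Field F] [CharZero F]

lemma der_aeval {M : Type*} [Field M] [Algebra M F] (D : Derivation ℚ F F)
    (hM : ∀ a : M, ∃ b : M, D (algebraMap M F a) = algebraMap M F b) (y : F) (p : M[X]) :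
    ∃ q : M[X], D (Polynomial.aeval y p) = Polynomial.aeval y q + Polynomial.aeval y (derivative p) * D y := by
  induction p using Polynomial.induction_on' with
  | add p q hp hq =>
    obtain ⟨p', hp⟩ := hp
    obtain ⟨q', hq⟩ := hq
    exact ⟨p' + q', by simp only [map_add, hp, hq]; ring⟩
  | monomial n a =>
    obtain ⟨b, hb⟩ := hM a
    refine ⟨Polynomial.monomial n b, ?_⟩
    simp only [Polynomial.aeval_monomial, Derivation.leibniz, Derivation.leibniz_pow, hb, derivative_monomial,
      smul_eq_mul, nsmul_eq_mul, map_mul, map_natCast]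
    ring

lemma der_mem_adjoin {M : Type*} [Field M] [Algebra M F] (D : Derivation ℚ F F)
    (hM : ∀ a : M, ∃ b : M, D (algebraMap M F a) = algebraMap M F b) (y : F)
    (hy : IsAlgebraic M y) : D y ∈ IntermediateField.adjoin M {y} := by
  haveI : CharZero M := by
    constructor
    intro a b h
    have := congrArg (algebraMap M F) h
    simpa using this
  obtain ⟨q, hq⟩ := der_aeval D hM y (minpoly M y)
  rw [minpoly.aeval, map_zero] at hq
  have hsep : (minpoly M y).Separable := (minpoly.irreducible hy.isIntegral).separable
  have h2 := hsep.aeval_derivative_ne_zero (minpoly.aeval M y)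
  have : D y = - Polynomial.aeval y q / Polynomial.aeval y (derivative (minpoly M y)) := by
    field_simp; linear_combination -hq
  have hm : ∀ p : M[X], Polynomial.aeval y p ∈ IntermediateField.adjoin M {y} := fun p => by
    have := IntermediateField.mem_adjoin_simple_self M y
    have h3 := (Polynomial.aeval (⟨y, this⟩ : IntermediateField.adjoin M {y}) p).2
    have h4 : ((Polynomial.aeval (⟨y, this⟩ : IntermediateField.adjoin M {y}) p :
      IntermediateField.adjoin M {y}) : F) = Polynomial.aeval y p := by
      rw [← IntermediateField.coe_val, ← Polynomial.aeval_algHom_apply]; rfl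
    rwa [h4] at h3
  rw [this]
  exact div_mem (neg_mem (hm q)) (hm _)

lemma der_alg_zero' {M : Type*} [Field M] [Algebra M F] (D : Derivation ℚ F F)
    (hM : ∀ a : M, D (algebraMap M F a) = 0) (y : F)
    (hy : IsAlgebraic M y) : D y = 0 := by
  haveI : CharZero M := by
    constructor
    intro a b h
    have := congrArg (algebraMap M F) h
    simpa using this
  have hz : ∀ p : M[X], D (Polynomial.aeval y p) = Polynomial.aeval y (derivative p) * D y := by
    intro p
    induction p using Polynomial.induction_on' with
    | add p q hp hq => simp only [map_add, hp, hq]; ring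
    | monomial n a =>
      simp only [Polynomial.aeval_monomial, Derivation.leibniz, Derivation.leibniz_pow, hM,
        derivative_monomial, smul_eq_mul, nsmul_eq_mul, map_mul, map_natCast]
      ring
  have hsep : (minpoly M y).Separable := (minpoly.irreducible hy.isIntegral).separable
  have h2 := hsep.aeval_derivative_ne_zero (minpoly.aeval M y)
  have h3 := hz (minpoly M y)
  rw [minpoly.aeval, map_zero] at h3
  exact (mul_eq_zero.1 h3.symm).resolve_left h2

/-- restriction of a derivation to a subfield -/
noncomputable def restrictDer {M : Type*} [Field M] [Algebra M F] (L : IntermediateField M F)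
    (D : Derivation ℚ F F) (h : ∀ y ∈ L, D y ∈ L) : Derivation ℚ L L where
  toFun := fun y => ⟨D y, h y y.2⟩
  map_add' := fun x y => Subtype.ext (by simp)
  map_smul' := fun r x => Subtype.ext (by
    have e : ((r • x : L) : F) = r • (x : F) := by
      rw [Rat.smul_def, Rat.smul_def]; simp
    have e2 : ∀ z : L, ((r • z : L) : F) = r • (z : F) := fun z => by
      rw [Rat.smul_def, Rat.smul_def]; simp
    exact (congrArg D e).trans ((D.map_smul r (x : F)).trans (e2 ⟨D x, h x x.2⟩).symm))
  map_one_eq_zero' := Subtype.ext (by simp)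
  leibniz' := fun x y => Subtype.ext (by simp)

lemma local_step {K : Type*} [Field K] [IsAlgClosed K] [Algebra K F] (u : F)
    (hu : Transcendental K u)
    (O : ValuationSubring F) (hO : ∀ p : K[X], Polynomial.aeval u p ∈ O) (hOu : O.valuation u < 1)
    (D : Derivation ℚ F F) (hK : ∀ c : K, ∃ c' : K, D (algebraMap K F c) = algebraMap K F c')
    (hDu : ∃ c : K, D u = algebraMap K F c * u)
    (x : F) (hx : x ∈ O) (halg : IsAlgebraic (IntermediateField.adjoin K {u}) x) :
    D x ∈ O ∧ ((∀ c : K, D (algebraMap K F c) = 0) → O.valuation (D x) < 1) := by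
  let M := IntermediateField.adjoin K {u}
  let uM : M := ⟨u, IntermediateField.mem_adjoin_simple_self K u⟩
  letI : Algebra K[X] M := (Polynomial.aeval uM).toAlgebra
  have hMval : ∀ p : K[X], ((algebraMap K[X] M p : M) : F) = Polynomial.aeval u p := by
    intro p
    change ((Polynomial.aeval uM p : M) : F) = _
    rw [← IntermediateField.coe_val, ← Polynomial.aeval_algHom_apply]; rfl
  have hinj : Function.Injective (algebraMap K[X] M) := by
    intro p q h
    have h1 := congrArg (fun z : M => (z : F)) h
    simp only [hMval] at h1
    exact (transcendental_iff_injective.1 hu) h1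
  haveI : FaithfulSMul K[X] M := (faithfulSMul_iff_algebraMap_injective _ _).2 hinj
  haveI : IsFractionRing K[X] M := by
    refine IsFractionRing.of_field _ _ ?_
    rintro ⟨z, hz⟩
    obtain ⟨r, s, h⟩ := (IntermediateField.mem_adjoin_simple_iff K z).1 hz
    refine ⟨r, s, Subtype.ext ?_⟩
    rw [IntermediateField.coe_div, hMval, hMval]; exact h
  let L := IntermediateField.adjoin M {x}
  haveI : FiniteDimensional M L := IntermediateField.adjoin.finiteDimensional halg.isIntegral
  letI : Algebra K[X] L := ((algebraMap M L).comp (algebraMap K[X] M)).toAlgebra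
  haveI : IsScalarTower K[X] M L := IsScalarTower.of_algebraMap_eq (fun _ => rfl)
  letI : Algebra K L := ((algebraMap M L).comp (algebraMap K M)).toAlgebra
  have hKL : ∀ c : K, ((algebraMap K L c : L) : F) = algebraMap K F c := fun _ => rfl
  have hAL : ∀ p : K[X], ((algebraMap K[X] L p : L) : F) = Polynomial.aeval u p := fun p => hMval p
  haveI : IsScalarTower K K[X] L := IsScalarTower.of_algebraMap_eq (fun c => Subtype.ext (by
    rw [hAL, hKL, Polynomial.algebraMap_eq, Polynomial.aeval_C]))
  have hDA : ∀ p : K[X], ∃ q : K[X], D (Polynomial.aeval u p) = Polynomial.aeval u q := by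
    intro p
    obtain ⟨q, hq⟩ := der_aeval D hK u p
    obtain ⟨c, hc⟩ := hDu
    refine ⟨q + derivative p * (Polynomial.C c * Polynomial.X), ?_⟩
    rw [hq, hc]; simp
  have hDM : ∀ a : M, ∃ b : M, D (algebraMap M F a) = algebraMap M F b := by
    rintro ⟨z, hz⟩
    obtain ⟨r, s, h⟩ := (IntermediateField.mem_adjoin_simple_iff K z).1 hz
    obtain ⟨r', hr'⟩ := hDA r
    obtain ⟨s', hs'⟩ := hDA s
    change ∃ b : M, D z = b
    refine ⟨(algebraMap K[X] M s ^ 2)⁻¹ * (algebraMap K[X] M s * algebraMap K[X] M r'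
      - algebraMap K[X] M r * algebraMap K[X] M s'), ?_⟩
    rw [h, Derivation.leibniz_div]
    simp only [IntermediateField.coe_mul, IntermediateField.coe_inv, IntermediateField.coe_pow,
      AddSubgroupClass.coe_sub, hMval, hr', hs', smul_eq_mul]
    ring
  have hDL : ∀ y ∈ L, D y ∈ L := by
    intro y hy
    have hyalg : IsAlgebraic M y := by
      have := (Algebra.IsAlgebraic.of_finite M L).isAlgebraic ⟨y, hy⟩
      exact (IntermediateField.isAlgebraic_iff).1 this
    have h1 := der_mem_adjoin D hDM y hyalg
    have h2 : IntermediateField.adjoin M {y} ≤ L := by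
      rw [IntermediateField.adjoin_simple_le_iff]; exact hy
    exact h2 h1
  let DL := restrictDer L D hDL
  have hDLv : ∀ y : L, ((DL y : L) : F) = D y := fun _ => rfl
  let OL : ValuationSubring L := O.comap (algebraMap L F)
  have hOL : ∀ y : L, y ∈ OL ↔ (y : F) ∈ O := fun _ => Iff.rfl
  have hOLlt : ∀ y : L, OL.valuation y < 1 ↔ O.valuation (y : F) < 1 := by
    intro y
    rw [← ValuationSubring.mem_nonunits_iff, ← ValuationSubring.mem_nonunits_iff,
      ValuationSubring.mem_nonunits_iff_or, ValuationSubring.mem_nonunits_iff_or, hOL]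
    simp
  obtain ⟨c, hc⟩ := hDu
  have hX : ((algebraMap K[X] L Polynomial.X : L) : F) = u := by rw [hAL, Polynomial.aeval_X]
  have hu0 : u ≠ 0 := by rintro rfl; exact hu isAlgebraic_zero
  have core := dvr_core (K := K) (A := K[X]) (M := M) (L := L) OL
    (fun a => by rw [hOL, hAL]; exact hO a) Polynomial.X
    (fun h => hu0 (by rw [← hX, h]; rfl))
    (by rw [hOLlt, hX]; exact hOu)
    (fun a => ⟨a.coeff 0, a.divX, by
      rw [Polynomial.algebraMap_eq, add_comm]; exact (X_mul_divX_add a).symm⟩)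
    DL (fun a => by
      obtain ⟨q, hq⟩ := hDA a
      exact ⟨q, Subtype.ext (by rw [hDLv, hAL, hAL, hq])⟩)
    (fun a => by
      obtain ⟨q, hq⟩ := hK a
      exact ⟨q, Subtype.ext (by rw [hDLv, hKL, hKL, hq])⟩)
    ⟨c, Subtype.ext (by rw [hDLv, IntermediateField.coe_mul, hX, hKL, hc])⟩
  let xL : L := ⟨x, IntermediateField.mem_adjoin_simple_self M x⟩
  refine ⟨(hOL _).1 (core.1 xL hx), fun h0 => ?_⟩
  have := core.2 (fun c => Subtype.ext (by rw [hDLv, hKL, h0]; rfl)) xL hx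
  rw [hOLlt] at this
  exact this

theorem local_val {K : Type*} [Field K] [IsAlgClosed K] [Algebra K F] (u : F)
    (hu : Transcendental K u)
    (halg : ∀ x : F, IsAlgebraic (IntermediateField.adjoin K {u}) x) :
    ∃ O : ValuationSubring F, (∀ c : K, algebraMap K F c ∈ O) ∧ O.valuation u < 1 ∧
      ∀ D : Derivation ℚ F F,
        (∀ c : K, ∃ c' : K, D (algebraMap K F c) = algebraMap K F c') →
        (∃ c : K, D u = algebraMap K F c * u) →
        (∀ x ∈ O, D x ∈ O) ∧
        ((∀ c : K, D (algebraMap K F c) = 0) → ∀ x ∈ O, O.valuation (D x) < 1) := by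
  let A : Subring F := (Polynomial.aeval u : K[X] →ₐ[K] F).toRingHom.range
  have hA : ∀ p : K[X], Polynomial.aeval u p ∈ A := fun p => ⟨p, rfl⟩
  let I : Ideal A := Ideal.span {⟨u, by simpa using hA Polynomial.X⟩}
  have hI : I ≠ ⊤ := by
    rw [Ne, Ideal.span_singleton_eq_top, isUnit_iff_exists_inv]
    rintro ⟨⟨_, ⟨q, rfl⟩⟩, hq⟩
    have h1 : u * Polynomial.aeval u q = 1 := congrArg (fun z : A => (z : F)) hq
    have h2 : Polynomial.aeval u (Polynomial.X * q - 1 : K[X]) = 0 := by simp [h1]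
    have h3 := (transcendental_iff.1 hu) _ h2
    have h4 := congrArg (Polynomial.eval 0) h3
    simp at h4
  obtain ⟨O, hO1, hO2⟩ := Ideal.image_subset_nonunits_valuationSubring I hI
  have hOp : ∀ p : K[X], Polynomial.aeval u p ∈ O := fun p => hO1 (hA p)
  have hOu : O.valuation u < 1 := by
    rw [← ValuationSubring.mem_nonunits_iff]
    exact hO2 ⟨⟨u, by simpa using hA Polynomial.X⟩, Ideal.mem_span_singleton_self _, rfl⟩
  refine ⟨O, fun c => by simpa using hOp (Polynomial.C c), hOu, fun D hK hDu => ?_⟩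
  exact ⟨fun x hx => (local_step u hu O hOp hOu D hK hDu x hx (halg x)).1,
    fun h0 x hx => (local_step u hu O hOp hOu D hK hDu x hx (halg x)).2 h0⟩
end
end Irr
end

section
open Matrix
namespace Irr

section
variable {F : Type*} [Field F] {k m : ℕ}

/-- Plücker coordinates over a general field -/
def pl (w : Matrix (Fin k) (Fin m) F) : PluckIdx k m → F :=
  fun S => Matrix.det (Matrix.of fun i j => w i (↑(S.1.orderIsoOfFin S.2 j)))

def plT (w : Matrix (Fin k) (Fin m) F) (f : Fin k → Fin m) : F := (w.submatrix id f).det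

/-- the increasing enumeration of a Plücker index -/
def en (S : PluckIdx k m) : Fin k → Fin m := fun j => S.1.orderIsoOfFin S.2 j

lemma en_inj (S : PluckIdx k m) : Function.Injective (en S) := fun a b h => by
  apply (S.1.orderIsoOfFin S.2).injective
  exact Subtype.ext h

lemma pl_eq (w : Matrix (Fin k) (Fin m) F) (S : PluckIdx k m) : pl w S = plT w (en S) := rfl

lemma plT_mul (B : Matrix (Fin k) (Fin k) F) (w : Matrix (Fin k) (Fin m) F) (f : Fin k → Fin m) :
    plT (B * w) f = B.det * plT w f := by
  have : (B * w).submatrix id f = B * w.submatrix id f := by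
    ext i j; simp [Matrix.mul_apply]
  rw [plT, this, det_mul]; rfl

lemma pl_mul (B : Matrix (Fin k) (Fin k) F) (w : Matrix (Fin k) (Fin m) F) :
    pl (B * w) = B.det • pl w := by
  ext S; simp [pl_eq, plT_mul]

lemma exists_lam_one (f : Fin k → Fin m) : ∃ l : PluckIdx k m → ℤ,
    (∀ w : Matrix (Fin k) (Fin m) F, plT w f = ∑ S, (l S : F) * pl w S) := by
  classical
  by_cases hf : Function.Injective f
  · let S : PluckIdx k m := ⟨Finset.univ.image f, by
      rw [Finset.card_image_of_injective _ hf]; simp⟩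
    have hmem : ∀ i, f i ∈ S.1 := fun i => Finset.mem_image_of_mem _ (Finset.mem_univ _)
    let σ : Fin k → Fin k := fun i => (S.1.orderIsoOfFin S.2).symm ⟨f i, hmem i⟩
    have hσ : ∀ i, en S (σ i) = f i := fun i => by simp [en, σ]
    have hσi : Function.Injective σ := fun a b h => hf (by rw [← hσ, ← hσ, h])
    let τ : Equiv.Perm (Fin k) := Equiv.ofBijective σ (Finite.injective_iff_bijective.1 hσi)
    refine ⟨fun T => if T = S then (Equiv.Perm.sign τ : ℤ) else 0, fun w => ?_⟩
    have h1 : w.submatrix id f = (w.submatrix id (en S)).submatrix id τ := by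
      ext i j; simp [τ, hσ]
    rw [plT, h1, Matrix.det_permute']
    simp only [Int.cast_ite, Int.cast_zero, ite_mul, zero_mul, Finset.sum_ite_eq',
      Finset.mem_univ, if_true, pl_eq]
    rfl
  · refine ⟨fun _ => 0, fun w => ?_⟩
    obtain ⟨a, b, h, hne⟩ : ∃ a b, f a = f b ∧ a ≠ b := by
      simpa [Function.Injective] using hf
    simp only [Int.cast_zero, zero_mul, Finset.sum_const_zero]
    exact det_zero_of_column_eq hne (fun i => by simp [h])

/-- the linear form expressing `plT` through the Plücker coordinates -/
noncomputable def lam (F : Type*) [Field F] (f : Fin k → Fin m) : PluckIdx k m → ℤ :=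
  (exists_lam_one (F := F) f).choose

lemma plT_lam (w : Matrix (Fin k) (Fin m) F) (f : Fin k → Fin m) :
    plT w f = ∑ S, (lam F f S : F) * pl w S := (exists_lam_one (F := F) f).choose_spec w

/-- the chart submatrix -/
def cs (w : Matrix (Fin k) (Fin m) F) (A : PluckIdx k m) : Matrix (Fin k) (Fin k) F :=
  w.submatrix id (en A)

lemma det_cs (w : Matrix (Fin k) (Fin m) F) (A : PluckIdx k m) : (cs w A).det = pl w A := rfl

lemma cs_mul (B : Matrix (Fin k) (Fin k) F) (w : Matrix (Fin k) (Fin m) F) (A : PluckIdx k m) :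
    cs (B * w) A = B * cs w A := by
  ext i j; simp [cs, Matrix.mul_apply]

lemma submatrix_update (w : Matrix (Fin k) (Fin m) F) (f : Fin k → Fin m) (i : Fin k) (j : Fin m) :
    w.submatrix id (Function.update f i j) = (w.submatrix id f).updateCol i (fun a => w a j) := by
  ext a b
  by_cases h : b = i
  · subst h; simp
  · simp [h]

/-- entries of a normalized matrix -/
lemma plT_update (w : Matrix (Fin k) (Fin m) F) (A : PluckIdx k m) (h : cs w A = 1)
    (i : Fin k) (j : Fin m) : plT w (Function.update (en A) i j) = w i j := by
  rw [plT, submatrix_update]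
  have : w.submatrix id (en A) = 1 := h
  rw [this, ← cramer_apply, cramer_one]; rfl

lemma det_two (i i' : Fin k) (h : i ≠ i') (u v : Fin k → F) :
    (((1 : Matrix (Fin k) (Fin k) F).updateCol i u).updateCol i' v).det
      = u i * v i' - v i * u i' := by
  let U : Matrix (Fin k) (Fin 2) F := of fun a b => if b = 0 then u a - (1 : Matrix _ _ F) a i
    else v a - (1 : Matrix _ _ F) a i'
  let V : Matrix (Fin 2) (Fin k) F := of fun b a => if b = 0 then (1 : Matrix _ _ F) i a
    else (1 : Matrix _ _ F) i' a
  have h1 : ((1 : Matrix (Fin k) (Fin k) F).updateCol i u).updateCol i' v = 1 + U * V := by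
    ext a b
    simp only [Matrix.add_apply, Matrix.mul_apply, Fin.sum_univ_two, U, V, of_apply, if_true,
      Fin.one_eq_zero_iff, OfNat.ofNat_ne_one, if_false]
    by_cases hb : b = i'
    · subst hb
      simp [one_apply_ne h]
    · by_cases hb2 : b = i
      · subst hb2
        simp [hb, one_apply_ne hb, one_apply_ne (Ne.symm hb)]
      · simp [hb, hb2, one_apply_ne (Ne.symm hb), one_apply_ne (Ne.symm hb2)]
  rw [h1, det_one_add_mul_comm, det_fin_two]
  simp only [Matrix.add_apply, Matrix.mul_apply, U, V, of_apply]
  simp [one_apply, h, Ne.symm h]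

lemma plT_update_two (w : Matrix (Fin k) (Fin m) F) (A : PluckIdx k m) (h : cs w A = 1)
    (i i' : Fin k) (hi : i ≠ i') (j j' : Fin m) :
    plT w (Function.update (Function.update (en A) i j) i' j')
      = w i j * w i' j' - w i j' * w i' j := by
  rw [plT, submatrix_update, submatrix_update]
  have : w.submatrix id (en A) = 1 := h
  rw [this, det_two _ _ hi]

/-- normalization -/
noncomputable def nrm (w : Matrix (Fin k) (Fin m) F) (A : PluckIdx k m) :
    Matrix (Fin k) (Fin m) F := (cs w A)⁻¹ * w

lemma cs_nrm (w : Matrix (Fin k) (Fin m) F) (A : PluckIdx k m) (h : pl w A ≠ 0) :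
    cs (nrm w A) A = 1 := by
  rw [nrm, cs_mul, nonsing_inv_mul]
  rw [det_cs]; exact h.isUnit

lemma mul_nrm (w : Matrix (Fin k) (Fin m) F) (A : PluckIdx k m) (h : pl w A ≠ 0) :
    cs w A * nrm w A = w := by
  rw [nrm, ← Matrix.mul_assoc, mul_nonsing_inv, Matrix.one_mul]
  rw [det_cs]; exact h.isUnit

lemma nrm_apply (w : Matrix (Fin k) (Fin m) F) (A : PluckIdx k m) (h : pl w A ≠ 0)
    (i : Fin k) (j : Fin m) : nrm w A i j = (pl w A)⁻¹ * plT w (Function.update (en A) i j) := by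
  rw [← plT_update _ A (cs_nrm w A h), nrm, plT_mul, det_nonsing_inv, det_cs]
  simp

lemma pl_nrm (w : Matrix (Fin k) (Fin m) F) (A : PluckIdx k m) :
    pl (nrm w A) = (pl w A)⁻¹ • pl w := by
  rw [nrm, pl_mul, det_nonsing_inv, det_cs]; simp

lemma eq_of_pl_eq (w w' : Matrix (Fin k) (Fin m) F) (A : PluckIdx k m) (h : cs w A = 1)
    (h' : cs w' A = 1) (e : pl w = pl w') : w = w' := by
  ext i j
  rw [← plT_update w A h, ← plT_update w' A h', plT_lam, plT_lam, e]

/-- proportional Plücker vectors: same row space -/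
lemma exists_B_of_pl_smul (w w' : Matrix (Fin k) (Fin m) F) (c : F) (e : pl w = c • pl w')
    (h : pl w ≠ 0) : ∃ B : Matrix (Fin k) (Fin k) F, B.det ≠ 0 ∧ w = B * w' := by
  obtain ⟨A, hA⟩ := Function.ne_iff.1 h
  have hA : pl w A ≠ 0 := hA
  have hA' : pl w' A ≠ 0 := fun h0 => hA (by rw [e]; simp [h0])
  have e2 : nrm w A = nrm w' A := by
    refine eq_of_pl_eq _ _ A (cs_nrm w A hA) (cs_nrm w' A hA') ?_
    rw [pl_nrm, pl_nrm, e]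
    have hc : c ≠ 0 := by rintro rfl; exact hA (by rw [e]; simp)
    ext S; simp only [Pi.smul_apply, smul_eq_mul]; field_simp
  refine ⟨cs w A * (cs w' A)⁻¹, ?_, ?_⟩
  · rw [det_mul, det_nonsing_inv, det_cs, det_cs]
    simp [hA, hA']
  · rw [Matrix.mul_assoc]; change w = cs w A * nrm w' A
    rw [← e2, mul_nrm w A hA]
end
end Irr
end

section
open Matrix
namespace Irr

section
variable {F : Type*} [Field F] {k m : ℕ} {P : Type*} [Fintype P] [DecidableEq P]

/-- the matrix `E_ab * w` -/
def Ew (w : Matrix (Fin k) (Fin m) F) (ab : Fin k × Fin k) : Matrix (Fin k) (Fin m) F :=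
  of fun i j => if i = ab.1 then w ab.2 j else 0

lemma mul_eq_sum_Ew (C : Matrix (Fin k) (Fin k) F) (w : Matrix (Fin k) (Fin m) F) :
    C * w = ∑ ab, C ab.1 ab.2 • Ew w ab := by
  ext i j
  simp [Matrix.mul_apply, Matrix.sum_apply, Ew, Fintype.sum_prod_type]

lemma mul_Ew_apply (B : Matrix (Fin k) (Fin k) F) (w : Matrix (Fin k) (Fin m) F)
    (ab : Fin k × Fin k) (i j) : (B * Ew w ab) i j = B i ab.1 * w ab.2 j := by
  simp [Matrix.mul_apply, Ew]

lemma Ew_mul (B : Matrix (Fin k) (Fin k) F) (hB : B.det ≠ 0) (w : Matrix (Fin k) (Fin m) F)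
    (ab : Fin k × Fin k) (i j) :
    Ew (B * w) ab i j =
      ∑ dc : Fin k × Fin k, (B⁻¹ dc.1 ab.1 * B ab.2 dc.2) * (B * Ew w dc) i j := by
  simp only [mul_Ew_apply, Fintype.sum_prod_type]
  have h1 : (B * B⁻¹) i ab.1 = if i = ab.1 then 1 else 0 := by
    rw [mul_nonsing_inv _ hB.isUnit, one_apply]
  have h2 : Ew (B * w) ab i j = (B * B⁻¹) i ab.1 * (B * w) ab.2 j := by
    rw [h1]; simp [Ew]
  rw [h2, Matrix.mul_apply, Matrix.mul_apply, Finset.sum_mul_sum]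
  refine Finset.sum_congr rfl fun d _ => Finset.sum_congr rfl fun c _ => ?_
  ring

def rowsM (w : Matrix (Fin k) (Fin m) F) (u : P → Matrix (Fin k) (Fin m) F) :
    Matrix (P ⊕ (Fin k × Fin k)) (Fin k × Fin m) F :=
  of fun r p => Sum.elim (fun o => u o p.1 p.2) (fun ab => Ew w ab p.1 p.2) r

def Om (e : P ⊕ (Fin k × Fin k) ≃ Fin k × Fin m) (w : Matrix (Fin k) (Fin m) F)
    (u : P → Matrix (Fin k) (Fin m) F) : F := ((rowsM w u).submatrix id e).det

lemma Om_transform (e : P ⊕ (Fin k × Fin k) ≃ Fin k × Fin m) (w : Matrix (Fin k) (Fin m) F)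
    (u : P → Matrix (Fin k) (Fin m) F) (B : Matrix (Fin k) (Fin k) F) (hB : B.det ≠ 0)
    (C : P → Matrix (Fin k) (Fin k) F) :
    Om e (B * w) (fun o => B * u o + C o * w) = B.det ^ m * Om e w u := by
  let L : Matrix (P ⊕ (Fin k × Fin k)) (P ⊕ (Fin k × Fin k)) F :=
    fromBlocks 1 (of fun o dc => (B⁻¹ * C o) dc.1 dc.2) 0 (kroneckerMap (fun x y => x * y) (B⁻¹)ᵀ B)
  let R : Matrix (Fin k × Fin m) (Fin k × Fin m) F := kroneckerMap (fun x y => x * y) Bᵀ 1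
  have hR : ∀ (x : Matrix (Fin k) (Fin m) F) (p : Fin k × Fin m),
      ∑ q : Fin k × Fin m, x q.1 q.2 * R q p = (B * x) p.1 p.2 := by
    intro x p
    simp only [R, kroneckerMap_apply, Fintype.sum_prod_type, transpose_apply,
      Matrix.mul_apply]
    refine Finset.sum_congr rfl fun i _ => ?_
    rw [Finset.sum_eq_single p.2]
    · simp [mul_comm]
    · intro j _ hj; simp [Matrix.one_apply_ne hj]
    · simp
  have hLdet : L.det = 1 := by
    rw [det_fromBlocks_zero₂₁, det_one, one_mul, det_kronecker, det_transpose, det_nonsing_inv,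
      ← mul_pow]
    simp [hB]
  have hRdet : R.det = B.det ^ m := by
    rw [det_kronecker, det_transpose]; simp
  have key : rowsM (B * w) (fun o => B * u o + C o * w) = L * (rowsM w u * R) := by
    ext r p
    have hrow : ∀ r p, (rowsM w u * R) r p = Sum.elim (fun o => (B * u o) p.1 p.2)
        (fun ab => (B * Ew w ab) p.1 p.2) r := by
      intro r p
      rw [Matrix.mul_apply]
      cases r with
      | inl o => exact hR (u o) p
      | inr ab => exact hR (Ew w ab) p
    rw [Matrix.mul_apply, Fintype.sum_sum_type]
    simp only [hrow, Sum.elim_inl, Sum.elim_inr]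
    cases r with
    | inl o =>
      simp only [L, fromBlocks_apply₁₁, fromBlocks_apply₁₂, rowsM, of_apply, Sum.elim_inl,
        Matrix.one_apply, ite_mul, one_mul, zero_mul, Finset.sum_ite_eq, Finset.mem_univ, if_true,
        Matrix.add_apply]
      congr 1
      have h1 : C o * w = B * ((B⁻¹ * C o) * w) := by
        rw [← Matrix.mul_assoc, ← Matrix.mul_assoc, mul_nonsing_inv _ hB.isUnit, Matrix.one_mul]
      rw [h1, mul_eq_sum_Ew (B⁻¹ * C o) w, Matrix.mul_sum, Matrix.sum_apply]
      refine Finset.sum_congr rfl fun ab _ => ?_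
      rw [Matrix.mul_smul, Matrix.smul_apply, smul_eq_mul]
    | inr ab =>
      simp only [L, fromBlocks_apply₂₁, fromBlocks_apply₂₂, rowsM, of_apply, Sum.elim_inr,
        Matrix.zero_apply, zero_mul, Finset.sum_const_zero, zero_add]
      rw [Ew_mul B hB]
      rfl
  have h3 : (L * (rowsM w u * R)).submatrix id e
      = L * ((rowsM w u).submatrix id e * R.submatrix e e) := by
    ext r p
    simp only [Matrix.mul_apply, submatrix_apply, id]
    refine Finset.sum_congr rfl fun x _ => ?_
    congr 1
    exact (Equiv.sum_comp e (fun q => rowsM w u x q * R q (e p))).symm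
  rw [Om, key, h3, det_mul, det_mul, hLdet, det_submatrix_equiv_self, hRdet, Om]
  ring

lemma Om_eq_zero (e : P ⊕ (Fin k × Fin k) ≃ Fin k × Fin m) (w : Matrix (Fin k) (Fin m) F)
    (u : P → Matrix (Fin k) (Fin m) F) (ξ : Matrix (Fin k) (Fin m) F →ₗ[F] F) (h0 : ξ ≠ 0)
    (h1 : ∀ ab, ξ (Ew w ab) = 0) (h2 : ∀ o, ξ (u o) = 0) : Om e w u = 0 := by
  let x : P ⊕ (Fin k × Fin k) → F := fun r => ξ (Matrix.single (e r).1 (e r).2 1)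
  have hx : ∀ y : Matrix (Fin k) (Fin m) F, ∑ r, y (e r).1 (e r).2 * x r = ξ y := by
    intro y
    conv_rhs => rw [Matrix.matrix_eq_sum_single y]
    simp only [map_sum]
    rw [← Fintype.sum_prod_type' (fun i j => ξ (Matrix.single i j (y i j))),
      ← Equiv.sum_comp e]
    refine Finset.sum_congr rfl fun r _ => ?_
    have : Matrix.single (e r).1 (e r).2 (y (e r).1 (e r).2)
      = y (e r).1 (e r).2 • Matrix.single (e r).1 (e r).2 (1 : F) := by simp
    rw [this, map_smul, smul_eq_mul]
  have hx0 : x ≠ 0 := by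
    rintro h
    refine h0 (LinearMap.ext fun y => ?_)
    rw [← hx y]; simp [h]
  refine Matrix.exists_mulVec_eq_zero_iff.1 ⟨x, hx0, ?_⟩
  ext r
  change ∑ r', (rowsM w u) r (e r') * x r' = 0
  cases r with
  | inl o => exact (hx (u o)).trans (h2 o)
  | inr ab => exact (hx (Ew w ab)).trans (h1 ab)

/-- scaling of rows -/
lemma Om_smul (e : P ⊕ (Fin k × Fin k) ≃ Fin k × Fin m) (w : Matrix (Fin k) (Fin m) F)
    (u : P → Matrix (Fin k) (Fin m) F) (c : P → F) :
    Om e w (fun o => c o • u o) = (∏ o, c o) * Om e w u := by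
  let v : P ⊕ (Fin k × Fin k) → F := Sum.elim c (fun _ => 1)
  have : (rowsM w (fun o => c o • u o)).submatrix id e
      = of fun i j => v i * ((rowsM w u).submatrix id e) i j := by
    ext r p
    cases r <;> simp [rowsM, v]
  rw [Om, this, det_mul_column]
  simp [v, Om]

/-- linearity in a row -/
lemma Om_update_sub (e : P ⊕ (Fin k × Fin k) ≃ Fin k × Fin m) (w : Matrix (Fin k) (Fin m) F)
    (u : P → Matrix (Fin k) (Fin m) F) (o : P) (a b : F) (x y : Matrix (Fin k) (Fin m) F) :
    Om e w (Function.update u o (a • x - b • y)) =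
      a * Om e w (Function.update u o x) - b * Om e w (Function.update u o y) := by
  have h : ∀ z, (rowsM w (Function.update u o z)).submatrix id e
      = ((rowsM w u).submatrix id e).updateRow (Sum.inl o) (fun r => z (e r).1 (e r).2) := by
    intro z
    ext r p
    cases r with
    | inl o' =>
      by_cases h : o' = o
      · subst h; simp [rowsM]
      · simp [rowsM, h]
    | inr ab => simp [rowsM]
  simp only [Om, h]
  have : (fun r => (a • x - b • y) (e r).1 (e r).2)
    = a • (fun r => x (e r).1 (e r).2) + (-b) • (fun r => y (e r).1 (e r).2) := by
    ext r; simp; ring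
  rw [this, det_updateRow_add, det_updateRow_smul, det_updateRow_smul]
  ring

/-- adding multiples of a row -/
lemma Om_add_row (e : P ⊕ (Fin k × Fin k) ≃ Fin k × Fin m) (w : Matrix (Fin k) (Fin m) F)
    (u : P → Matrix (Fin k) (Fin m) F) (o : P) (c : P → F) (hc : c o = 0) :
    Om e w (fun o' => u o' + c o' • u o) = Om e w u := by
  refine det_eq_of_forall_row_eq_smul_add_const (Sum.elim c (fun _ => 0)) (Sum.inl o) hc ?_
  intro r p
  cases r <;> simp [rowsM]
end
end Irr
end

section
open Polynomial
namespace Irr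

section
variable {F : Type*} [Field F] {K : Type*} [Field K] [IsAlgClosed K] [Algebra K F]

lemma aeval_mem_O (O : ValuationSubring F) (hO : ∀ c : K, algebraMap K F c ∈ O) (t : F)
    (ht : t ∈ O) (p : K[X]) : Polynomial.aeval t p ∈ O := by
  induction p using Polynomial.induction_on' with
  | add p q hp hq => rw [map_add]; exact add_mem hp hq
  | monomial n a => rw [Polynomial.aeval_monomial]; exact mul_mem (hO a) (pow_mem ht n)

lemma val_const (O : ValuationSubring F) (hO : ∀ c : K, algebraMap K F c ∈ O) (c : K)
    (hc : c ≠ 0) : O.valuation (algebraMap K F c) = 1 := by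
  have h1 := (O.valuation_le_one_iff _).2 (hO c)
  have h2 := (O.valuation_le_one_iff _).2 (hO c⁻¹)
  have h3 : O.valuation (algebraMap K F c) * O.valuation (algebraMap K F c⁻¹) = 1 := by
    rw [← map_mul, ← map_mul, mul_inv_cancel₀ hc, map_one, map_one]
  refine le_antisymm h1 ?_
  calc 1 = O.valuation (algebraMap K F c) * O.valuation (algebraMap K F c⁻¹) := h3.symm
    _ ≤ O.valuation (algebraMap K F c) * 1 := by gcongr
    _ = _ := mul_one _

lemma val_mul_lt (O : ValuationSubring F) {x y : F} (hx : O.valuation x < 1) (hy : y ∈ O) :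
    O.valuation (x * y) < 1 := by
  have h2 := (O.valuation_le_one_iff _).2 hy
  rw [map_mul]
  calc O.valuation x * O.valuation y ≤ O.valuation x * 1 := by gcongr
    _ = _ := mul_one _
    _ < 1 := hx

lemma val_eval_unit (O : ValuationSubring F) (hO : ∀ c : K, algebraMap K F c ∈ O) (t : F) (a : K)
    (ht : O.valuation (t - algebraMap K F a) < 1) (p : K[X]) (hp : p.eval a ≠ 0) :
    O.valuation (Polynomial.aeval t p) = 1 := by
  have htO : t ∈ O := by
    have h1 : t - algebraMap K F a ∈ O := (O.valuation_le_one_iff _).1 ht.le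
    simpa using add_mem h1 (hO a)
  have h := mul_divByMonic_eq_iff_isRoot (p := p - Polynomial.C (p.eval a)) (a := a)
  have h2 : (Polynomial.X - Polynomial.C a) * ((p - Polynomial.C (p.eval a)) /ₘ (Polynomial.X - Polynomial.C a)) = p - Polynomial.C (p.eval a) := by
    rw [h]; simp
  have h3 : Polynomial.aeval t p = (t - algebraMap K F a) * Polynomial.aeval t ((p - Polynomial.C (p.eval a)) /ₘ (Polynomial.X - Polynomial.C a))
      + algebraMap K F (p.eval a) := by
    have h4 := congrArg (Polynomial.aeval t) h2
    simp only [map_mul, map_sub, Polynomial.aeval_X, Polynomial.aeval_C] at h4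
    rw [h4]; ring
  rw [h3, Valuation.map_add_eq_of_lt_right]
  · exact val_const O hO _ hp
  · rw [val_const O hO _ hp]
    exact val_mul_lt O ht (aeval_mem_O O hO t htO _)

lemma ratfun_zero (s : F) (hs : Transcendental K s) (H : F)
    (hH : H ∈ IntermediateField.adjoin K {s})
    (hloc : ∀ a : K, ∃ O : ValuationSubring F, (∀ c, algebraMap K F c ∈ O) ∧
      O.valuation (s - algebraMap K F a) < 1 ∧ O.valuation ((s - algebraMap K F a) * H) < 1)
    (hinf : ∃ O : ValuationSubring F, (∀ c, algebraMap K F c ∈ O) ∧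
      O.valuation s⁻¹ < 1 ∧ O.valuation (s * H) < 1) : H = 0 := by
  have hne : ∀ p : K[X], p ≠ 0 → Polynomial.aeval s p ≠ 0 := fun p hp h =>
    hp ((transcendental_iff.1 hs) p h)
  have hs0 : s ≠ 0 := by simpa using hne Polynomial.X Polynomial.X_ne_zero
  have main : ∀ n : ℕ, ∀ r q : K[X], q.natDegree = n → q ≠ 0 → H * Polynomial.aeval s q = Polynomial.aeval s r →
      H = 0 := by
    intro n
    induction n with
    | zero =>
      intro r q hq hq0 h
      by_contra hH0
      obtain ⟨c, rfl⟩ := natDegree_eq_zero.1 hq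
      have hc : c ≠ 0 := by rintro rfl; simp at hq0
      have hr : r ≠ 0 := by
        rintro rfl
        rw [map_zero] at h
        exact (mul_ne_zero hH0 (hne _ hq0)) h
      obtain ⟨O, hO, hs1, hs2⟩ := hinf
      have hsi : s⁻¹ ∈ O := (O.valuation_le_one_iff _).1 hs1.le
      letI := invertibleOfNonzero hs0
      have h1 : Polynomial.aeval s⁻¹ r.reverse * s ^ r.natDegree = Polynomial.aeval s r := by
        have := eval₂_reverse_mul_pow (algebraMap K F) s r
        simpa [Polynomial.aeval_def] using this
      have h2 : O.valuation (Polynomial.aeval s⁻¹ r.reverse) = 1 := by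
        refine val_eval_unit O hO _ 0 (by simpa using hs1) _ ?_
        rw [← coeff_zero_eq_eval_zero, coeff_zero_reverse]
        exact leadingCoeff_ne_zero.2 hr
      have h3 : (s * H) * (algebraMap K F c * s⁻¹ ^ r.natDegree) * s⁻¹
          = Polynomial.aeval s⁻¹ r.reverse := by
        rw [Polynomial.aeval_C] at h
        have : H * algebraMap K F c = Polynomial.aeval s⁻¹ r.reverse * s ^ r.natDegree := by rw [h1, h]
        have e1 : (s * H) * (algebraMap K F c * s⁻¹ ^ r.natDegree) * s⁻¹
            = (H * algebraMap K F c) * s⁻¹ ^ r.natDegree * (s * s⁻¹) := by ring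
        rw [e1, mul_inv_cancel₀ hs0, mul_one, this, inv_pow, mul_assoc, mul_inv_cancel₀ (pow_ne_zero _ hs0), mul_one]
      have h4 : O.valuation ((s * H) * (algebraMap K F c * s⁻¹ ^ r.natDegree) * s⁻¹) < 1 := by
        refine val_mul_lt O (val_mul_lt O hs2 (mul_mem (hO _) (pow_mem hsi _))) hsi
      rw [h3, h2] at h4
      exact lt_irrefl _ h4
    | succ n ih =>
      intro r q hq hq0 h
      obtain ⟨a, ha⟩ := IsAlgClosed.exists_root q (by
        rw [degree_eq_natDegree hq0, hq]; exact_mod_cast Nat.succ_ne_zero n)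
      obtain ⟨q1, rfl⟩ := dvd_iff_isRoot.2 ha
      have hq1 : q1 ≠ 0 := right_ne_zero_of_mul hq0
      have hsa : s - algebraMap K F a ≠ 0 := by
        simpa using hne (Polynomial.X - Polynomial.C a) (X_sub_C_ne_zero a)
      have hdeg : q1.natDegree = n := by
        rw [natDegree_mul (X_sub_C_ne_zero a) hq1, natDegree_X_sub_C] at hq; omega
      simp only [map_mul, map_sub, Polynomial.aeval_X, Polynomial.aeval_C] at h
      by_cases hr : r.eval a = 0
      · obtain ⟨r1, rfl⟩ := dvd_iff_isRoot.2 (show r.IsRoot a from hr)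
        refine ih r1 q1 hdeg hq1 ?_
        simp only [map_mul, map_sub, Polynomial.aeval_X, Polynomial.aeval_C] at h
        apply mul_left_cancel₀ hsa
        linear_combination h
      · exfalso
        obtain ⟨O, hO, hs1, hs2⟩ := hloc a
        have htO : s ∈ O := by
          have h1 : s - algebraMap K F a ∈ O := (O.valuation_le_one_iff _).1 hs1.le
          simpa using add_mem h1 (hO a)
        have h2 := val_eval_unit O hO s a hs1 r hr
        have h4 := val_mul_lt O hs2 (aeval_mem_O O hO s htO q1)
        rw [show (s - algebraMap K F a) * H * Polynomial.aeval s q1 = Polynomial.aeval s r by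
          rw [← h]; ring, h2] at h4
        exact lt_irrefl _ h4
  obtain ⟨r, q, h⟩ := (IntermediateField.mem_adjoin_simple_iff K H).1 hH
  by_cases hq : q = 0
  · rw [h, hq]; simp
  · refine main _ r q rfl hq ?_
    have := hne q hq
    rw [h]; field_simp
end
end Irr
end

section
open Matrix MvPolynomial
namespace Irr

section
variable {F : Type*} [Field F]

lemma det_val_lt (O : ValuationSubring F) {n : Type*} [Fintype n] [DecidableEq n]
    (M : Matrix n n F) (hM : ∀ i j, M i j ∈ O) (i0 : n) (h0 : ∀ j, O.valuation (M i0 j) < 1) :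
    O.valuation M.det < 1 := by
  rw [det_apply]
  refine Valuation.map_sum_lt _ one_ne_zero fun σ _ => ?_
  have h1 : O.valuation (∏ i, M (σ i) i) < 1 := by
    rw [← Finset.mul_prod_erase Finset.univ _ (Finset.mem_univ (σ.symm i0))]
    refine val_mul_lt O ?_ (prod_mem fun i _ => hM _ _)
    rw [Equiv.apply_symm_apply]; exact h0 _
  rcases Int.units_eq_one_or (Equiv.Perm.sign σ) with h | h
  · rw [h, one_smul]; exact h1
  · rw [h, Units.neg_smul, one_smul, Valuation.map_neg]; exact h1

lemma aeval_smul_hom {K : Type*} [CommSemiring K] [Algebra K F] {ι : Type*} (f : MvPolynomial ι K)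
    {r : ℕ} (hf : f.IsHomogeneous r) (c : F) (x : ι → F) :
    aeval (c • x) f = c ^ r * aeval x f := by
  rw [aeval_def, aeval_def, eval₂_eq, eval₂_eq, Finset.mul_sum]
  refine Finset.sum_congr rfl fun d hd => ?_
  have h1 : ∏ i ∈ d.support, (c • x) i ^ d i = c ^ r * ∏ i ∈ d.support, x i ^ d i := by
    simp only [Pi.smul_apply, smul_eq_mul, mul_pow, Finset.prod_mul_distrib]
    rw [Finset.prod_pow_eq_pow_sum]
    have := hf (mem_support_iff.1 hd)
    rw [Finsupp.weight_apply, Finsupp.sum] at this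
    simp at this
    rw [this]
  rw [h1]; ring

lemma aeval_mem_O' {K : Type*} [CommSemiring K] [Algebra K F] {ι : Type*} (O : ValuationSubring F)
    (hO : ∀ c : K, algebraMap K F c ∈ O) (x : ι → F) (hx : ∀ i, x i ∈ O) (f : MvPolynomial ι K) :
    aeval x f ∈ O := by
  rw [aeval_def, eval₂_eq]
  exact sum_mem fun d _ => mul_mem (hO _) (prod_mem fun i _ => pow_mem (hx i) _)

variable [CharZero F]

lemma der_map_mul {k l m : ℕ} (D : Derivation ℚ F F) (B : Matrix (Fin k) (Fin l) F)
    (w : Matrix (Fin l) (Fin m) F) : (B * w).map D = B * w.map D + B.map D * w := by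
  ext i j
  simp only [map_apply, Matrix.add_apply, Matrix.mul_apply, map_sum, Derivation.leibniz,
    smul_eq_mul, Finset.sum_add_distrib]
  congr 1
  exact Finset.sum_congr rfl fun _ _ => mul_comm _ _

/-- conjugation of a derivation by an automorphism -/
noncomputable def conjDer (σ : F ≃+* F) (D : Derivation ℚ F F) : Derivation ℚ F F :=
  Derivation.mk' ((σ.symm.toAddMonoidHom.comp
    (D.toLinearMap.toAddMonoidHom.comp σ.toAddMonoidHom)).toRatLinearMap) (fun a b => by
    change σ.symm (D (σ (a * b))) = a • σ.symm (D (σ b)) + b • σ.symm (D (σ a))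
    simp)

lemma conjDer_apply (σ : F ≃+* F) (D : Derivation ℚ F F) (x : F) :
    conjDer σ D x = σ.symm (D (σ x)) := rfl

lemma der_zero_adjoin {K : Type*} [Field K] [Algebra K F] (D : Derivation ℚ F F) (s : F)
    (hK : ∀ c : K, D (algebraMap K F c) = 0) (hs : D s = 0) (x : F)
    (hx : x ∈ IntermediateField.adjoin K {s}) : D x = 0 := by
  induction hx using IntermediateField.adjoin_induction with
  | mem x hx => rw [Set.mem_singleton_iff.1 hx, hs]
  | algebraMap c => exact hK c
  | add x y _ _ hx hy => rw [map_add, hx, hy, add_zero]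
  | inv x _ hx => rw [Derivation.leibniz_inv, hx, smul_zero]
  | mul x y _ _ hx hy => rw [Derivation.leibniz, hx, hy]; simp

lemma der_comm_aut {K : Type*} [Field K] [Algebra K F] (s : F)
    (halg : ∀ x : F, IsAlgebraic (IntermediateField.adjoin K {s}) x)
    (σ : F ≃ₐ[IntermediateField.adjoin K {s}] F) (D : Derivation ℚ F F)
    (hK : ∀ c : K, ∃ c' : K, D (algebraMap K F c) = algebraMap K F c')
    (hs : ∃ c' : K, D s = algebraMap K F c') (x : F) : D (σ x) = σ (D x) := by
  have hσ : ∀ y ∈ IntermediateField.adjoin K {s}, σ y = y := fun y hy => σ.commutes ⟨y, hy⟩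
  have hσ' : ∀ y ∈ IntermediateField.adjoin K {s}, σ.symm y = y := fun y hy =>
    σ.symm.commutes ⟨y, hy⟩
  have hc : ∀ c : K, algebraMap K F c ∈ IntermediateField.adjoin K {s} := fun c =>
    IntermediateField.algebraMap_mem _ c
  have hsm := IntermediateField.mem_adjoin_simple_self K s
  let D' : Derivation ℚ F F := conjDer σ.toRingEquiv D - D
  have hD' : ∀ y, D' y = σ.symm (D (σ y)) - D y := fun y => rfl
  have hz : ∀ y ∈ IntermediateField.adjoin K {s}, D' y = 0 := by
    intro y hy
    refine der_zero_adjoin D' s (fun c => ?_) ?_ y hy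
    · obtain ⟨c', hc'⟩ := hK c
      rw [hD', hσ _ (hc c), hc', hσ' _ (hc c'), sub_self]
    · obtain ⟨c', hc'⟩ := hs
      rw [hD', hσ _ hsm, hc', hσ' _ (hc c'), sub_self]
  have h1 : D' x = 0 := der_alg_zero' (M := IntermediateField.adjoin K {s}) D'
    (fun a => hz a a.2) x (halg x)
  rw [hD', sub_eq_zero] at h1
  rw [← h1, AlgEquiv.apply_symm_apply]
end
end Irr
end

section
open Matrix MvPolynomial
namespace Irr

/-- twisted derivative of a matrix -/
noncomputable def twD {F : Type*} [Field F] [CharZero F] {K : Type*} [Field K] [Algebra K F] {k m : ℕ}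
    (δ : Derivation ℚ F F) (v : Matrix (Fin m) (Fin m) K) (w : Matrix (Fin k) (Fin m) F) :
    Matrix (Fin k) (Fin m) F := w.map δ + w * v.map (algebraMap K F)

/-- data for the null-trace theorem -/
structure NTD (F K : Type*) [Field F] [CharZero F] [Field K] [Algebra K F]
    (k m d : ℕ) (J Q : Type*) [Fintype J] [DecidableEq J] [Fintype Q] where
  Ds : Derivation ℚ F F
  s : F
  Ds_s : Ds s = 1
  Ds_K : ∀ c : K, Ds (algebraMap K F c) = 0
  alg : ∀ x : F, IsAlgebraic (IntermediateField.adjoin K {s}) x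
  δ : Q → Derivation ℚ F F
  δ_K : ∀ q (c : K), ∃ c' : K, δ q (algebraMap K F c) = algebraMap K F c'
  δ_s : ∀ q, δ q s = 0
  v : Q → Matrix (Fin m) (Fin m) K
  qA : PluckIdx k m → Q
  ε : J → ℕ
  c : J → Q → MvPolynomial (PluckIdx k m) K
  c_hom : ∀ j q, (c j q).IsHomogeneous (ε j)
  r : ℕ
  deg : r + m + ∑ j, ε j = d
  e : Option (Option J) ⊕ (Fin k × Fin k) ≃ Fin k × Fin m
  P : Matrix (Fin k) (Fin m) F → Prop
  P_pl : ∀ w, P w → pl w ≠ 0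
  P_B : ∀ w (B : Matrix (Fin k) (Fin k) F), P w → B.det ≠ 0 → P (B * w)
  ξ : Matrix (Fin k) (Fin m) F → Matrix (Fin k) (Fin m) F →ₗ[F] F
  ξ_E : ∀ w, P w → ∀ ab, ξ w (Ew w ab) = 0
  ξ_s : ∀ w, P w → ξ w (w.map Ds) = 0
  ξ_j : ∀ w, P w → ∀ j, ξ w (∑ q, aeval (pl w) (c j q) • twD (δ q) (v q) w) = 0
  ξ_A : ∀ w, P w → ∀ A, ξ w (twD (δ (qA A)) (v (qA A)) w) = - pl w A ^ d

namespace NTD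
variable {F K : Type*} [Field F] [CharZero F] [Field K] [Algebra K F]
  {k m d : ℕ} {J Q : Type*} [Fintype J] [DecidableEq J] [Fintype Q] (N : NTD F K k m d J Q)

noncomputable def row (A : PluckIdx k m) (w : Matrix (Fin k) (Fin m) F) :
    Option (Option J) → Matrix (Fin k) (Fin m) F
  | none => twD (N.δ (N.qA A)) (N.v (N.qA A)) w
  | some none => w.map N.Ds
  | some (some j) => ∑ q, aeval (pl w) (N.c j q) • twD (N.δ q) (N.v q) w

noncomputable def tau (A : PluckIdx k m) (w : Matrix (Fin k) (Fin m) F) : F :=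
  Om N.e w (N.row A w) / pl w A ^ d

lemma tau_indep (w : Matrix (Fin k) (Fin m) F) (hw : N.P w) (A A' : PluckIdx k m)
    (hA : pl w A ≠ 0) (hA' : pl w A' ≠ 0) : N.tau A w = N.tau A' w := by
  have h1 : ∀ B, N.row B w = Function.update (N.row A w) none
      (twD (N.δ (N.qA B)) (N.v (N.qA B)) w) := by
    intro B
    ext o : 1
    rcases o with _ | _ | j <;> simp [row, Function.update]
  have h2 := Om_update_sub N.e w (N.row A w) none (pl w A' ^ d) (pl w A ^ d)
    (twD (N.δ (N.qA A)) (N.v (N.qA A)) w) (twD (N.δ (N.qA A')) (N.v (N.qA A')) w)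
  rw [← h1, ← h1, Om_eq_zero N.e w _ (N.ξ w) ?_ (N.ξ_E w hw) ?_] at h2
  · rw [tau, tau]
    have := pow_ne_zero d hA
    have := pow_ne_zero d hA'
    field_simp
    linear_combination -h2
  · intro h0
    have := N.ξ_A w hw A
    rw [h0] at this
    simp [hA] at this
  · intro o
    rcases o with _ | _ | j
    · simp only [Function.update_self, map_sub, map_smul, N.ξ_A w hw, smul_eq_mul]; ring
    · exact N.ξ_s w hw
    · exact N.ξ_j w hw j

lemma twD_mul (δ : Derivation ℚ F F) (v : Matrix (Fin m) (Fin m) K)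
    (B : Matrix (Fin k) (Fin k) F) (w : Matrix (Fin k) (Fin m) F) :
    twD δ v (B * w) = B * twD δ v w + B.map δ * w := by
  rw [twD, twD, der_map_mul, Matrix.mul_add, Matrix.mul_assoc]; abel

lemma tau_B (w : Matrix (Fin k) (Fin m) F) (B : Matrix (Fin k) (Fin k) F) (hB : B.det ≠ 0)
    (A : PluckIdx k m) : B.det ^ N.r * N.tau A (B * w) = N.tau A w := by
  let c : Option (Option J) → F
    | none => 1
    | some none => 1
    | some (some j) => B.det ^ N.ε j
  let C : Option (Option J) → Matrix (Fin k) (Fin k) F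
    | none => B.map (N.δ (N.qA A))
    | some none => B.map N.Ds
    | some (some j) => ∑ q, aeval (pl w) (N.c j q) • B.map (N.δ q)
  have h1 : N.row A (B * w) = fun o => c o • (B * N.row A w o + C o * w) := by
    ext o : 1
    rcases o with _ | _ | j
    · simp only [row, c, C, one_smul, twD_mul]
    · simp only [row, c, C, one_smul, der_map_mul]
    · simp only [row, c, C, twD_mul, pl_mul, aeval_smul_hom _ (N.c_hom j _)]
      rw [Matrix.mul_sum, Matrix.sum_mul, ← Finset.sum_add_distrib, Finset.smul_sum]
      refine Finset.sum_congr rfl fun q _ => ?_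
      rw [mul_smul, Matrix.mul_smul, Matrix.smul_mul, smul_add]
  have h2 : ∏ o, c o = B.det ^ (∑ j, N.ε j) := by
    rw [Fintype.prod_option, Fintype.prod_option]
    simp [c, Finset.prod_pow_eq_pow_sum]
  rw [tau, h1, Om_smul, h2, Om_transform _ _ _ _ hB, pl_mul, tau]
  simp only [Pi.smul_apply, smul_eq_mul, mul_pow]
  have h3 : B.det ^ d = B.det ^ N.r * B.det ^ m * B.det ^ (∑ j, N.ε j) := by
    rw [← pow_add, ← pow_add, N.deg]
  rw [h3]
  field_simp

/-- the summand of the trace -/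
noncomputable def G (f : MvPolynomial (PluckIdx k m) K) (A : PluckIdx k m) (w : Matrix (Fin k) (Fin m) F) : F :=
  aeval (pl w) f * N.tau A w

lemma G_B (f : MvPolynomial (PluckIdx k m) K) (hf : f.IsHomogeneous N.r)
    (w : Matrix (Fin k) (Fin m) F) (B : Matrix (Fin k) (Fin k) F) (hB : B.det ≠ 0)
    (A : PluckIdx k m) : N.G f A (B * w) = N.G f A w := by
  rw [G, G, ← N.tau_B w B hB A, pl_mul, aeval_smul_hom f hf]; ring

lemma pl_map (σ : F ≃ₐ[IntermediateField.adjoin K {N.s}] F) (w : Matrix (Fin k) (Fin m) F) :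
    pl (w.map σ) = fun S => σ (pl w S) := by
  ext S
  rw [pl, pl, AlgEquiv.map_det]; rfl

lemma aeval_map (σ : F ≃ₐ[IntermediateField.adjoin K {N.s}] F) (x : PluckIdx k m → F)
    (f : MvPolynomial (PluckIdx k m) K) : aeval (fun S => σ (x S)) f = σ (aeval x f) := by
  have hc : ∀ c : K, σ (algebraMap K F c) = algebraMap K F c := fun c =>
    σ.commutes ⟨_, IntermediateField.algebraMap_mem _ c⟩
  rw [aeval_def, aeval_def, eval₂_eq, eval₂_eq, map_sum]
  simp only [map_mul, map_prod, map_pow, hc]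

lemma twD_map (σ : F ≃ₐ[IntermediateField.adjoin K {N.s}] F) (q : Q)
    (w : Matrix (Fin k) (Fin m) F) :
    twD (N.δ q) (N.v q) (w.map σ) = (twD (N.δ q) (N.v q) w).map σ := by
  have hc : ∀ c : K, σ (algebraMap K F c) = algebraMap K F c := fun c =>
    σ.commutes ⟨_, IntermediateField.algebraMap_mem _ c⟩
  ext i j
  simp only [twD, Matrix.add_apply, map_apply, Matrix.mul_apply, map_add, map_sum, map_mul, hc]
  rw [der_comm_aut N.s N.alg σ (N.δ q) (N.δ_K q) ⟨0, by rw [N.δ_s, map_zero]⟩]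

lemma tau_map (σ : F ≃ₐ[IntermediateField.adjoin K {N.s}] F) (A : PluckIdx k m)
    (w : Matrix (Fin k) (Fin m) F) : N.tau A (w.map σ) = σ (N.tau A w) := by
  have h1 : ∀ o, N.row A (w.map σ) o = (N.row A w o).map σ := by
    intro o
    rcases o with _ | _ | j
    · exact N.twD_map σ _ w
    · ext i j
      simp only [row, map_apply]
      rw [der_comm_aut N.s N.alg σ N.Ds (fun c => ⟨0, by rw [N.Ds_K, map_zero]⟩)
        ⟨1, by rw [N.Ds_s, map_one]⟩]
    · simp only [row, twD_map, pl_map, aeval_map]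
      ext a b
      simp [Matrix.sum_apply]
  have h2 : Om N.e (w.map σ) (N.row A (w.map σ)) = σ (Om N.e w (N.row A w)) := by
    rw [Om, Om, AlgEquiv.map_det]
    congr 1
    ext r p
    cases r with
    | inl o => simp [rowsM, h1]
    | inr ab => simp only [rowsM, Ew, submatrix_apply, of_apply, id, Sum.elim_inr, map_apply,
        AlgEquiv.mapMatrix_apply, apply_ite σ, map_zero]
  rw [tau, h2, pl_map, tau, map_div₀, map_pow]

lemma G_map (σ : F ≃ₐ[IntermediateField.adjoin K {N.s}] F) (f : MvPolynomial (PluckIdx k m) K)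
    (A : PluckIdx k m) (w : Matrix (Fin k) (Fin m) F) : N.G f A (w.map σ) = σ (N.G f A w) := by
  rw [G, G, map_mul, tau_map, pl_map, aeval_map]

lemma G_local_nrm (O : ValuationSubring F) (hO : ∀ c : K, algebraMap K F c ∈ O) (ζ : F) (κ : Q → F)
    (hE : ∀ x ∈ O, O.valuation (ζ * N.Ds x) < 1)
    (hδ : ∀ q, ∀ x ∈ O, N.δ q x + κ q * N.Ds x ∈ O)
    (f : MvPolynomial (PluckIdx k m) K) (A : PluckIdx k m) (w : Matrix (Fin k) (Fin m) F)
    (hw : ∀ i j, w i j ∈ O) (hA : pl w A = 1) : O.valuation (ζ * N.G f A w) < 1 := by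
  have hpl : ∀ S, pl w S ∈ O := by
    intro S
    rw [pl, det_apply]
    refine sum_mem fun σ _ => ?_
    have h1 : ∏ i, (of fun i j => w i ↑(S.1.orderIsoOfFin S.2 j)) (σ i) i ∈ O :=
      prod_mem fun i _ => hw _ _
    rcases Int.units_eq_one_or (Equiv.Perm.sign σ) with h | h
    · rw [h, one_smul]; exact h1
    · rw [h, Units.neg_smul, one_smul]; exact neg_mem h1
  let c : Option (Option J) → F
    | none => κ (N.qA A)
    | some none => 0
    | some (some j) => ∑ q, aeval (pl w) (N.c j q) * κ q
  let z : Option (Option J) → F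
    | none => 1
    | some none => ζ
    | some (some j) => 1
  have htw : ∀ q i j, (twD (N.δ q) (N.v q) w + κ q • w.map N.Ds) i j ∈ O := by
    intro q i j
    have : (twD (N.δ q) (N.v q) w + κ q • w.map N.Ds) i j
      = (N.δ q (w i j) + κ q * N.Ds (w i j)) + ∑ l, w i l * algebraMap K F (N.v q l j) := by
      simp only [twD, Matrix.add_apply, map_apply, Matrix.mul_apply, Matrix.smul_apply, smul_eq_mul]
      ring
    rw [this]
    exact add_mem (hδ q _ (hw i j)) (sum_mem fun l _ => mul_mem (hw i l) (hO _))
  have h1 : ζ * Om N.e w (N.row A w)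
      = Om N.e w (fun o => z o • (N.row A w o + c o • N.row A w (some none))) := by
    rw [Om_smul, Om_add_row _ _ _ (some none) c rfl, Fintype.prod_option, Fintype.prod_option]
    simp [z]
  have h2 : O.valuation (ζ * Om N.e w (N.row A w)) < 1 := by
    rw [h1]
    have hlast : ∀ i j, O.valuation ((z (some none) • (N.row A w (some none) +
        c (some none) • N.row A w (some none))) i j) < 1 := by
      intro i j
      simp only [z, c, row, zero_smul, add_zero, Matrix.smul_apply, map_apply, smul_eq_mul]
      exact hE _ (hw i j)
    refine det_val_lt O _ ?_ (Sum.inl (some none)) (fun p => hlast _ _)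
    intro r p
    rcases r with o | ab
    · change (z o • (N.row A w o + c o • N.row A w (some none))) (N.e p).1 (N.e p).2 ∈ O
      rcases o with _ | _ | j
      · simp only [z, one_smul]
        exact htw _ _ _
      · exact (O.valuation_le_one_iff _).1 (hlast _ _).le
      · have : z (some (some j)) • (N.row A w (some (some j)) + c (some (some j)) •
            N.row A w (some none))
            = ∑ q, aeval (pl w) (N.c j q) • (twD (N.δ q) (N.v q) w + κ q • w.map N.Ds) := by
          simp only [z, row, c, one_smul, Finset.sum_smul, ← Finset.sum_add_distrib, smul_add,
            mul_smul]
        rw [this, Matrix.sum_apply]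
        refine sum_mem fun q _ => ?_
        rw [Matrix.smul_apply, smul_eq_mul]
        exact mul_mem (aeval_mem_O' O hO _ hpl _) (htw _ _ _)
    · change Ew w ab (N.e p).1 (N.e p).2 ∈ O
      simp only [Ew, of_apply]
      split_ifs
      · exact hw _ _
      · exact zero_mem _
  have h3 : ζ * N.G f A w = (ζ * Om N.e w (N.row A w)) * aeval (pl w) f := by
    rw [G, tau, hA, one_pow, div_one]; ring
  rw [h3]
  exact val_mul_lt O h2 (aeval_mem_O' O hO _ hpl _)

lemma G_indep (f : MvPolynomial (PluckIdx k m) K) (w : Matrix (Fin k) (Fin m) F) (hw : N.P w)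
    (A A' : PluckIdx k m) (hA : pl w A ≠ 0) (hA' : pl w A' ≠ 0) : N.G f A w = N.G f A' w := by
  rw [G, G, N.tau_indep w hw A A' hA hA']

lemma G_local (O : ValuationSubring F) (hO : ∀ c : K, algebraMap K F c ∈ O) (ζ : F) (κ : Q → F)
    (hE : ∀ x ∈ O, O.valuation (ζ * N.Ds x) < 1)
    (hδ : ∀ q, ∀ x ∈ O, N.δ q x + κ q * N.Ds x ∈ O)
    (f : MvPolynomial (PluckIdx k m) K) (hf : f.IsHomogeneous N.r) (A : PluckIdx k m)
    (w : Matrix (Fin k) (Fin m) F) (hw : N.P w)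
    (hA : pl w A ≠ 0) : O.valuation (ζ * N.G f A w) < 1 := by
  obtain ⟨A', -, hA'⟩ := Finset.exists_max_image Finset.univ (fun S => O.valuation (pl w S))
    ⟨A, Finset.mem_univ _⟩
  have hA'0 : pl w A' ≠ 0 := by
    intro h0
    have := hA' A (Finset.mem_univ _)
    rw [h0, map_zero] at this
    simp [hA] at this
  have hB : (cs w A')⁻¹.det ≠ 0 := by
    rw [det_nonsing_inv, det_cs]; simpa using hA'0
  rw [N.G_indep f w hw A A' hA hA'0, ← N.G_B f hf w _ hB]
  change O.valuation (ζ * N.G f A' (nrm w A')) < 1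
  refine N.G_local_nrm O hO ζ κ hE hδ f A' _ ?_ ?_
  · intro i j
    rw [nrm_apply w A' hA'0, plT_lam, Finset.mul_sum]
    refine sum_mem fun S _ => ?_
    have h1 : (pl w A')⁻¹ * ((lam F (Function.update (en A') i j) S : F) * pl w S)
      = (lam F (Function.update (en A') i j) S : F) * ((pl w A')⁻¹ * pl w S) := by ring
    rw [h1]
    refine mul_mem (intCast_mem _ _) ?_
    rw [← O.valuation_le_one_iff, map_mul, map_inv₀]
    have h2 := hA' S (Finset.mem_univ _)
    have h3 : O.valuation (pl w A') ≠ 0 := by simpa using hA'0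
    calc (O.valuation (pl w A'))⁻¹ * O.valuation (pl w S)
        ≤ (O.valuation (pl w A'))⁻¹ * O.valuation (pl w A') := by gcongr
      _ = 1 := inv_mul_cancel₀ h3
  · rw [← det_cs, cs_nrm w A' hA'0, det_one]

theorem null_trace [IsAlgClosed K] [IsAlgClosed F]
    (f : MvPolynomial (PluckIdx k m) K) (hf : f.IsHomogeneous N.r)
    {Θ : Type*} [Fintype Θ] (w : Θ → Matrix (Fin k) (Fin m) F) (hw : ∀ θ, N.P (w θ))
    (A : Θ → PluckIdx k m) (hA : ∀ θ, pl (w θ) (A θ) ≠ 0)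
    (hσ : ∀ σ : F ≃ₐ[IntermediateField.adjoin K {N.s}] F, ∃ π : Equiv.Perm Θ, ∀ θ,
      ∃ B : Matrix (Fin k) (Fin k) F, B.det ≠ 0 ∧ (w θ).map σ = B * w (π θ)) :
    ∑ θ, N.G f (A θ) (w θ) = 0 := by
  have hs : Transcendental K N.s := by
    intro h
    have := der_alg_zero' (M := K) N.Ds N.Ds_K N.s h
    rw [N.Ds_s] at this
    exact one_ne_zero this
  have hs0 : N.s ≠ 0 := by
    intro h; rw [h] at hs; exact hs isAlgebraic_zero
  refine ratfun_zero N.s hs _ ?_ ?_ ?_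
  · let M := IntermediateField.adjoin K {N.s}
    haveI : Algebra.IsAlgebraic M F := ⟨N.alg⟩
    haveI : CharZero M := inferInstance
    haveI : IsAlgClosure M F := ⟨inferInstance, inferInstance⟩
    haveI : Normal M F := IsAlgClosure.normal M F
    haveI : IsGalois M F := ⟨⟩
    have h1 : (∑ θ, N.G f (A θ) (w θ)) ∈ (⊥ : IntermediateField M F) := by
      rw [InfiniteGalois.mem_bot_iff_fixed]
      intro σ
      obtain ⟨π, hπ⟩ := hσ σ
      rw [map_sum, ← Equiv.sum_comp π (fun θ => N.G f (A θ) (w θ))]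
      refine Finset.sum_congr rfl fun θ _ => ?_
      obtain ⟨B, hB, hwB⟩ := hπ θ
      rw [← G_map, hwB, N.G_B f hf _ B hB]
      refine N.G_indep f _ (hw _) _ _ ?_ (hA _)
      intro h0
      have h2 : pl ((w θ).map σ) (A θ) = 0 := by rw [hwB, pl_mul]; simp [h0]
      rw [N.pl_map σ] at h2
      exact hA θ (by simpa using h2)
    obtain ⟨y, hy⟩ := IntermediateField.mem_bot.1 h1
    rw [← hy]; exact y.2
  · intro a
    have e1 : IntermediateField.adjoin K {N.s - algebraMap K F a}
        = IntermediateField.adjoin K {N.s} := by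
      apply le_antisymm
      · rw [IntermediateField.adjoin_simple_le_iff]
        exact sub_mem (IntermediateField.mem_adjoin_simple_self K _)
          (IntermediateField.algebraMap_mem _ a)
      · rw [IntermediateField.adjoin_simple_le_iff]
        have := add_mem (IntermediateField.mem_adjoin_simple_self K (N.s - algebraMap K F a))
          (IntermediateField.algebraMap_mem _ a)
        simpa using this
    have htr : Transcendental K (N.s - algebraMap K F a) := by
      intro h
      have := der_alg_zero' (M := K) N.Ds N.Ds_K _ h
      rw [map_sub, N.Ds_s, N.Ds_K, sub_zero] at this
      exact one_ne_zero this
    obtain ⟨O, hO, hu, hD⟩ := local_val (K := K) (N.s - algebraMap K F a) htr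
      (fun x => by rw [e1]; exact N.alg x)
    refine ⟨O, hO, hu, ?_⟩
    rw [Finset.mul_sum]
    refine Valuation.map_sum_lt _ one_ne_zero fun θ _ => ?_
    refine N.G_local O hO _ (fun q => N.δ q (algebraMap K F a)) ?_ ?_ f hf _ _ (hw θ) (hA θ)
    · have h1 := (hD ((N.s - algebraMap K F a) • N.Ds)
        (fun c => ⟨0, by simp [N.Ds_K]⟩)
        ⟨1, by simp [N.Ds_K, N.Ds_s]⟩).2 (fun c => by simp [N.Ds_K])
      intro x hx
      simpa using h1 x hx
    · intro q x hx
      have h1 := (hD (N.δ q + N.δ q (algebraMap K F a) • N.Ds)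
        (fun c => by
          obtain ⟨c', hc'⟩ := N.δ_K q c
          exact ⟨c', by simp [N.Ds_K, hc']⟩)
        ⟨0, by simp [N.Ds_K, N.Ds_s, N.δ_s]⟩).1 x hx
      simpa using h1
  · have e1 : IntermediateField.adjoin K {N.s⁻¹} = IntermediateField.adjoin K {N.s} := by
      apply le_antisymm
      · rw [IntermediateField.adjoin_simple_le_iff]
        exact inv_mem (IntermediateField.mem_adjoin_simple_self K _)
      · rw [IntermediateField.adjoin_simple_le_iff]
        have := inv_mem (IntermediateField.mem_adjoin_simple_self K (N.s⁻¹))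
        simpa using this
    have htr : Transcendental K (N.s⁻¹) := by
      intro h
      have := der_alg_zero' (M := K) N.Ds N.Ds_K _ h
      rw [Derivation.leibniz_inv, N.Ds_s] at this
      simp [hs0] at this
    obtain ⟨O, hO, hu, hD⟩ := local_val (K := K) (N.s⁻¹) htr
      (fun x => by rw [e1]; exact N.alg x)
    refine ⟨O, hO, hu, ?_⟩
    rw [Finset.mul_sum]
    refine Valuation.map_sum_lt _ one_ne_zero fun θ _ => ?_
    refine N.G_local O hO _ (fun q => 0) ?_ ?_ f hf _ _ (hw θ) (hA θ)
    · have h1 := (hD (N.s • N.Ds)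
        (fun c => ⟨0, by simp [N.Ds_K]⟩)
        ⟨-1, by
          rw [Derivation.smul_apply, Derivation.leibniz_inv, N.Ds_s]; simp; field_simp⟩).2
          (fun c => by simp [N.Ds_K])
      intro x hx
      simpa using h1 x hx
    · intro q x hx
      have h1 := (hD (N.δ q) (N.δ_K q)
        ⟨0, by rw [Derivation.leibniz_inv, N.δ_s]; simp⟩).1 x hx
      simpa using h1

/-- version with arbitrary coefficients -/
theorem null_trace' [IsAlgClosed K] [IsAlgClosed F]
    (f : MvPolynomial (PluckIdx k m) F) (hf : f.IsHomogeneous N.r)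
    {Θ : Type*} [Fintype Θ] (w : Θ → Matrix (Fin k) (Fin m) F) (hw : ∀ θ, N.P (w θ))
    (A : Θ → PluckIdx k m) (hA : ∀ θ, pl (w θ) (A θ) ≠ 0)
    (hσ : ∀ σ : F ≃ₐ[IntermediateField.adjoin K {N.s}] F, ∃ π : Equiv.Perm Θ, ∀ θ,
      ∃ B : Matrix (Fin k) (Fin k) F, B.det ≠ 0 ∧ (w θ).map σ = B * w (π θ)) :
    ∑ θ, eval (pl (w θ)) f * N.tau (A θ) (w θ) = 0 := by
  have h1 : ∀ x : PluckIdx k m → F, eval x f = ∑ u ∈ f.support,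
      coeff u f * aeval x (monomial u (1 : K)) := by
    intro x
    rw [eval_eq]
    refine Finset.sum_congr rfl fun u _ => ?_
    rw [aeval_monomial, map_one, one_mul, Finsupp.prod]
  simp only [h1, Finset.sum_mul]
  rw [Finset.sum_comm]
  refine Finset.sum_eq_zero fun u hu => ?_
  have h2 := N.null_trace (monomial u (1 : K)) (isHomogeneous_monomial _ (by
    have := hf (mem_support_iff.1 hu)
    rw [Finsupp.weight_apply] at this
    simp [Finsupp.sum] at this
    exact this)) w hw A hA hσ
  simp only [mul_assoc, ← Finset.mul_sum]
  simp only [G] at h2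
  rw [h2, mul_zero]
end NTD
end Irr
end

section
namespace Irr
section
variable {F : Type*} [Field F] {V : Type*} [AddCommGroup V] [Module F V] [DecidableEq V]

/-- Cayley-Bacharach for products of linear forms -/
def CBl (r : ℕ) (S : Finset V) : Prop :=
  ∀ l : List (Module.Dual F V), l.length = r → ∀ p ∈ S,
    (∀ q ∈ S, q ≠ p → (l.map (fun a => a q)).prod = 0) → (l.map (fun a => a p)).prod = 0

lemma exists_dual_sep (W : Submodule F V) (p : V) (hp : p ∉ W) :
    ∃ a : Module.Dual F V, (∀ x ∈ W, a x = 0) ∧ a p ≠ 0 := by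
  obtain ⟨a, h1, h2⟩ := Submodule.exists_le_ker_of_notMem hp
  exact ⟨a, fun x hx => h2 hx, h1⟩

lemma CBl.filter {r : ℕ} {S : Finset V} (h : CBl (F := F) (r + 1) S) (a : Module.Dual F V)
    [DecidablePred fun x => a x ≠ 0] : CBl (F := F) r (S.filter fun x => a x ≠ 0) := by
  intro l hl p hp hq
  rw [Finset.mem_filter] at hp
  have := h (a :: l) (by simp [hl]) p hp.1 (fun q hqS hqp => by
    by_cases h0 : a q = 0
    · simp [h0]
    · simp [hq q (Finset.mem_filter.2 ⟨hqS, h0⟩) hqp])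
  simpa [hp.2] using this

lemma CBl.card_ge {r : ℕ} : ∀ {S : Finset V}, CBl (F := F) r S → (∀ p ∈ S, p ≠ 0) →
    (∀ p ∈ S, ∀ q ∈ S, p ≠ q → p ∉ Submodule.span F {q}) → S.Nonempty → r + 2 ≤ S.card := by
  classical
  induction r with
  | zero =>
    intro S h h0 hnp ⟨p, hp⟩
    by_contra hc
    have h1 : ∀ q ∈ S, q = p := fun q hq => Finset.card_le_one.1 (by omega) q hq p hp
    have := h [] rfl p hp (fun q hq hqp => absurd (h1 q hq) hqp)
    simp at this
  | succ r ih =>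
    intro S h h0 hnp ⟨p, hp⟩
    by_cases h1 : ∀ q ∈ S, q = p
    · obtain ⟨a, -, ha⟩ := exists_dual_sep (⊥ : Submodule F V) p (by simpa using h0 p hp)
      have := h (List.replicate (r + 1) a) (by simp) p hp (fun q hq hqp => absurd (h1 q hq) hqp)
      simp [ha] at this
    · push Not at h1
      obtain ⟨q, hq, hqp⟩ := h1
      obtain ⟨a, ha, hap⟩ := exists_dual_sep _ p (hnp p hp q hq (Ne.symm hqp))
      have haq : a q = 0 := ha q (Submodule.mem_span_singleton_self q)
      have h2 := ih (h.filter a) (fun x hx => h0 x (Finset.mem_filter.1 hx).1)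
        (fun x hx y hy => hnp x (Finset.mem_filter.1 hx).1 y (Finset.mem_filter.1 hy).1)
        ⟨p, Finset.mem_filter.2 ⟨hp, hap⟩⟩
      have h3 : (S.filter fun x => a x ≠ 0).card < S.card := by
        apply Finset.card_lt_card
        refine ⟨Finset.filter_subset _ _, fun h => ?_⟩
        exact (Finset.mem_filter.1 (h hq)).2 haq
      omega

lemma CBl.collinear {r : ℕ} : ∀ {S : Finset V}, CBl (F := F) r S → (∀ p ∈ S, p ≠ 0) →
    (∀ p ∈ S, ∀ q ∈ S, p ≠ q → p ∉ Submodule.span F {q}) → S.card ≤ 2 * r + 1 →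
    ∃ W : Submodule F V, Module.Finite F W ∧ Module.finrank F W ≤ 2 ∧ ∀ p ∈ S, p ∈ W := by
  classical
  have small : ∀ S : Finset V, S.card ≤ 2 → 
      ∃ W : Submodule F V, Module.Finite F W ∧ Module.finrank F W ≤ 2 ∧ ∀ p ∈ S, p ∈ W :=
    fun S hS => ⟨Submodule.span F S, inferInstance, (finrank_span_finset_le_card S).trans hS,
      fun p hp => Submodule.subset_span hp⟩
  induction r with
  | zero => intro S h h0 hnp hc; exact small S (by omega)
  | succ r ih =>
    intro S h h0 hnp hc
    by_cases hS : S.card ≤ 2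
    · exact small S hS
    obtain ⟨T, hTS, hT⟩ := Finset.exists_subset_card_eq (show 2 ≤ S.card by omega)
    by_cases hin : ∀ p ∈ S, p ∈ Submodule.span F (T : Set V)
    · exact ⟨Submodule.span F T, inferInstance, (finrank_span_finset_le_card T).trans hT.le, hin⟩
    push Not at hin
    obtain ⟨p, hp, hpT⟩ := hin
    obtain ⟨a, ha, hap⟩ := exists_dual_sep _ p hpT
    have hsub : ∀ b : Module.Dual F V, ∀ x ∈ S.filter (fun x => b x ≠ 0), x ∈ S :=
      fun b x hx => (Finset.mem_filter.1 hx).1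
    have hd : (S.filter fun x => a x ≠ 0).card ≤ 2 * r + 1 := by
      have h1 : (S.filter fun x => a x ≠ 0) ⊆ S \ T := by
        intro x hx
        rw [Finset.mem_filter] at hx
        refine Finset.mem_sdiff.2 ⟨hx.1, fun hxT => hx.2 (ha x (Submodule.subset_span hxT))⟩
      have h2 := Finset.card_le_card h1
      rw [Finset.card_sdiff_of_subset hTS] at h2
      omega
    obtain ⟨W, hWf, hW2, hW⟩ := ih (h.filter a) (fun x hx => h0 x (hsub a x hx))
        (fun x hx y hy => hnp x (hsub a x hx) y (hsub a y hy)) hd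
    refine ⟨W, hWf, hW2, ?_⟩
    by_contra hcon
    push Not at hcon
    obtain ⟨q, hq, hqW⟩ := hcon
    obtain ⟨b, hb, hbq⟩ := exists_dual_sep _ q hqW
    have c1 := (h.filter a).card_ge (fun x hx => h0 x (hsub a x hx))
        (fun x hx y hy => hnp x (hsub a x hx) y (hsub a y hy))
        ⟨p, Finset.mem_filter.2 ⟨hp, hap⟩⟩
    have c2 := (h.filter b).card_ge (fun x hx => h0 x (hsub b x hx))
        (fun x hx y hy => hnp x (hsub b x hx) y (hsub b y hy))
        ⟨q, Finset.mem_filter.2 ⟨hq, hbq⟩⟩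
    have hdis : Disjoint (S.filter fun x => a x ≠ 0) (S.filter fun x => b x ≠ 0) := by
      rw [Finset.disjoint_left]
      intro x hx hx'
      exact (Finset.mem_filter.1 hx').2 (hb x (hW x hx))
    have h3 := Finset.card_le_card (Finset.union_subset (Finset.filter_subset (fun x => a x ≠ 0) S)
      (Finset.filter_subset (fun x => b x ≠ 0) S))
    rw [Finset.card_union_of_disjoint hdis] at h3
    omega
end
end Irr
end

section
open Matrix MvPolynomial
namespace Irr

section
variable {F : Type*} [Field F] {k m : ℕ}

lemma der_aevalQ [CharZero F] {ι : Type*} [Fintype ι] (D : Derivation ℚ F F) (x : ι → F)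
    (p : MvPolynomial ι ℚ) :
    D (aeval x p) = ∑ i, aeval x (pderiv i p) * D (x i) := by
  classical
  induction p using MvPolynomial.induction_on with
  | C a => simpa using D.map_algebraMap a
  | add p q hp hq => simp [hp, hq, add_mul, Finset.sum_add_distrib]
  | mul_X p i hp =>
    have h : ∀ j, aeval x (pderiv j (p * X i)) * D (x j)
        = aeval x p * (if j = i then D (x i) else 0) + x i * (aeval x (pderiv j p) * D (x j)) := by
      intro j
      rw [Derivation.leibniz, pderiv_X]
      by_cases hj : j = i
      · subst hj; simp; ring
      · simp [hj, Pi.single_apply, Ne.symm hj]; ring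
    rw [Finset.sum_congr rfl fun j _ => h j]
    simp only [Finset.sum_add_distrib, ← Finset.mul_sum, map_mul, aeval_X, Derivation.leibniz,
      smul_eq_mul, hp]
    simp

/-- derivative of a polynomial evaluation -/
lemma der_eval [CharZero F] {ι : Type*} [Fintype ι] (D : Derivation ℚ F F) (x : ι → F)
    (p : MvPolynomial ι F) (T : Finset (ι →₀ ℕ)) (hT : p.support ⊆ T) :
    D (eval x p) = ∑ β ∈ T, D (coeff β p) * (∏ i, x i ^ β i)
      + ∑ i, eval x (pderiv i p) * D (x i) := by
  classical
  have hp : p = ∑ β ∈ T, monomial β (coeff β p) := by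
    conv_lhs => rw [p.as_sum]
    refine Finset.sum_subset hT fun β _ h => ?_
    rw [notMem_support_iff.1 h, monomial_zero]
  have hm : ∀ β (c : F), eval x (monomial β c) = c * ∏ i, x i ^ β i := by
    intro β c
    rw [eval_monomial, Finsupp.prod_fintype]; simp
  have h1 : ∀ β (c : F), D (eval x (monomial β c)) = D c * (∏ i, x i ^ β i)
      + ∑ i, eval x (pderiv i (monomial β c)) * D (x i) := by
    intro β c
    have h2 := der_aevalQ D x (monomial β (1 : ℚ))
    have h3 : ∀ β (q : ℚ), aeval x (monomial β q) = algebraMap ℚ F q * ∏ i, x i ^ β i := by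
      intro β q
      rw [aeval_monomial, Finsupp.prod_fintype]; simp
    rw [h3, map_one, one_mul] at h2
    rw [hm, Derivation.leibniz, h2, smul_eq_mul, smul_eq_mul, Finset.mul_sum, add_comm]
    congr 1
    · ring
    · refine Finset.sum_congr rfl fun i _ => ?_
      rw [pderiv_monomial, pderiv_monomial, h3, hm]
      simp; ring
  conv_lhs => rw [hp, map_sum, map_sum]
  simp only [h1]
  rw [Finset.sum_add_distrib]
  congr 1
  rw [Finset.sum_comm]
  refine Finset.sum_congr rfl fun i _ => ?_
  rw [← Finset.sum_mul]
  congr 1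
  conv_rhs => rw [hp, map_sum, map_sum]

lemma trace_adj_col {F : Type*} [CommRing F] (M N : Matrix (Fin k) (Fin k) F) :
    (M.adjugate * N).trace = ∑ b, (M.updateCol b (fun a => N a b)).det := by
  simp only [Matrix.trace, Matrix.diag, ← cramer_apply]
  refine Finset.sum_congr rfl fun b _ => ?_
  rw [cramer_eq_adjugate_mulVec]; rfl

lemma der_prod {E F : Type*} [CommRing E] [CommRing F] [Algebra E F] {ι : Type*} [DecidableEq ι]
    (D : Derivation E F F) (s : Finset ι)
    (f : ι → F) : D (∏ i ∈ s, f i) = ∑ b ∈ s, ∏ i ∈ s, if i = b then D (f i) else f i := by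
  induction s using Finset.induction_on with
  | empty => simp
  | insert a s ha ih =>
    rw [Finset.prod_insert ha, Derivation.leibniz, ih, Finset.sum_insert ha, Finset.prod_insert ha]
    simp only [smul_eq_mul, if_true]
    rw [add_comm]
    congr 1
    · rw [mul_comm]; congr 1
      refine Finset.prod_congr rfl fun i hi => ?_
      rw [if_neg]; rintro rfl; exact ha hi
    · rw [Finset.mul_sum]
      refine Finset.sum_congr rfl fun b hb => ?_
      rw [Finset.prod_insert ha, if_neg]; rintro rfl; exact ha hb

lemma der_det {E F : Type*} [CommRing E] [CommRing F] [Algebra E F] (D : Derivation E F F) (M : Matrix (Fin k) (Fin k) F) :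
    D M.det = (M.adjugate * M.map D).trace := by
  rw [trace_adj_col]
  simp only [det_apply, map_sum]
  rw [Finset.sum_comm]
  refine Finset.sum_congr rfl fun σ _ => ?_
  rw [← Finset.smul_sum]
  have : ∀ (z : ℤˣ) (x : F), D (z • x) = z • D x := by
    intro z x
    rcases Int.units_eq_one_or z with rfl | rfl <;> simp
  rw [this, der_prod]
  congr 1
  refine Finset.sum_congr rfl fun b _ => Finset.prod_congr rfl fun a _ => ?_
  rw [updateCol_apply]
  split_ifs with h
  · rw [h]; rfl
  · rfl

/-- differential of the Plücker map -/
noncomputable def dpl (w : Matrix (Fin k) (Fin m) F) (S : PluckIdx k m) :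
    Matrix (Fin k) (Fin m) F →ₗ[F] F where
  toFun u := ((cs w S).adjugate * cs u S).trace
  map_add' u v := by
    rw [← trace_add, ← Matrix.mul_add]; rfl
  map_smul' c u := by
    rw [RingHom.id_apply, ← trace_smul, ← Matrix.mul_smul]; rfl

lemma dpl_apply (w u : Matrix (Fin k) (Fin m) F) (S : PluckIdx k m) :
    dpl w S u = ((cs w S).adjugate * cs u S).trace := rfl

lemma dpl_der [CharZero F] (D : Derivation ℚ F F) (w : Matrix (Fin k) (Fin m) F)
    (S : PluckIdx k m) : dpl w S (w.map D) = D (pl w S) := by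
  rw [← det_cs, der_det]; rfl

lemma dpl_mul (B : Matrix (Fin k) (Fin k) F) (w : Matrix (Fin k) (Fin m) F)
    (S : PluckIdx k m) : dpl w S (B * w) = B.trace * pl w S := by
  rw [dpl_apply, cs_mul, Matrix.trace_mul_comm, Matrix.mul_assoc, mul_adjugate, det_cs]
  simp [mul_comm]

lemma dpl_single (w : Matrix (Fin k) (Fin m) F) (i j : Fin m)
    (S : PluckIdx k m) : dpl w S (w * Matrix.single i j (1 : F))
      = ∑ b, if en S b = j then plT w (Function.update (en S) b i) else 0 := by
  rw [dpl_apply, trace_adj_col]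
  refine Finset.sum_congr rfl fun b _ => ?_
  split_ifs with h
  · rw [plT, submatrix_update]
    congr 2
    ext a
    rw [cs, submatrix_apply, h]; simp
  · refine det_eq_zero_of_column_eq_zero b fun a => ?_
    rw [updateCol_self]
    simp [cs, Matrix.mul_apply, Matrix.single_apply, Ne.symm h]

/-- the conormal functional of the hypersurface `g = 0` -/
noncomputable def xi (g : MvPolynomial (PluckIdx k m) F) (w : Matrix (Fin k) (Fin m) F) :
    Matrix (Fin k) (Fin m) F →ₗ[F] F := ∑ S, eval (pl w) (pderiv S g) • dpl w S

lemma xi_apply (g : MvPolynomial (PluckIdx k m) F) (w u : Matrix (Fin k) (Fin m) F) :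
    xi g w u = ∑ S, eval (pl w) (pderiv S g) * dpl w S u := by
  simp [xi]

lemma xi_mul (g : MvPolynomial (PluckIdx k m) F) {d : ℕ} (hg : g.IsHomogeneous d)
    (B : Matrix (Fin k) (Fin k) F)
    (w : Matrix (Fin k) (Fin m) F) : xi g w (B * w) = d * B.trace * eval (pl w) g := by
  have h := congrArg (eval (pl w)) hg.sum_X_mul_pderiv
  simp only [map_sum, map_mul, eval_X, map_nsmul] at h
  rw [nsmul_eq_mul] at h
  rw [xi_apply]
  simp only [dpl_mul]
  rw [mul_right_comm, ← h, Finset.sum_mul]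
  exact Finset.sum_congr rfl fun S _ => by ring

lemma Ew_eq (w : Matrix (Fin k) (Fin m) F) (ab : Fin k × Fin k) :
    Ew w ab = Matrix.single ab.1 ab.2 (1 : F) * w := by
  ext i j
  by_cases h : i = ab.1
  · subst h; simp [Ew]
  · simp [Ew, h]

lemma xi_Ew (g : MvPolynomial (PluckIdx k m) F) {d : ℕ} (hg : g.IsHomogeneous d)
    (w : Matrix (Fin k) (Fin m) F) (h0 : eval (pl w) g = 0) (ab : Fin k × Fin k) :
    xi g w (Ew w ab) = 0 := by
  rw [Ew_eq, xi_mul g hg, h0, mul_zero]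

lemma xi_der [CharZero F] (g : MvPolynomial (PluckIdx k m) F)
    (w : Matrix (Fin k) (Fin m) F) (h0 : eval (pl w) g = 0) (D : Derivation ℚ F F)
    (T : Finset (PluckIdx k m →₀ ℕ)) (hT : g.support ⊆ T) :
    xi g w (w.map D) = - ∑ β ∈ T, D (coeff β g) * (∏ i, pl w i ^ β i) := by
  have := der_eval D (pl w) g T hT
  rw [h0, map_zero] at this
  rw [xi_apply]
  simp only [dpl_der]
  linear_combination -this

/-- the polynomial giving the derivative of `g` along `w ↦ w E_ij` -/
noncomputable def hp (g : MvPolynomial (PluckIdx k m) F) (ij : Fin m × Fin m) :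
    MvPolynomial (PluckIdx k m) F :=
  ∑ S, pderiv S g * ∑ b, if en S b = ij.2 then
    ∑ T, C (lam F (Function.update (en S) b ij.1) T : F) * X T else 0

lemma xi_single (g : MvPolynomial (PluckIdx k m) F) (w : Matrix (Fin k) (Fin m) F)
    (ij : Fin m × Fin m) :
    xi g w (w * Matrix.single ij.1 ij.2 (1 : F)) = eval (pl w) (hp g ij) := by
  rw [xi_apply, hp, map_sum]
  refine Finset.sum_congr rfl fun S _ => ?_
  rw [dpl_single, map_mul, map_sum]
  congr 1
  refine Finset.sum_congr rfl fun b _ => ?_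
  split_ifs
  · rw [plT_lam]; simp
  · simp

lemma hp_hom (g : MvPolynomial (PluckIdx k m) F) {d : ℕ} (hd : 1 ≤ d) (hg : g.IsHomogeneous d)
    (ij : Fin m × Fin m) : (hp g ij).IsHomogeneous d := by
  refine IsHomogeneous.sum _ _ _ fun S _ => ?_
  obtain ⟨e, rfl⟩ : ∃ e, d = e + 1 := ⟨d - 1, by omega⟩
  refine IsHomogeneous.mul (hg.pderiv) ?_
  refine IsHomogeneous.sum _ _ _ fun b _ => ?_
  split_ifs
  · refine IsHomogeneous.sum _ _ _ fun T _ => ?_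
    exact (isHomogeneous_C_mul_X _ _)
  · exact isHomogeneous_zero _ _ _

lemma hp_coeff (g : MvPolynomial (PluckIdx k m) F) (κ : Subfield F)
    (h : ∀ α, coeff α g ∈ κ) (ij : Fin m × Fin m) (α) : coeff α (hp g ij) ∈ κ := by
  have hr : ∀ p : MvPolynomial (PluckIdx k m) F, (∀ α, coeff α p ∈ κ) ↔
      p ∈ (MvPolynomial.map (σ := PluckIdx k m) κ.subtype).range := by
    intro p
    rw [← SetLike.mem_coe, RingHom.coe_range, mem_range_map_iff_coeffs_subset]
    simp only [Set.subset_def, Finset.mem_coe, mem_coeffs_iff]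
    constructor
    · rintro h x ⟨α, _, rfl⟩; exact ⟨⟨_, h α⟩, rfl⟩
    · intro h α
      by_cases h0 : α ∈ p.support
      · obtain ⟨y, hy⟩ := h _ ⟨α, h0, rfl⟩
        rw [← hy]; exact y.2
      · rw [notMem_support_iff.1 h0]; exact zero_mem _
  refine (hr _).2 ?_ α
  obtain ⟨g0, rfl⟩ := (hr g).1 h
  refine sum_mem fun S _ => mul_mem ⟨pderiv S g0, (pderiv_map).symm⟩ (sum_mem fun b _ => ?_)
  split_ifs
  · refine sum_mem fun T _ => mul_mem ⟨C (lam F (Function.update (en S) b ij.1) T : κ), ?_⟩ ⟨X T, ?_⟩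
    · simp
    · simp
  · exact zero_mem _
end
end Irr
end

section
open Matrix
namespace Irr

section
variable {F : Type*} [Field F] {k m : ℕ}

lemma det_affine (M R : Matrix (Fin k) (Fin k) F) (i0 : Fin k) (c : Fin k → F)
    (hR : ∀ i j, R i j = c i * R i0 j) : ∃ e : F, ∀ s : F, (M + s • R).det = M.det + s * e := by
  let N0 : Matrix (Fin k) (Fin k) F := of fun i j => M i j - c i * M i0 j
  have h1 : ∀ s : F, (M + s • R).det = (N0.updateRow i0 (M i0 + s • R i0)).det := by
    intro s
    refine det_eq_of_forall_row_eq_smul_add_const (fun i => if i = i0 then 0 else c i) i0 (by simp) ?_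
    intro i j
    by_cases hi : i = i0
    · subst hi; simp
    · simp only [hi, N0, updateRow_self, if_false, Matrix.add_apply, Matrix.smul_apply, Pi.add_apply,
        Pi.smul_apply, updateRow_ne hi, of_apply, hR i j, smul_eq_mul]
      ring
  refine ⟨(N0.updateRow i0 (R i0)).det, fun s => ?_⟩
  have h0 := h1 0
  rw [zero_smul, add_zero, zero_smul, add_zero] at h0
  rw [h1, det_updateRow_add, det_updateRow_smul, h0]

lemma pl_line (w R : Matrix (Fin k) (Fin m) F) (i0 : Fin k) (c : Fin k → F)
    (hR : ∀ i j, R i j = c i * R i0 j) :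
    ∃ v : PluckIdx k m → F, ∀ s : F, pl (w + s • R) = pl w + s • v := by
  have h : ∀ S : PluckIdx k m, ∃ e : F, ∀ s : F, (cs w S + s • cs R S).det = (cs w S).det + s * e :=
    fun S => det_affine _ _ i0 c (fun i j => hR i _)
  choose v hv using h
  refine ⟨v, fun s => ?_⟩
  ext S
  exact hv S s

/-- normalized matrices whose Plücker vectors are collinear differ by a rank one matrix -/
lemma collin (A : PluckIdx k m) (w1 w2 w3 : Matrix (Fin k) (Fin m) F) (h1 : cs w1 A = 1)
    (h2 : cs w2 A = 1) (h3 : cs w3 A = 1) (t : F) (ht0 : t ≠ 0) (ht1 : t ≠ 1)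
    (e : pl w3 = pl w1 + t • (pl w2 - pl w1)) :
    w3 = w1 + t • (w2 - w1) ∧ ∀ i i' j j', (w2 - w1) i j * (w2 - w1) i' j'
      = (w2 - w1) i j' * (w2 - w1) i' j := by
  have hl : ∀ f, plT w3 f = plT w1 f + t * (plT w2 f - plT w1 f) := by
    intro f
    rw [plT_lam, plT_lam, plT_lam, e, ← Finset.sum_sub_distrib, Finset.mul_sum,
      ← Finset.sum_add_distrib]
    refine Finset.sum_congr rfl fun S _ => ?_
    simp only [Pi.add_apply, Pi.smul_apply, Pi.sub_apply, smul_eq_mul]; ring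
  have hw : ∀ i j, w3 i j = w1 i j + t * (w2 i j - w1 i j) := by
    intro i j
    have := hl (Function.update (en A) i j)
    rwa [plT_update _ A h1, plT_update _ A h2, plT_update _ A h3] at this
  refine ⟨by ext i j; simp [hw], fun i i' j j' => ?_⟩
  by_cases hi : i = i'
  · subst hi; ring
  have := hl (Function.update (Function.update (en A) i j) i' j')
  rw [plT_update_two _ A h1 _ _ hi, plT_update_two _ A h2 _ _ hi, plT_update_two _ A h3 _ _ hi,
    hw, hw, hw, hw] at this
  have h5 : t * (t - 1) * ((w2 i j - w1 i j) * (w2 i' j' - w1 i' j')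
      - (w2 i j' - w1 i j') * (w2 i' j - w1 i' j)) = 0 := by linear_combination this
  rw [mul_eq_zero, mul_eq_zero, sub_eq_zero, sub_eq_zero] at h5
  simpa [ht0, ht1] using h5
end

section
variable {F : Type*} [Field F] [CharZero F]

lemma dpl_line {k m : ℕ} (w R : Matrix (Fin k) (Fin m) F) (v : PluckIdx k m → F)
    (h : ∀ s : F, pl (w + s • R) = pl w + s • v) (S : PluckIdx k m) : dpl w S R = v S := by
  let M : Matrix (Fin k) (Fin k) (Polynomial F) :=
    (cs w S).map Polynomial.C + (Polynomial.X : Polynomial F) • (cs R S).map Polynomial.C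
  have hev : ∀ s : F, M.map (Polynomial.evalRingHom s) = cs w S + s • cs R S := by
    intro s; ext i j; simp [M]; ring
  have h1 : M.det = Polynomial.C (pl w S) + Polynomial.X * Polynomial.C (v S) := by
    refine Polynomial.funext fun s => ?_
    have := RingHom.map_det (Polynomial.evalRingHom s) M
    rw [Polynomial.coe_evalRingHom] at this
    rw [this, RingHom.mapMatrix_apply, hev]
    have h2 := congrFun (h s) S
    simp only [Pi.add_apply, Pi.smul_apply, smul_eq_mul] at h2
    simp only [Polynomial.eval_add, Polynomial.eval_mul, Polynomial.eval_C, Polynomial.eval_X]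
    exact h2
  have h2 := der_det (Polynomial.derivative' (R := F)) M
  have h3 : M.map (Polynomial.derivative' (R := F)) = (cs R S).map Polynomial.C := by
    ext i j; simp [M]
  rw [h1, h3] at h2
  have h4 := congrArg (Polynomial.evalRingHom 0) h2
  rw [AddMonoidHom.map_trace, ] at h4
  have h5 : (M.adjugate * (cs R S).map Polynomial.C).map (Polynomial.evalRingHom (0 : F))
      = (cs w S).adjugate * cs R S := by
    rw [Matrix.map_mul, ← RingHom.mapMatrix_apply, RingHom.map_adjugate, RingHom.mapMatrix_apply, hev]
    simp
    congr 1
    ext i j; simp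
  rw [dpl_apply, ← h5, ]
  simpa using h4.symm

lemma isAlgClosed_Dconst [IsAlgClosed F] (D : Derivation ℚ F F) : IsAlgClosed (Dconst D) := by
  refine IsAlgClosed.of_exists_root _ fun p _ hp => ?_
  obtain ⟨x, hx⟩ := IsAlgClosed.exists_aeval_eq_zero F p (Polynomial.degree_pos_of_irreducible hp).ne'
  have hD : x ∈ Dconst D := der_alg_zero D (Dconst D) (fun x h => h) x ⟨p, hp.ne_zero, hx⟩
  refine ⟨⟨x, hD⟩, ?_⟩
  apply (algebraMap (Dconst D) F).injective
  rw [map_zero, ← Polynomial.eval₂_at_apply, ← hx]; rfl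
end
end Irr
end

section
open Matrix MvPolynomial
namespace Irr

section
variable {k m : ℕ}

/-- exponents of degree `d` -/
def Mon (k m d : ℕ) : Type := {α : PluckIdx k m →₀ ℕ // ∑ i, α i = d}

noncomputable instance (d : ℕ) : DecidableEq (Mon k m d) := Classical.decEq _

lemma mon_mem {d : ℕ} (α : PluckIdx k m →₀ ℕ) :
    α ∈ Finset.finsuppAntidiag (Finset.univ : Finset (PluckIdx k m)) d ↔ ∑ i, α i = d := by
  rw [Finset.mem_finsuppAntidiag]
  exact ⟨fun h => h.1, fun h => ⟨h, Finset.subset_univ _⟩⟩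

instance (d : ℕ) : Finite (Mon k m d) := by
  refine Finite.of_injective (β := Finset.finsuppAntidiag (Finset.univ : Finset (PluckIdx k m)) d)
    (fun α => ⟨α.1, (mon_mem _).2 α.2⟩) ?_
  intro a b h
  exact Subtype.ext (congrArg (fun x => x.1) h)

noncomputable instance (d : ℕ) : Fintype (Mon k m d) := Fintype.ofFinite _

/-- the pure power exponent -/
noncomputable def powMon (d : ℕ) (A : PluckIdx k m) : Mon k m d :=
  ⟨Finsupp.single A d, by simp [Finsupp.single_apply]⟩

lemma sum_mon {M : Type*} [AddCommMonoid M] {d : ℕ} (f : (PluckIdx k m →₀ ℕ) → M) :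
    ∑ β ∈ Finset.finsuppAntidiag (Finset.univ : Finset (PluckIdx k m)) d, f β
      = ∑ β : Mon k m d, f β.1 := by
  symm
  refine Finset.sum_bij' (fun β _ => β.1) (fun β h => ⟨β, (mon_mem _).1 h⟩) ?_ ?_ ?_ ?_ ?_
  · intro β _; exact (mon_mem _).2 β.2
  · intro β _; exact Finset.mem_univ _
  · intro β _; rfl
  · intro β _; rfl
  · intro β _; rfl

lemma hom_mem {F : Type*} [Field F] {d : ℕ} (p : MvPolynomial (PluckIdx k m) F) (hp : p.IsHomogeneous d) :
    p.support ⊆ Finset.finsuppAntidiag (Finset.univ : Finset (PluckIdx k m)) d := by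
  intro α hα
  rw [mon_mem]
  have := hp (mem_support_iff.1 hα)
  rw [Finsupp.weight_apply, Finsupp.sum_fintype _ _ (by simp)] at this
  simpa using this

/-- value of the monomial -/
def mv {F : Type*} [Field F] (x : PluckIdx k m → F) (α : PluckIdx k m →₀ ℕ) : F := ∏ i, x i ^ α i

lemma mv_single {F : Type*} [Field F] (x : PluckIdx k m → F) (A : PluckIdx k m) (d : ℕ) :
    mv x (Finsupp.single A d) = x A ^ d := by
  rw [mv, Finset.prod_eq_single A]
  · simp
  · intro b _ hb; simp [Finsupp.single_apply, hb.symm]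
  · simp

lemma mv_add {F : Type*} [Field F] (x : PluckIdx k m → F) (α β) :
    mv x (α + β) = mv x α * mv x β := by
  simp [mv, pow_add, Finset.prod_mul_distrib]

lemma eval_smul_hom {F ι : Type*} [Field F] (f : MvPolynomial ι F)
    {r : ℕ} (hf : f.IsHomogeneous r) (c : F) (x : ι → F) :
    eval (c • x) f = c ^ r * eval x f := aeval_smul_hom f hf c x

lemma twD_zero {F : Type*} [Field F] [CharZero F] {K : Type*} [Field K] [Algebra K F]
    (δ : Derivation ℚ F F) (w : Matrix (Fin k) (Fin m) F) :
    twD δ (0 : Matrix (Fin m) (Fin m) K) w = w.map δ := by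
  rw [twD, Matrix.map_zero _ (map_zero _), Matrix.mul_zero, add_zero]

/-- the generic situation -/
structure Su (F : Type*) [Field F] [CharZero F] (I : Type*) (k m d : ℕ) where
  Δ : DB F I
  g : MvPolynomial (PluckIdx k m) F
  hg : g.IsHomogeneous d
  t : Mon k m d → I
  t_inj : Function.Injective t
  ht : ∀ α, Δ.b (t α) = coeff α.1 g

namespace Su
variable {F : Type*} [Field F] [CharZero F] {I : Type*} {d : ℕ} (G : Su F I k m d)

lemma supp : G.g.support ⊆ Finset.finsuppAntidiag (Finset.univ : Finset (PluckIdx k m)) d := by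
  exact hom_mem _ G.hg

lemma eval_hom (p : MvPolynomial (PluckIdx k m) F) (hp : p.IsHomogeneous d) (x : PluckIdx k m → F) :
    eval x p = ∑ β : Mon k m d, coeff β.1 p * mv x β.1 := by
  rw [eval_eq', ← sum_mon (fun β => coeff β p * mv x β)]
  refine Finset.sum_subset (hom_mem p hp) fun β _ h => ?_
  rw [notMem_support_iff.1 h, zero_mul]

lemma d_coeff (α : PluckIdx k m →₀ ℕ) (i : I) (hi : i ∉ Set.range G.t) : G.Δ.d i (coeff α G.g) = 0 := by
  by_cases h : α ∈ G.g.support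
  · rw [← G.ht ⟨α, (mon_mem _).1 (G.supp h)⟩]
    exact G.Δ.d_ne _ _ fun h => hi ⟨_, h.symm⟩
  · rw [notMem_support_iff.1 h, map_zero]

lemma xi_d (w : Matrix (Fin k) (Fin m) F) (h0 : eval (pl w) G.g = 0) (i : I)
    (hi : i ∉ Set.range G.t) : xi G.g w (w.map (G.Δ.d i)) = 0 := by
  rw [xi_der G.g w h0 _ _ G.supp]
  simp [G.d_coeff _ i hi]

lemma xi_t (w : Matrix (Fin k) (Fin m) F) (h0 : eval (pl w) G.g = 0) (α : Mon k m d) :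
    xi G.g w (w.map (G.Δ.d (G.t α))) = - mv (pl w) α.1 := by
  rw [xi_der G.g w h0 _ _ G.supp, sum_mon (fun β => G.Δ.d (G.t α) (coeff β G.g) * ∏ i, pl w i ^ β i)]
  congr 1
  simp only [← G.ht]
  rw [Finset.sum_eq_single α]
  · rw [G.Δ.d_self, one_mul]; rfl
  · intro β _ hβ
    rw [G.Δ.d_ne _ _ fun h => hβ (G.t_inj h).symm, zero_mul]
  · simp

/-- the constants -/
abbrev K (s0 : I) : IntermediateField ℚ F := Dconst (G.Δ.d s0)

/-- the twisted derivation -/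
noncomputable def dU {s0 : I} (U : Matrix (Mon k m d) (Mon k m d) (G.K s0)) (β : Mon k m d) :
    Derivation ℚ F F := ∑ α, (U β α : F) • G.Δ.d (G.t α)

lemma dU_apply {s0 : I} (U : Matrix (Mon k m d) (Mon k m d) (G.K s0)) (β : Mon k m d) (x : F) :
    G.dU U β x = ∑ α, (U β α : F) * G.Δ.d (G.t α) x := by
  rw [dU, ← Derivation.coeFnAddMonoidHom_apply, map_sum, Finset.sum_apply]
  rfl

/-- the hypersurface cone -/
def P (w : Matrix (Fin k) (Fin m) F) : Prop := pl w ≠ 0 ∧ eval (pl w) G.g = 0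

lemma P_B (w : Matrix (Fin k) (Fin m) F) (B : Matrix (Fin k) (Fin k) F) (h : G.P w) (hB : B.det ≠ 0) :
    G.P (B * w) := by
  refine ⟨?_, ?_⟩
  · rw [pl_mul]; exact smul_ne_zero hB h.1
  · rw [pl_mul]
    rw [eval_smul_hom G.g G.hg, h.2, mul_zero]

variable {Y Z : Type*} [Fintype Y] [DecidableEq Y] [Fintype Z] [DecidableEq Z]

noncomputable def mkN (s0 : I) (hs : s0 ∉ Set.range G.t) (η : Y → I) (hη : ∀ y, η y ∉ Set.range G.t)
    (hηs : ∀ y, η y ≠ s0) (U : Matrix (Mon k m d) (Mon k m d) (G.K s0))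
    (v : Mon k m d → Matrix (Fin m) (Fin m) (G.K s0))
    (hUv : ∀ w, G.P w → ∀ β, xi G.g w (twD (G.dU U β) (v β) w) = - mv (pl w) β.1)
    (c : Z → Mon k m d → MvPolynomial (PluckIdx k m) (G.K s0))
    (hc : ∀ z β, (c z β).IsHomogeneous 1)
    (hc0 : ∀ z (x : PluckIdx k m → F), ∑ β, aeval x (c z β) * mv x β.1 = 0)
    (r : ℕ) (hr : r + m + Fintype.card Z = d)
    (e : Option (Option (Y ⊕ Z)) ⊕ (Fin k × Fin k) ≃ Fin k × Fin m)
    (alg : ∀ x : F, IsAlgebraic (IntermediateField.adjoin (G.K s0) {G.Δ.b s0}) x) :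
    NTD F (G.K s0) k m d (Y ⊕ Z) (Mon k m d ⊕ Y) where
  Ds := G.Δ.d s0
  s := G.Δ.b s0
  Ds_s := G.Δ.d_self s0
  Ds_K := fun c => c.2
  alg := alg
  δ := Sum.elim (G.dU U) (fun y => G.Δ.d (η y))
  δ_K := by
    rintro (β | y) c
    · refine ⟨⟨G.dU U β c, ?_⟩, rfl⟩
      rw [dU_apply]
      refine sum_mem fun α _ => mul_mem (U β α).2 (G.Δ.presconst _ _ _ c.2)
    · exact ⟨⟨G.Δ.d (η y) c, G.Δ.presconst _ _ _ c.2⟩, rfl⟩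
  δ_s := by
    rintro (β | y)
    · rw [Sum.elim_inl, dU_apply]
      refine Finset.sum_eq_zero fun α _ => ?_
      rw [G.Δ.d_ne _ _ fun h => hs ⟨α, h⟩, mul_zero]
    · exact G.Δ.d_ne _ _ (hηs y)
  v := Sum.elim v (fun _ => 0)
  qA := fun A => Sum.inl (powMon d A)
  ε := Sum.elim (fun _ => 0) (fun _ => 1)
  c := Sum.elim (fun y q => if q = Sum.inr y then 1 else 0) (fun z => Sum.elim (c z) (fun _ => 0))
  c_hom := by
    rintro (y | z) q
    · simp only [Sum.elim_inl]
      split_ifs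
      · exact isHomogeneous_one _ _
      · exact isHomogeneous_zero _ _ _
    · rcases q with β | y
      · exact hc z β
      · exact isHomogeneous_zero _ _ _
  r := r
  deg := by simpa using hr
  e := e
  P := G.P
  P_pl := fun w h => h.1
  P_B := G.P_B
  ξ := xi G.g
  ξ_E := fun w hw ab => xi_Ew G.g G.hg w hw.2 ab
  ξ_s := fun w hw => G.xi_d w hw.2 s0 hs
  ξ_j := by
    rintro w hw (y | z)
    · rw [Finset.sum_eq_single (Sum.inr y)]
      · simp [twD_zero, G.xi_d w hw.2 (η y) (hη y)]
      · intro q _ hq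
        simp [hq]
      · simp
    · rw [map_sum, Fintype.sum_sum_type]
      simp only [Sum.elim_inr, Sum.elim_inl, map_smul, hUv w hw, map_zero, zero_smul,
        Finset.sum_const_zero, add_zero, smul_eq_mul, mul_neg, Finset.sum_neg_distrib, hc0, neg_zero]
  ξ_A := by
    intro w hw A
    rw [Sum.elim_inl, Sum.elim_inl, hUv w hw, powMon, mv_single]

section rows
variable (s0 : I) (hs : s0 ∉ Set.range G.t) (η : Y → I) (hη : ∀ y, η y ∉ Set.range G.t)
    (hηs : ∀ y, η y ≠ s0) (U : Matrix (Mon k m d) (Mon k m d) (G.K s0))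
    (v : Mon k m d → Matrix (Fin m) (Fin m) (G.K s0))
    (hUv : ∀ w, G.P w → ∀ β, xi G.g w (twD (G.dU U β) (v β) w) = - mv (pl w) β.1)
    (c : Z → Mon k m d → MvPolynomial (PluckIdx k m) (G.K s0))
    (hc : ∀ z β, (c z β).IsHomogeneous 1)
    (hc0 : ∀ z (x : PluckIdx k m → F), ∑ β, aeval x (c z β) * mv x β.1 = 0)
    (r : ℕ) (hr : r + m + Fintype.card Z = d)
    (e : Option (Option (Y ⊕ Z)) ⊕ (Fin k × Fin k) ≃ Fin k × Fin m)
    (alg : ∀ x : F, IsAlgebraic (IntermediateField.adjoin (G.K s0) {G.Δ.b s0}) x)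

lemma row_Y (A w y) : (G.mkN s0 hs η hη hηs U v hUv c hc hc0 r hr e alg).row A w
    (some (some (Sum.inl y))) = w.map (G.Δ.d (η y)) := by
  change ∑ q, aeval (pl w) (if q = Sum.inr y then (1 : MvPolynomial _ (G.K s0)) else 0) • _ = _
  rw [Finset.sum_eq_single (Sum.inr y)]
  · rw [if_pos rfl, map_one, one_smul]
    exact twD_zero _ _
  · intro q _ hq
    rw [if_neg hq, map_zero, zero_smul]
  · simp

lemma row_Z (A w z) : (G.mkN s0 hs η hη hηs U v hUv c hc hc0 r hr e alg).row A w
    (some (some (Sum.inr z))) = ∑ β, aeval (pl w) (c z β) • twD (G.dU U β) (v β) w := by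
  change ∑ q, aeval (pl w) (Sum.elim (c z) (fun _ => 0) q) • _ = _
  rw [Fintype.sum_sum_type]
  simp only [Sum.elim_inr, map_zero, zero_smul, Finset.sum_const_zero, add_zero]
  rfl
end rows
end Su

lemma Om_ne_zero {F : Type*} [Field F] {P : Type*} [Fintype P] [DecidableEq P]
    (e : P ⊕ (Fin k × Fin k) ≃ Fin k × Fin m) (w : Matrix (Fin k) (Fin m) F)
    (u : P → Matrix (Fin k) (Fin m) F)
    (h : ∀ (c : P → F) (B : Matrix (Fin k) (Fin k) F), ∑ o, c o • u o + B * w = 0 →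
      c = 0 ∧ B = 0) : Om e w u ≠ 0 := by
  intro h0
  rw [Om] at h0
  obtain ⟨x, hx, hx0⟩ := exists_vecMul_eq_zero_iff.2 h0
  obtain ⟨h1, h2⟩ := h (fun o => x (Sum.inl o)) (of fun a b => x (Sum.inr (a, b))) (by
    rw [mul_eq_sum_Ew]
    ext i j
    have := congrFun hx0 (e.symm (i, j))
    simp only [vecMul, dotProduct, Fintype.sum_sum_type, rowsM, submatrix_apply, of_apply, id,
      Sum.elim_inl, Sum.elim_inr, Equiv.apply_symm_apply, Pi.zero_apply] at this
    simpa [Matrix.add_apply, Matrix.sum_apply] using this)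
  apply hx
  ext (o | ab)
  · exact congrFun h1 o
  · exact congrFun (congrFun h2 ab.1) ab.2

/-- the Plücker coordinates determine full rank -/
lemma mul_eq_zero_of_pl {F : Type*} [Field F] (w : Matrix (Fin k) (Fin m) F) (hw : pl w ≠ 0)
    (B : Matrix (Fin k) (Fin k) F) (h : B * w = 0) : B = 0 := by
  obtain ⟨A, hA⟩ := Function.ne_iff.1 hw
  have h1 : B * cs w A = 0 := by rw [← cs_mul, h]; rfl
  have h2 : IsUnit (cs w A).det := by rw [det_cs]; exact IsUnit.mk0 _ hA
  have := congrArg (· * (cs w A)⁻¹) h1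
  simpa [Matrix.mul_assoc, mul_nonsing_inv _ h2] using this

/-- Galois permutation -/
lemma galois_perm {F : Type*} [Field F] (σ : F ≃+* F) {Θ : Type*} [Finite Θ]
    (w : Θ → Matrix (Fin k) (Fin m) F) (h0 : ∀ θ, pl (w θ) ≠ 0)
    (hinj : ∀ θ θ' (c : F), pl (w θ) = c • pl (w θ') → θ = θ')
    (hst : ∀ θ, ∃ θ', ∃ c : F, (fun S => σ (pl (w θ) S)) = c • pl (w θ')) :
    ∃ π : Equiv.Perm Θ, ∀ θ, ∃ B : Matrix (Fin k) (Fin k) F,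
      B.det ≠ 0 ∧ (w θ).map σ = B * w (π θ) := by
  choose p c hp using hst
  have hc : ∀ θ, c θ ≠ 0 := by
    intro θ h
    apply h0 θ
    ext S
    have := congrFun (hp θ) S
    rw [h] at this
    simpa using this
  have hpi : Function.Injective p := by
    intro a b hab
    refine hinj a b (σ.symm (c a * (c b)⁻¹)) ?_
    ext S
    apply σ.injective
    have h1 := congrFun (hp a) S
    have h2 := congrFun (hp b) S
    have := hc b
    simp only [Pi.smul_apply, smul_eq_mul, map_mul, RingEquiv.apply_symm_apply] at h1 h2 ⊢
    rw [h1, h2, hab]; field_simp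
  refine ⟨Equiv.ofBijective p (Finite.injective_iff_bijective.1 hpi), fun θ => ?_⟩
  have hm : pl ((w θ).map σ) = fun S => σ (pl (w θ) S) := by
    ext S
    rw [pl, pl, RingEquiv.map_det]; rfl
  refine exists_B_of_pl_smul _ _ (c θ) (hm.trans (hp θ)) ?_
  rw [hm, hp θ]
  exact smul_ne_zero (hc θ) (h0 _)
end
end Irr
end

section
open Matrix MvPolynomial
namespace Irr

section
variable {k m : ℕ}

lemma exists_poly_list {F ι : Type*} [Field F] [Fintype ι] [DecidableEq ι]
    (l : List (Module.Dual F (ι → F))) :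
    ∃ f : MvPolynomial ι F, f.IsHomogeneous l.length ∧
      ∀ x, eval x f = (l.map (fun a => a x)).prod := by
  induction l with
  | nil => exact ⟨1, isHomogeneous_one _ _, by simp⟩
  | cons a l ih =>
    obtain ⟨f, hf, hf'⟩ := ih
    refine ⟨(∑ i, C (a (Pi.single i 1)) * X i) * f, ?_, fun x => ?_⟩
    · rw [List.length_cons, add_comm]
      exact (IsHomogeneous.sum _ _ _ fun i _ => isHomogeneous_C_mul_X _ _).mul hf
    · rw [map_mul, hf', List.map_cons, List.prod_cons]
      congr 1
      conv_rhs => rw [← Finset.univ_sum_single x, map_sum]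
      rw [map_sum]
      refine Finset.sum_congr rfl fun i _ => ?_
      have : (Pi.single i (x i) : ι → F) = x i • Pi.single i 1 := by
        rw [← Pi.single_smul]; simp
      rw [this, map_smul]
      simp [mul_comm]

lemma exists_e (Y Z : Type*) [Fintype Y] [Fintype Z] (hkm : k ≤ m)
    (h : Fintype.card Y + Fintype.card Z + 2 = k * (m - k)) :
    Nonempty (Option (Option (Y ⊕ Z)) ⊕ (Fin k × Fin k) ≃ Fin k × Fin m) := by
  refine ⟨Fintype.equivOfCardEq ?_⟩
  obtain ⟨c, rfl⟩ := Nat.exists_eq_add_of_le hkm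
  simp only [Fintype.card_sum, Fintype.card_option, Fintype.card_prod, Fintype.card_fin]
  rw [Nat.add_sub_cancel_left] at h
  rw [mul_add]; omega

/-- data for the lower bound -/
structure Lo (F : Type*) [Field F] [CharZero F] (I : Type*) (k m d n : ℕ) extends Su F I k m d where
  hn : n + 1 = k * (m - k)
  φ : Fin (n + 1) → MvPolynomial (PluckIdx k m) F
  e : ℕ
  φ_hom : ∀ l, (φ l).IsHomogeneous e
  η : Fin (n + 1) → I
  η_inj : Function.Injective η
  η_t : ∀ l, η l ∉ Set.range t
  φ_d : ∀ l l' α, Δ.d (η l) (coeff α (φ l')) = 0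
  Θ : Type
  fin : Fintype Θ
  ne : Nonempty Θ
  card_lt : Fintype.card Θ < d
  w : Θ → Matrix (Fin k) (Fin m) F
  w_P : ∀ θ, toSu.P (w θ)
  lam : Θ → F
  lam_ne : ∀ θ, lam θ ≠ 0
  w_φ : ∀ θ l, eval (pl (w θ)) (φ l) = lam θ * Δ.b (η l)
  w_inj : ∀ θ θ' (c : F), pl (w θ) = c • pl (w θ') → θ = θ'
  w_all : ∀ w', toSu.P w' → ∀ l' ≠ (0 : F), (∀ l, eval (pl w') (φ l) = l' * Δ.b (η l)) →
    ∃ θ, ∃ c : F, pl w' = c • pl (w θ)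

namespace Lo
variable {F : Type*} [Field F] [CharZero F] {I : Type*} {d n : ℕ} (G : Lo F I k m d n)

instance : Fintype G.Θ := G.fin

/-- combination of the derivations -/
noncomputable def DS (c : Fin n → F) : Derivation ℚ F F := ∑ j, c j • G.Δ.d (G.η j.succ)

lemma DS_apply (c : Fin n → F) (x : F) : G.DS c x = ∑ j, c j * G.Δ.d (G.η j.succ) x := by
  rw [DS, ← Derivation.coeFnAddMonoidHom_apply, map_sum, Finset.sum_apply]
  rfl

lemma DS_y0 (c : Fin n → F) : G.DS c (G.Δ.b (G.η 0)) = 0 := by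
  rw [DS_apply]
  refine Finset.sum_eq_zero fun j _ => ?_
  rw [G.Δ.d_ne _ _ fun h => (Fin.succ_ne_zero j) (G.η_inj h), mul_zero]

lemma DS_y (c : Fin n → F) (j : Fin n) : G.DS c (G.Δ.b (G.η j.succ)) = c j := by
  rw [DS_apply, Finset.sum_eq_single j]
  · rw [G.Δ.d_self, mul_one]
  · intro i _ hi
    rw [G.Δ.d_ne _ _ fun h => hi (Fin.succ_injective _ (G.η_inj h)), mul_zero]
  · simp

lemma y0_ne : G.Δ.b (G.η 0) ≠ 0 := by
  intro h
  have := G.Δ.d_self (G.η 0)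
  rw [h, map_zero] at this
  exact zero_ne_one this

lemma DS_ker (w : Matrix (Fin k) (Fin m) F) (l' : F) (hl' : l' ≠ 0)
    (hφ : ∀ l, eval (pl w) (G.φ l) = l' * G.Δ.b (G.η l)) (c : Fin n → F)
    (B : Matrix (Fin k) (Fin k) F) (h : w.map (G.DS c) = B * w) : c = 0 := by
  have h1 : ∀ S, G.DS c (pl w S) = B.trace * pl w S := by
    intro S; rw [← dpl_der, h, dpl_mul]
  have h2 : ∀ l, G.DS c (eval (pl w) (G.φ l)) = B.trace * G.e * eval (pl w) (G.φ l) := by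
    intro l
    rw [der_eval _ _ _ _ (Finset.Subset.refl _)]
    have h3 := congrArg (eval (pl w)) (G.φ_hom l).sum_X_mul_pderiv
    simp only [map_sum, map_mul, eval_X, map_nsmul] at h3
    rw [nsmul_eq_mul] at h3
    rw [mul_assoc, ← h3, Finset.mul_sum, Finset.sum_eq_zero, zero_add]
    · refine Finset.sum_congr rfl fun i _ => ?_
      rw [h1]; ring
    · intro α _
      rw [DS_apply, Finset.sum_eq_zero, zero_mul]
      intro j _
      rw [G.φ_d, mul_zero]
  have h4 : G.DS c l' = B.trace * G.e * l' := by
    have := h2 0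
    rw [hφ, Derivation.leibniz, DS_y0, smul_zero, zero_add, smul_eq_mul] at this
    apply mul_left_cancel₀ G.y0_ne
    linear_combination this
  ext j
  have := h2 j.succ
  rw [hφ, Derivation.leibniz, DS_y, h4, smul_eq_mul, smul_eq_mul] at this
  have h5 : l' * c j = 0 := by linear_combination this
  simpa [hl'] using h5

lemma map_DS (w : Matrix (Fin k) (Fin m) F) (c : Fin n → F) :
    w.map (G.DS c) = ∑ j, c j • w.map (G.Δ.d (G.η j.succ)) := by
  ext a b
  simp [Matrix.sum_apply, DS_apply]

lemma xi_DS (w : Matrix (Fin k) (Fin m) F) (hw : G.P w) (c : Fin n → F) :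
    xi G.g w (w.map (G.DS c)) = 0 := by
  rw [map_DS, map_sum]
  refine Finset.sum_eq_zero fun j _ => ?_
  rw [map_smul, G.xi_d w hw.2 _ (G.η_t _), smul_zero]

lemma xi_Bw (w : Matrix (Fin k) (Fin m) F) (hw : G.P w) (B : Matrix (Fin k) (Fin k) F) :
    xi G.g w (B * w) = 0 := by
  rw [xi_mul G.g G.hg, hw.2, mul_zero]

lemma tangent_indep (w : Matrix (Fin k) (Fin m) F) (hw : G.P w) (l' : F) (hl' : l' ≠ 0)
    (hφ : ∀ l, eval (pl w) (G.φ l) = l' * G.Δ.b (G.η l)) (A : PluckIdx k m) (hA : pl w A ≠ 0)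
    (a : F) (c : Fin n → F) (B : Matrix (Fin k) (Fin k) F)
    (h : a • w.map (G.Δ.d (G.t (powMon d A))) + w.map (G.DS c) + B * w = 0) :
    a = 0 ∧ c = 0 ∧ B = 0 := by
  have ha : a = 0 := by
    have := congrArg (xi G.g w) h
    rw [map_add, map_add, map_smul, G.xi_t w hw.2, G.xi_DS w hw, G.xi_Bw w hw, powMon, mv_single]
      at this
    simpa [hA] using this
  subst ha
  rw [zero_smul, zero_add] at h
  have hc := G.DS_ker w l' hl' hφ c (-B) (by rw [Matrix.neg_mul]; exact eq_neg_of_add_eq_zero_left h)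
  subst hc
  refine ⟨rfl, rfl, mul_eq_zero_of_pl w hw.1 B ?_⟩
  rw [map_DS] at h
  simpa using h

/-- automorphisms fixing all the data -/
structure Fx (σ : F ≃+* F) : Prop where
  g : ∀ α, σ (coeff α G.g) = coeff α G.g
  φ : ∀ l α, σ (coeff α (G.φ l)) = coeff α (G.φ l)
  y : ∀ l, σ (G.Δ.b (G.η l)) = G.Δ.b (G.η l)

lemma eval_fix {ι : Type*} [Fintype ι] (σ : F ≃+* F) (p : MvPolynomial ι F)
    (h : ∀ α, σ (coeff α p) = coeff α p) (x : ι → F) :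
    eval (fun i => σ (x i)) p = σ (eval x p) := by
  rw [eval_eq', eval_eq', map_sum]
  refine Finset.sum_congr rfl fun α _ => ?_
  rw [map_mul, h, map_prod]
  simp

lemma pl_map' (σ : F ≃+* F) (w : Matrix (Fin k) (Fin m) F) :
    pl (w.map σ) = fun S => σ (pl w S) := by
  ext S
  rw [pl, pl, RingEquiv.map_det]; rfl

lemma P_map (σ : F ≃+* F) (hσ : G.Fx σ) (w : Matrix (Fin k) (Fin m) F) (hw : G.P w) :
    G.P (w.map σ) := by
  rw [Su.P, pl_map', eval_fix σ _ hσ.g, hw.2, map_zero]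
  refine ⟨fun h => hw.1 ?_, rfl⟩
  ext S
  simpa using congrFun h S

lemma stab (σ : F ≃+* F) (hσ : G.Fx σ) (θ : G.Θ) :
    ∃ θ', ∃ c : F, (fun S => σ (pl (G.w θ) S)) = c • pl (G.w θ') := by
  rw [← pl_map']
  refine G.w_all _ (G.P_map σ hσ _ (G.w_P θ)) (σ (G.lam θ)) (by simpa using G.lam_ne θ) fun l => ?_
  rw [pl_map', eval_fix σ _ (hσ.φ l), G.w_φ, map_mul, hσ.y]

lemma alg (s0 : I) (x : F) : IsAlgebraic (IntermediateField.adjoin (G.K s0) {G.Δ.b s0}) x :=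
  (G.Δ.alg_over s0).isAlgebraic x

lemma fx_of (j : Fin n)
    (σ : F ≃ₐ[IntermediateField.adjoin (G.K (G.η j.succ)) {G.Δ.b (G.η j.succ)}] F) :
    G.Fx σ.toRingEquiv := by
  have hc : ∀ c ∈ G.K (G.η j.succ), σ c = c := fun c h =>
    σ.commutes ⟨_, IntermediateField.algebraMap_mem _ (⟨c, h⟩ : G.K (G.η j.succ))⟩
  have hs : σ (G.Δ.b (G.η j.succ)) = G.Δ.b (G.η j.succ) :=
    σ.commutes ⟨_, IntermediateField.mem_adjoin_simple_self _ _⟩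
  refine ⟨fun α => hc _ (G.d_coeff α _ (G.η_t _)), fun l α => hc _ (G.φ_d _ _ _), fun l => ?_⟩
  by_cases h : G.η j.succ = G.η l
  · rw [← h]; exact hs
  · exact hc _ (G.Δ.d_ne _ _ h)

/-- Cayley-Bacharach for the fiber -/
lemma cb [IsAlgClosed F] (hkm : k ≤ m) (hdm : m ≤ d) (hn2 : 0 < n) (f : MvPolynomial (PluckIdx k m) F)
    (hf : f.IsHomogeneous (d - m)) (θ : G.Θ) (h : ∀ θ', θ' ≠ θ → eval (pl (G.w θ')) f = 0) :
    eval (pl (G.w θ)) f = 0 := by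
  classical
  let j0 : Fin n := ⟨0, hn2⟩
  let Y := {j : Fin n // j ≠ j0}
  obtain ⟨e⟩ := exists_e (k := k) (m := m) Y (Fin 0) hkm (by
    rw [← G.hn, Fintype.card_subtype_compl, Fintype.card_fin, Fintype.card_fin]
    simp; omega)
  have hdU : ∀ β, G.dU (s0 := G.η j0.succ) 1 β = G.Δ.d (G.t β) := by
    intro β
    ext x
    rw [Su.dU_apply, Finset.sum_eq_single β]
    · simp
    · intro α _ hα; rw [one_apply_ne hα.symm]; simp
    · simp
  let N := G.mkN (G.η j0.succ) (G.η_t _) (fun y : Y => G.η y.1.succ) (fun y => G.η_t _)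
    (fun y h => y.2 (Fin.succ_injective _ (G.η_inj h))) 1 (fun _ => 0)
    (fun w hw β => by rw [twD_zero, hdU, G.xi_t w hw.2]) (Fin.elim0 : Fin 0 → _) (fun z => z.elim0)
    (fun z => z.elim0) (d - m) (by simp; omega) e (G.alg _)
  choose A hA using fun θ => Function.ne_iff.1 (G.w_P θ).1
  haveI : IsAlgClosed (G.K (G.η j0.succ)) := isAlgClosed_Dconst _
  have h1 := N.null_trace' f hf G.w G.w_P A hA (fun σ => galois_perm σ.toRingEquiv G.w
    (fun θ => (G.w_P θ).1) G.w_inj (G.stab _ (G.fx_of j0 σ)))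
  rw [Finset.sum_eq_single θ (fun θ' _ h' => by rw [h θ' h', zero_mul]) (by simp)] at h1
  refine (mul_eq_zero.1 h1).resolve_right ?_
  rw [NTD.tau]
  refine div_ne_zero ?_ (pow_ne_zero _ (hA θ))
  refine Om_ne_zero _ _ _ fun c B hcB => ?_
  let c' : Fin n → F := fun j => if h : j = j0 then c (some none) else c (some (some (Sum.inl ⟨j, h⟩)))
  have key : c none • (G.w θ).map (G.Δ.d (G.t (powMon d (A θ)))) + (G.w θ).map (G.DS c') + B * G.w θ
      = 0 := by
    rw [← hcB]
    congr 1
    rw [Fintype.sum_option, Fintype.sum_option, Fintype.sum_sum_type]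
    congr 1
    · congr 1
      change _ = twD (G.dU (s0 := G.η j0.succ) 1 _) 0 (G.w θ)
      rw [twD_zero, hdU]
    · rw [map_DS, ← Finset.sum_erase_add _ _ (Finset.mem_univ j0), add_comm]
      refine congrArg₂ _ ?_ ?_
      · simp only [c', dif_pos]; rfl
      · simp only [Finset.univ_eq_empty, Finset.sum_empty, add_zero]
        symm
        refine Finset.sum_bij (fun y _ => y.1) ?_ ?_ ?_ ?_
        · intro y _; simp [y.2]
        · intro a _ b _ h; exact Subtype.ext h
        · intro b hb; exact ⟨⟨b, by simpa using hb⟩, Finset.mem_univ _, rfl⟩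
        · intro y _
          have := G.row_Y (Z := Fin 0) (G.η j0.succ) (G.η_t _) (fun y : Y => G.η y.1.succ) (fun y => G.η_t _)
            (fun y h => y.2 (Fin.succ_injective _ (G.η_inj h))) 1 (fun _ => 0)
            (fun w hw β => by rw [twD_zero, hdU, G.xi_t w hw.2]) (Fin.elim0 : Fin 0 → _) (fun z => z.elim0)
            (fun z => z.elim0) (d - m) (by simp; omega) e (G.alg _) (A θ) (G.w θ) y
          rw [this]
          simp only [c', dif_neg y.2]
          rfl
  obtain ⟨h1, h2, h3⟩ := G.tangent_indep (G.w θ) (G.w_P θ) _ (G.lam_ne θ) (G.w_φ θ) (A θ) (hA θ) _ _ _ key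
  refine ⟨?_, h3⟩
  ext o
  rcases o with _ | _ | y | z
  · exact h1
  · have := congrFun h2 j0
    simpa [c'] using this
  · have := congrFun h2 y.1
    simpa [c', y.2] using this
  · exact z.elim0

end Lo
end
end Irr
end

section
open Matrix MvPolynomial
namespace Irr

section
variable {k m : ℕ} {F : Type*} [Field F] [CharZero F] {I : Type*} {d n : ℕ}

/-- the line containing the fiber -/
structure Ln (G : Lo F I k m d n) where
  hk : 2 ≤ k
  hkm : k + 2 ≤ m
  hd : 3 * m ≤ d + 5
  W : Submodule F (PluckIdx k m → F)
  rank : Module.finrank F W ≤ 2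
  mem : ∀ θ, pl (G.w θ) ∈ W
  card_ge : d + 2 ≤ Fintype.card G.Θ + m

lemma Lo.not_span (G : Lo F I k m d n) {θ θ' : G.Θ} (h : θ ≠ θ') :
    pl (G.w θ) ∉ Submodule.span F {pl (G.w θ')} := by
  intro h'
  obtain ⟨c, hc⟩ := Submodule.mem_span_singleton.1 h'
  exact h (G.w_inj _ _ c hc.symm)

lemma Lo.n_pos (G : Lo F I k m d n) (hk : 2 ≤ k) (hkm : k + 2 ≤ m) : 0 < n := by
  have := G.hn
  have h2 : 2 * 2 ≤ k * (m - k) := Nat.mul_le_mul hk (by omega)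
  omega

lemma exists_Ln [IsAlgClosed F] (G : Lo F I k m d n) (hk : 2 ≤ k) (hkm : k + 2 ≤ m) (hd : 3 * m ≤ d + 5) :
    Nonempty (Ln G) := by
  classical
  let f : G.Θ → (PluckIdx k m → F) := fun θ => pl (G.w θ)
  have hf : Function.Injective f := fun a b h => G.w_inj a b 1 (by rw [one_smul]; exact h)
  let S := Finset.univ.image f
  have hc : S.card = Fintype.card G.Θ := by
    rw [Finset.card_image_of_injective _ hf]; rfl
  have hCB : CBl (F := F) (d - m) S := by
    intro l hl p hp hq
    obtain ⟨θ, -, rfl⟩ := Finset.mem_image.1 hp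
    obtain ⟨q, hq1, hq2⟩ := exists_poly_list l
    rw [hl] at hq1
    have := G.cb (by omega) (by omega) (G.n_pos hk hkm) q hq1 θ (fun θ' h => by
      rw [hq2]
      exact hq _ (Finset.mem_image_of_mem _ (Finset.mem_univ _)) (fun h' => h (hf h')))
    rwa [hq2] at this
  have h0 : ∀ p ∈ S, p ≠ 0 := by
    intro p hp
    obtain ⟨θ, -, rfl⟩ := Finset.mem_image.1 hp
    exact (G.w_P θ).1
  have h1 : ∀ p ∈ S, ∀ q ∈ S, p ≠ q → p ∉ Submodule.span F {q} := by
    intro p hp q hq hpq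
    obtain ⟨θ, -, rfl⟩ := Finset.mem_image.1 hp
    obtain ⟨θ', -, rfl⟩ := Finset.mem_image.1 hq
    exact G.not_span (fun h => hpq (by rw [h]))
  have hlt := G.card_lt
  obtain ⟨θ0⟩ := G.ne
  obtain ⟨W, -, hW, hW'⟩ := CBl.collinear hCB h0 h1 (by rw [hc]; change Fintype.card G.Θ < d at hlt; omega)
  have h2 := CBl.card_ge hCB h0 h1 ⟨f θ0, Finset.mem_image_of_mem _ (Finset.mem_univ _)⟩
  exact ⟨⟨hk, hkm, hd, W, hW, fun θ => hW' _ (Finset.mem_image_of_mem _ (Finset.mem_univ _)), by omega⟩⟩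

namespace Ln
variable {G : Lo F I k m d n} (E : Ln G)

lemma span_pair {θ θ' : G.Θ} (h : θ ≠ θ') (x : PluckIdx k m → F) (hx : x ∈ E.W) :
    ∃ a b : F, x = a • pl (G.w θ) + b • pl (G.w θ') := by
  have hi : LinearIndependent F ![pl (G.w θ), pl (G.w θ')] := by
    rw [LinearIndependent.pair_iff]
    intro s t hst
    have hs : s = 0 := by
      by_contra hs
      apply G.not_span h
      rw [Submodule.mem_span_singleton]
      refine ⟨-(s⁻¹ * t), ?_⟩
      have : pl (G.w θ) = s⁻¹ • (s • pl (G.w θ)) := by rw [smul_smul, inv_mul_cancel₀ hs, one_smul]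
      rw [this, eq_neg_of_add_eq_zero_left hst, smul_neg, smul_smul, neg_smul]
    subst hs
    refine ⟨rfl, ?_⟩
    rw [zero_smul, zero_add] at hst
    exact (smul_eq_zero.1 hst).resolve_right (G.w_P _).1
  have hle : Submodule.span F (Set.range ![pl (G.w θ), pl (G.w θ')]) ≤ E.W := by
    rw [Submodule.span_le]
    rintro _ ⟨i, rfl⟩
    fin_cases i
    · exact E.mem _
    · exact E.mem _
  have heq := Submodule.eq_of_le_of_finrank_le hle (by
    rw [finrank_span_eq_card hi]; simpa using E.rank)
  rw [← heq, Matrix.range_cons, Matrix.range_cons, Matrix.range_empty, Set.union_empty,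
    ← Set.insert_eq] at hx
  obtain ⟨a, b, h⟩ := Submodule.mem_span_pair.1 hx
  exact ⟨a, b, h.symm⟩

/-- affine chart of the line -/
structure Ch (A : PluckIdx k m) where
  w1 : Matrix (Fin k) (Fin m) F
  R : Matrix (Fin k) (Fin m) F
  v : PluckIdx k m → F
  i0 : Fin k
  j0 : Fin m
  hw1 : cs w1 A = 1
  hRA : cs R A = 0
  hR0 : R i0 j0 = 1
  hR : ∀ i j, R i j = R i j0 * R i0 j
  hpl : ∀ s : F, pl (w1 + s • R) = pl w1 + s • v
  hv : v ∈ E.W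
  hw1W : pl w1 ∈ E.W
  hv0 : v ≠ 0
  all : ∀ x ∈ E.W, x A = 1 → ∃ s : F, x = pl w1 + s • v

include E in
lemma card5 : 5 ≤ Fintype.card G.Θ := by
  have := E.card_ge; have := E.hd; have := E.hk; have := E.hkm
  omega

lemma pl_one {w : Matrix (Fin k) (Fin m) F} {A : PluckIdx k m} (h : cs w A = 1) : pl w A = 1 := by
  rw [← det_cs, h, det_one]

lemma exists_two (A : PluckIdx k m) (hA : ∃ x ∈ E.W, x A ≠ 0) :
    ∃ θ1 θ2 θ3 : G.Θ, pl (G.w θ1) A ≠ 0 ∧ pl (G.w θ2) A ≠ 0 ∧ pl (G.w θ3) A ≠ 0 ∧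
      θ1 ≠ θ2 ∧ θ1 ≠ θ3 ∧ θ2 ≠ θ3 := by
  classical
  obtain ⟨x, hx, hxA⟩ := hA
  have h1 : (Finset.univ.filter fun θ => pl (G.w θ) A = 0).card ≤ 1 := by
    rw [Finset.card_le_one]
    intro a ha b hb
    by_contra hab
    obtain ⟨s, t, e⟩ := E.span_pair hab x hx
    rw [Finset.mem_filter] at ha hb
    apply hxA
    rw [e]; simp [ha.2, hb.2]
  have h2 := Finset.card_filter_add_card_filter_not (s := (Finset.univ : Finset G.Θ)) (fun θ => pl (G.w θ) A = 0)
  have h3 := E.card5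
  rw [Finset.card_univ] at h2
  obtain ⟨a, b, c, ha, hb, hc, hab, hac, hbc⟩ := Finset.two_lt_card_iff.1
    (show 2 < (Finset.univ.filter fun θ => ¬ pl (G.w θ) A = 0).card by omega)
  exact ⟨a, b, c, (Finset.mem_filter.1 ha).2, (Finset.mem_filter.1 hb).2, (Finset.mem_filter.1 hc).2,
    hab, hac, hbc⟩

lemma exists_Ch (A : PluckIdx k m) (hA : ∃ x ∈ E.W, x A ≠ 0) : Nonempty (E.Ch A) := by
  obtain ⟨θ1, θ2, θ3, h1, h2, h3, h12, h13, h23⟩ := E.exists_two A hA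
  set w1 := nrm (G.w θ1) A with hw1
  set w2 := nrm (G.w θ2) A with hw2
  set w3 := nrm (G.w θ3) A with hw3
  have c1 : cs w1 A = 1 := cs_nrm _ _ h1
  have c2 : cs w2 A = 1 := cs_nrm _ _ h2
  have c3 : cs w3 A = 1 := cs_nrm _ _ h3
  have m1 : pl w1 ∈ E.W := by rw [hw1, pl_nrm]; exact E.W.smul_mem _ (E.mem _)
  have m2 : pl w2 ∈ E.W := by rw [hw2, pl_nrm]; exact E.W.smul_mem _ (E.mem _)
  have m3 : pl w3 ∈ E.W := by rw [hw3, pl_nrm]; exact E.W.smul_mem _ (E.mem _)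
  have dif : ∀ (θ θ' : G.Θ), θ ≠ θ' → pl (G.w θ) A ≠ 0 → pl (nrm (G.w θ) A) ≠ pl (nrm (G.w θ') A) := by
    intro θ θ' hne hθ e
    apply hne
    refine G.w_inj θ θ' (pl (G.w θ) A * (pl (G.w θ') A)⁻¹) ?_
    rw [pl_nrm, pl_nrm] at e
    rw [mul_smul, ← e, smul_smul, mul_inv_cancel₀ hθ, one_smul]
  have all : ∀ x ∈ E.W, x A = 1 → ∃ t : F, x = pl w1 + t • (pl w2 - pl w1) := by
    intro x hx hxA
    obtain ⟨a, b, e⟩ := E.span_pair h12 x hx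
    have e1 : pl (G.w θ1) = pl (G.w θ1) A • pl w1 := by
      rw [hw1, pl_nrm, smul_smul, mul_inv_cancel₀ h1, one_smul]
    have e2 : pl (G.w θ2) = pl (G.w θ2) A • pl w2 := by
      rw [hw2, pl_nrm, smul_smul, mul_inv_cancel₀ h2, one_smul]
    have hab : a * pl (G.w θ1) A + b * pl (G.w θ2) A = 1 := by rw [← hxA, e]; simp
    refine ⟨b * pl (G.w θ2) A, ?_⟩
    rw [e]
    nth_rewrite 1 [e1]
    nth_rewrite 1 [e2]
    have : a * pl (G.w θ1) A = 1 - b * pl (G.w θ2) A := by linear_combination hab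
    rw [smul_smul, smul_smul, this]
    module
  obtain ⟨t, ht⟩ := all _ m3 (pl_one c3)
  have ht0 : t ≠ 0 := by
    rintro rfl
    exact dif θ3 θ1 h13.symm h3 (by rw [← hw3, ← hw1, ht]; simp)
  have ht1 : t ≠ 1 := by
    rintro rfl
    exact dif θ3 θ2 h23.symm h3 (by rw [← hw3, ← hw2, ht]; simp)
  obtain ⟨-, hmin⟩ := collin A w1 w2 w3 c1 c2 c3 t ht0 ht1 ht
  have hR0 : w2 - w1 ≠ 0 := by
    intro h
    exact dif θ2 θ1 h12.symm h2 (by rw [← hw2, ← hw1, sub_eq_zero.1 h])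
  obtain ⟨i0, j0, hij⟩ : ∃ i0 j0, (w2 - w1) i0 j0 ≠ 0 := by
    by_contra! h
    exact hR0 (by ext i j; exact h i j)
  set ρ := (w2 - w1) i0 j0 with hρ
  have hR : ∀ i j, (ρ⁻¹ • (w2 - w1)) i j = (ρ⁻¹ • (w2 - w1)) i j0 * (ρ⁻¹ • (w2 - w1)) i0 j := by
    intro i j
    have := hmin i i0 j j0
    rw [← hρ] at this
    simp only [Matrix.smul_apply, smul_eq_mul]
    field_simp
    linear_combination this
  obtain ⟨v, hv⟩ := pl_line w1 (ρ⁻¹ • (w2 - w1)) i0 _ hR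
  have hv' : v = ρ⁻¹ • (pl w2 - pl w1) := by
    have := hv ρ
    rw [smul_smul, mul_inv_cancel₀ hij, one_smul, add_sub_cancel] at this
    rw [this, add_sub_cancel_left, smul_smul, inv_mul_cancel₀ hij, one_smul]
  refine ⟨⟨w1, ρ⁻¹ • (w2 - w1), v, i0, j0, c1, ?_, ?_, hR, hv, ?_, m1, ?_, ?_⟩⟩
  · ext i j
    have h1 := congrFun (congrFun c1 i) j
    have h2 := congrFun (congrFun c2 i) j
    simp only [cs, submatrix_apply, id] at h1 h2
    simp [cs, h1, h2]
  · rw [Matrix.smul_apply, ← hρ, smul_eq_mul, inv_mul_cancel₀ hij]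
  · rw [hv']; exact E.W.smul_mem _ (E.W.sub_mem m2 m1)
  · rw [hv']
    refine smul_ne_zero (inv_ne_zero hij) (sub_ne_zero.2 (dif θ2 θ1 h12.symm h2))
  · intro x hx hxA
    obtain ⟨s, hs⟩ := all x hx hxA
    exact ⟨s * ρ, by rw [hs, hv', smul_smul, mul_assoc, mul_inv_cancel₀ hij, mul_one]⟩

end Ln
end
end Irr
end

section
namespace Irr

section
open Polynomial
variable {F : Type*} [Field F] {ι : Type*} [Fintype ι]

/-- restriction to a line -/
noncomputable def lp (a v : ι → F) (g : MvPolynomial ι F) : F[X] :=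
  MvPolynomial.aeval (fun i => Polynomial.C (a i) + Polynomial.X * Polynomial.C (v i)) g

lemma lp_eval (a v : ι → F) (g : MvPolynomial ι F) (s : F) :
    (lp a v g).eval s = MvPolynomial.eval (a + s • v) g := by
  induction g using MvPolynomial.induction_on with
  | C c => simp [lp]
  | add p q hp hq => simp only [lp, map_add, Polynomial.eval_add] at hp hq ⊢; rw [hp, hq]
  | mul_X p i hp =>
    simp only [lp, map_mul, Polynomial.eval_mul, MvPolynomial.aeval_X, MvPolynomial.eval_X] at hp ⊢
    rw [hp]; simp; left; ring

lemma lp_deriv (a v : ι → F) (g : MvPolynomial ι F) :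
    derivative (lp a v g) = ∑ i, lp a v (MvPolynomial.pderiv i g) * Polynomial.C (v i) := by
  classical
  induction g using MvPolynomial.induction_on with
  | C c => simp [lp]
  | add p q hp hq =>
    simp only [lp, map_add] at hp hq ⊢
    simp only [hp, hq, add_mul, Finset.sum_add_distrib]
  | mul_X p i hp =>
    have h1 : ∀ p q : MvPolynomial ι F, lp a v (p * q) = lp a v p * lp a v q := fun p q => map_mul _ _ _
    have h2 : ∀ p q : MvPolynomial ι F, lp a v (p + q) = lp a v p + lp a v q := fun p q => map_add _ _ _
    have h3 : lp a v (MvPolynomial.X i) = Polynomial.C (a i) + Polynomial.X * Polynomial.C (v i) := MvPolynomial.aeval_X _ _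
    have h4 : ∀ j, lp a v (MvPolynomial.pderiv j (p * MvPolynomial.X i)) * Polynomial.C (v j)
      = (lp a v (MvPolynomial.pderiv j p) * Polynomial.C (v j)) * lp a v (MvPolynomial.X i)
        + if j = i then lp a v p * Polynomial.C (v i) else 0 := by
      intro j
      rw [MvPolynomial.pderiv_mul, h2, h1, h1]
      by_cases h : j = i
      · subst h
        rw [MvPolynomial.pderiv_X_self, if_pos rfl, show lp a v 1 = 1 from map_one _]; ring
      · rw [MvPolynomial.pderiv_X_of_ne (Ne.symm h), if_neg h, show lp a v 0 = 0 from map_zero _]; ring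
    simp only [h4, Finset.sum_add_distrib]
    rw [← Finset.sum_mul, ← hp, h1, derivative_mul, h3]
    simp

lemma lp_deriv_eval (a v : ι → F) (g : MvPolynomial ι F) (s : F) :
    (derivative (lp a v g)).eval s = ∑ i, MvPolynomial.eval (a + s • v) (MvPolynomial.pderiv i g) * v i := by
  rw [lp_deriv, eval_finset_sum]
  simp [lp_eval]

lemma lp_prod (a v : ι → F) (α : ι → ℕ) (s : Finset ι) :
    (∏ i ∈ s, (Polynomial.C (a i) + Polynomial.X * Polynomial.C (v i)) ^ α i).natDegree ≤ ∑ i ∈ s, α i ∧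
    (∏ i ∈ s, (Polynomial.C (a i) + Polynomial.X * Polynomial.C (v i)) ^ α i).coeff (∑ i ∈ s, α i) = ∏ i ∈ s, v i ^ α i := by
  classical
  have h1 : ∀ i, (Polynomial.C (a i) + Polynomial.X * Polynomial.C (v i)).natDegree ≤ 1 := by
    intro i
    rw [add_comm, X_mul_C]
    exact natDegree_linear_le
  have h2 : ∀ i, ((Polynomial.C (a i) + Polynomial.X * Polynomial.C (v i)) ^ α i).natDegree ≤ α i := fun i =>
    (natDegree_pow_le_of_le _ (h1 i)).trans (by simp)
  have h3 : ∀ i, ((Polynomial.C (a i) + Polynomial.X * Polynomial.C (v i)) ^ α i).coeff (α i) = v i ^ α i := by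
    intro i
    have := coeff_pow_of_natDegree_le (m := α i) (h1 i)
    rw [mul_one] at this
    rw [this]; simp [Polynomial.coeff_X, Polynomial.coeff_C]
  induction s using Finset.induction_on with
  | empty => simp
  | insert i s hi ih =>
    rw [Finset.prod_insert hi, Finset.sum_insert hi, Finset.prod_insert hi]
    refine ⟨natDegree_mul_le_of_le (h2 i) ih.1, ?_⟩
    rw [coeff_mul_add_eq_of_natDegree_le (h2 i) ih.1, h3, ih.2]

lemma lp_deg (a v : ι → F) (g : MvPolynomial ι F) {d : ℕ} (hg : g.IsHomogeneous d) :
    (lp a v g).natDegree ≤ d ∧ (lp a v g).coeff d = MvPolynomial.eval v g := by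
  have hs : ∀ α ∈ g.support, ∑ i, α i = d := by
    intro α hα
    have := hg (MvPolynomial.mem_support_iff.1 hα)
    rw [Finsupp.weight_apply, Finsupp.sum_fintype _ _ (by simp)] at this
    simpa using this
  have e : lp a v g = ∑ α ∈ g.support, Polynomial.C (g.coeff α) * ∏ i, (Polynomial.C (a i) + Polynomial.X * Polynomial.C (v i)) ^ α i := by
    rw [lp, MvPolynomial.aeval_eq_eval₂Hom, MvPolynomial.coe_eval₂Hom, MvPolynomial.eval₂_eq']
    rfl
  constructor
  · rw [e]
    refine natDegree_sum_le_of_forall_le _ _ fun α hα => ?_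
    refine (natDegree_C_mul_le _ _).trans ?_
    rw [← hs α hα]
    exact (lp_prod a v α _).1
  · rw [e, finset_sum_coeff, MvPolynomial.eval_eq']
    refine Finset.sum_congr rfl fun α hα => ?_
    rw [Polynomial.coeff_C_mul, ← hs α hα, (lp_prod a v α _).2]
end
end Irr
end

section
open Matrix MvPolynomial
namespace Irr

section
variable {k m : ℕ} {F : Type*} [Field F] [CharZero F] {I : Type*} {d n : ℕ}

lemma Lo.sum_Y (G : Lo F I k m d n) (j1 : Fin n) (c : {j : Fin n // j ≠ j1} → F)
    (w : Matrix (Fin k) (Fin m) F) :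
    ∑ y, c y • w.map (G.Δ.d (G.η y.1.succ))
      = w.map (G.DS (fun j => if h : j = j1 then 0 else c ⟨j, h⟩)) := by
  classical
  rw [G.map_DS, ← Finset.sum_erase_add _ _ (Finset.mem_univ j1)]
  simp only [dif_pos, zero_smul, add_zero]
  refine Finset.sum_bij (fun y _ => y.1) ?_ ?_ ?_ ?_
  · intro y _; simp [y.2]
  · intro a _ b _ h; exact Subtype.ext h
  · intro b hb; exact ⟨⟨b, by simpa using hb⟩, Finset.mem_univ _, rfl⟩
  · intro y _
    rw [dif_neg y.2]

lemma Su.dU_one (G : Su F I k m d) (s0 : I) (β : Mon k m d) :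
    G.dU (s0 := s0) 1 β = G.Δ.d (G.t β) := by
  ext x
  rw [Su.dU_apply, Finset.sum_eq_single β]
  · simp
  · intro α _ hα; rw [one_apply_ne hα.symm]; simp
  · simp

lemma det_generic {P : Type*} [Fintype P] [DecidableEq P] (K : IntermediateField ℚ F) (s : F)
    (hs : Transcendental K s) (M0 M1 : Matrix P P F) (h0 : ∀ i j, M0 i j ∈ K)
    (h1 : ∀ i j, M1 i j ∈ K) (h : M0.det ≠ 0) : (M0 + s • M1).det ≠ 0 := by
  let N0 : Matrix P P K := of fun i j => ⟨M0 i j, h0 i j⟩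
  let N1 : Matrix P P K := of fun i j => ⟨M1 i j, h1 i j⟩
  let Q : Matrix P P (Polynomial K) :=
    N0.map Polynomial.C + (Polynomial.X : Polynomial K) • N1.map Polynomial.C
  have e1 : Q.map (Polynomial.evalRingHom 0) = N0 := by
    ext i j; simp [Q]
  have e2 : Q.map (Polynomial.aeval (R := K) s) = M0 + s • M1 := by
    ext i j; simp [Q, N0, N1, IntermediateField.algebraMap_apply]
    exact mul_comm _ _
  have e3 : M0 = N0.map (algebraMap K F) := by
    ext i j; rfl
  rw [← e2]
  have h2 := (AlgHom.map_det (Polynomial.aeval (R := K) s) Q)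
  rw [AlgHom.mapMatrix_apply] at h2
  rw [← h2]
  intro h3
  have hQ : Q.det = 0 := (transcendental_iff.1 hs) _ h3
  have h4 := RingHom.map_det (Polynomial.evalRingHom (0 : K)) Q
  rw [hQ, map_zero, RingHom.mapMatrix_apply, e1] at h4
  apply h
  rw [e3, ← RingHom.mapMatrix_apply, ← RingHom.map_det, ← h4, map_zero]

lemma DB.transc (Δ : DB F I) (s : I) : Transcendental (Dconst (Δ.d s)) (Δ.b s) := by
  intro h
  have := der_alg_zero (Δ.d s) (Dconst (Δ.d s)) (fun x hx => hx) _ h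
  rw [Δ.d_self] at this
  exact one_ne_zero this

namespace Ln
variable {G : Lo F I k m d n} (E : Ln G)

lemma nrm_φ (A : PluckIdx k m) (θ : G.Θ) (h : pl (G.w θ) A ≠ 0) :
    ∃ l' : F, l' ≠ 0 ∧ ∀ l, eval (pl (nrm (G.w θ) A)) (G.φ l) = l' * G.Δ.b (G.η l) := by
  refine ⟨(pl (G.w θ) A)⁻¹ ^ G.e * G.lam θ, mul_ne_zero (pow_ne_zero _ (inv_ne_zero h)) (G.lam_ne θ),
    fun l => ?_⟩
  rw [pl_nrm, eval_smul_hom _ (G.φ_hom l), G.w_φ, mul_assoc]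

lemma g_ne [IsAlgClosed F] [Infinite I] : ∃ x ∈ E.W, eval x G.g ≠ 0 := by
  classical
  by_contra! hg
  have h5 := E.card5
  obtain ⟨θ⟩ := G.ne
  obtain ⟨A, hA⟩ := Function.ne_iff.1 (G.w_P θ).1
  have hA : pl (G.w θ) A ≠ 0 := hA
  obtain ⟨C⟩ := E.exists_Ch A ⟨_, E.mem θ, hA⟩
  set w1 := nrm (G.w θ) A with hw1
  have c1 : cs w1 A = 1 := cs_nrm _ _ hA
  have m1 : pl w1 ∈ E.W := by rw [hw1, pl_nrm]; exact E.W.smul_mem _ (E.mem _)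
  have hline : ∀ s : F, pl (w1 + s • C.R) = pl w1 + s • C.v := by
    obtain ⟨s1, hs1⟩ := C.all _ m1 (pl_one c1)
    have e1 : w1 = C.w1 + s1 • C.R := by
      refine eq_of_pl_eq _ _ A c1 ?_ (by rw [C.hpl, hs1])
      have := C.hw1; have h2 := C.hRA
      ext i j
      have := congrFun (congrFun this i) j
      have h2 := congrFun (congrFun h2 i) j
      simp only [cs, submatrix_apply, id, Matrix.zero_apply] at this h2
      simp [cs, this, h2]
    intro s
    rw [e1, add_assoc, ← add_smul, C.hpl, C.hpl, add_smul, add_assoc]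
  have hWs : ∀ s : F, pl (w1 + s • C.R) ∈ E.W := by
    intro s; rw [hline]; exact E.W.add_mem m1 (E.W.smul_mem _ C.hv)
  have hcs : ∀ s : F, cs (w1 + s • C.R) A = 1 := by
    intro s
    ext i j
    have h1 := congrFun (congrFun c1 i) j
    have h2 := congrFun (congrFun C.hRA i) j
    simp only [cs, submatrix_apply, id, Matrix.zero_apply] at h1 h2
    simp [cs, h1, h2]
  have hPs : ∀ s : F, G.P (w1 + s • C.R) := by
    intro s
    refine ⟨fun h => ?_, hg _ (hWs s)⟩
    have := pl_one (hcs s)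
    rw [h] at this
    exact zero_ne_one this
  have hP1 : G.P w1 := by simpa using hPs 0
  -- the tangent direction
  have hxi : xi G.g w1 C.R = 0 := by
    have hp : lp (pl w1) C.v G.g = 0 := by
      refine Polynomial.funext fun s => ?_
      rw [lp_eval, ← hline, (hPs s).2, Polynomial.eval_zero]
    have := lp_deriv_eval (pl w1) C.v G.g 0
    rw [hp, Polynomial.derivative_zero, Polynomial.eval_zero, zero_smul, add_zero] at this
    rw [xi_apply, this]
    exact Finset.sum_congr rfl fun S _ => by rw [dpl_line _ _ _ hline]
  obtain ⟨l', hl', hφ⟩ := Ln.nrm_φ A θ hA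
  have hRB : ∀ B : Matrix (Fin k) (Fin k) F, C.R ≠ B * w1 := by
    intro B h
    have h1 := C.hRA
    rw [h, cs_mul, c1, Matrix.mul_one] at h1
    have h2 := C.hR0
    rw [h, h1, Matrix.zero_mul] at h2
    exact zero_ne_one h2
  have hker0 : ∀ (c : Fin n → F) (B : Matrix (Fin k) (Fin k) F), w1.map (G.DS c) + B * w1 = 0 →
      c = 0 ∧ B = 0 := by
    intro c B h
    have := G.tangent_indep w1 hP1 l' hl' hφ A (by rw [pl_one c1]; exact one_ne_zero) 0 c B
      (by rw [zero_smul, zero_add, h])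
    exact ⟨this.2.1, this.2.2⟩
  have hDSadd : ∀ (a : F) (c c' : Fin n → F), a • w1.map (G.DS c) + w1.map (G.DS c')
      = w1.map (G.DS (a • c + c')) := by
    intro a c c'
    simp only [G.map_DS, Finset.smul_sum, ← Finset.sum_add_distrib, smul_smul, ← add_smul]
    rfl
  obtain ⟨j1, hj1⟩ : ∃ j1 : Fin n, ∀ (b : F) (c : Fin n → F) (B : Matrix (Fin k) (Fin k) F),
      c j1 = 0 → b • C.R + w1.map (G.DS c) + B * w1 = 0 → b = 0 ∧ c = 0 ∧ B = 0 := by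
    by_cases hc : ∃ (c : Fin n → F) (B : Matrix (Fin k) (Fin k) F), C.R = w1.map (G.DS c) + B * w1
    · obtain ⟨c0, B0, h0⟩ := hc
      have hc0 : c0 ≠ 0 := by
        rintro rfl
        apply hRB B0
        rw [h0, G.map_DS]; simp
      obtain ⟨j1, hj1⟩ := Function.ne_iff.1 hc0
      refine ⟨j1, fun b c B hc h => ?_⟩
      have h2 := hker0 (b • c0 + c) (b • B0 + B) (by
        rw [← hDSadd, ← h, h0, Matrix.add_mul, Matrix.smul_mul, smul_add]; abel)
      have hb : b = 0 := by
        have := congrFun h2.1 j1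
        simpa [hc, show c0 j1 ≠ 0 from hj1] using this
      subst hb
      simpa using h2
    · refine ⟨⟨0, G.n_pos E.hk E.hkm⟩, fun b c B _ h => ?_⟩
      have hb : b = 0 := by
        by_contra hb
        refine hc ⟨-b⁻¹ • c + 0, -b⁻¹ • B, ?_⟩
        rw [← hDSadd]
        have h3 : C.R = b⁻¹ • (b • C.R) := by rw [smul_smul, inv_mul_cancel₀ hb, one_smul]
        have h4 : b • C.R = - (w1.map (G.DS c) + B * w1) := by
          rw [add_assoc] at h; exact eq_neg_of_add_eq_zero_left h
        have h6 : w1.map (G.DS 0) = 0 := by rw [G.map_DS]; simp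
        rw [h3, h4, h6, Matrix.smul_mul]
        module
      subst hb
      rw [zero_smul, zero_add] at h
      exact ⟨rfl, hker0 c B h⟩
  -- new transcendental
  obtain ⟨ς, hς⟩ : ∃ ς : I, ς ∉ (Set.range G.t ∪ Set.range G.η) ∪
      ⋃ p : Fin k × Fin m, ({i | G.Δ.d i (w1 p.1 p.2) ≠ 0} ∪ {i | G.Δ.d i (C.R p.1 p.2) ≠ 0}) :=
    Set.Infinite.exists_notMem_finite Set.infinite_univ
      (((Set.finite_range _).union (Set.finite_range _)).union (Set.finite_iUnion fun p =>
        (G.Δ.finite_supp _).union (G.Δ.finite_supp _))) |>.imp fun _ h => h.2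
  simp only [Set.mem_union, Set.mem_iUnion, Set.mem_ofPred_eq, not_or, not_exists, not_not] at hς
  obtain ⟨⟨hςt, hςη⟩, hςw⟩ := hς
  have hςt : ς ∉ Set.range G.t := by simpa using hςt
  have hw1c : ∀ i j, G.Δ.d ς (w1 i j) = 0 := fun i j => (hςw (i, j)).1
  have hRc : ∀ i j, G.Δ.d ς (C.R i j) = 0 := fun i j => (hςw (i, j)).2
  set s := G.Δ.b ς with hs
  set w := w1 + s • C.R with hw
  let Y := {j : Fin n // j ≠ j1}
  obtain ⟨e⟩ := exists_e (k := k) (m := m) Y (Fin 0) (by have := E.hkm; omega) (by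
    have := G.n_pos E.hk E.hkm
    rw [← G.hn, Fintype.card_subtype_compl, Fintype.card_fin, Fintype.card_fin]
    simp; omega)
  have hη : ∀ y : Y, G.η y.1.succ ≠ ς := fun y h => hςη ⟨_, h⟩
  have hUv : ∀ w, G.P w → ∀ β, xi G.g w (twD (G.dU (s0 := ς) 1 β) (0 : Matrix (Fin m) (Fin m) (G.K ς)) w)
      = - mv (pl w) β.1 := fun w hw β => by rw [twD_zero, Su.dU_one, G.xi_t w hw.2]
  have hmd : d - m + m + Fintype.card (Fin 0) = d := by
    have := E.hd; have := E.hk; have := E.hkm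
    simp; omega
  let N := G.mkN ς hςt (fun y : Y => G.η y.1.succ) (fun y => G.η_t _) hη 1 (fun _ => 0)
    hUv (Fin.elim0 : Fin 0 → _) (fun z => z.elim0) (fun z => z.elim0) (d - m) hmd e (G.alg _)
  haveI : IsAlgClosed (G.K ς) := isAlgClosed_Dconst _
  have hA1 : pl w A = 1 := pl_one (hcs s)
  have h1 := N.null_trace' (X A ^ (d - m)) (show (X A ^ (d - m) : MvPolynomial (PluckIdx k m) F).IsHomogeneous (d - m) from by
      simpa using (isHomogeneous_X F A).pow (d - m))
    (fun _ : Unit => w) (fun _ => hPs s) (fun _ => A) (fun _ => by rw [hA1]; exact one_ne_zero)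
    (fun σ => ⟨1, fun _ => ⟨1, by simp, by
      have hc : ∀ c, G.Δ.d ς c = 0 → σ c = c := fun c h =>
        σ.commutes ⟨_, IntermediateField.algebraMap_mem _ (⟨c, h⟩ : G.K ς)⟩
      have hs' : σ s = s := σ.commutes ⟨_, IntermediateField.mem_adjoin_simple_self _ _⟩
      rw [Matrix.one_mul]
      ext i j
      simp [hw, hs', hc _ (hw1c i j), hc _ (hRc i j)]⟩⟩)
  simp only [Finset.univ_unique, Finset.sum_singleton, map_pow, eval_X, hA1, one_pow, one_mul,
    NTD.tau, div_one] at h1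
  -- the rows
  let Dr : Option (Option (Y ⊕ Fin 0)) → Derivation ℚ F F := fun o => match o with
    | none => G.Δ.d (G.t (powMon d A))
    | some none => 0
    | some (some (Sum.inl y)) => G.Δ.d (G.η y.1.succ)
    | some (some (Sum.inr z)) => z.elim0
  let u0 : Option (Option (Y ⊕ Fin 0)) → Matrix (Fin k) (Fin m) F := fun o => match o with
    | none => w1.map (Dr none)
    | some none => C.R
    | some (some o) => w1.map (Dr (some (some o)))
  let u1 : Option (Option (Y ⊕ Fin 0)) → Matrix (Fin k) (Fin m) F := fun o => C.R.map (Dr o)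
  have hDrs : ∀ o, Dr o s = 0 := by
    rintro (_ | _ | y | z)
    · exact G.Δ.d_ne _ _ fun h => hςt ⟨_, h⟩
    · rfl
    · exact G.Δ.d_ne _ _ (hη y)
    · exact z.elim0
  have hmapw : ∀ o, w.map (Dr o) = w1.map (Dr o) + s • C.R.map (Dr o) := by
    intro o; ext i j
    simp [hw, Derivation.leibniz, hDrs]
  have hrow : ∀ o, N.row A w o = u0 o + s • u1 o := by
    rintro (_ | _ | y | z)
    · refine Eq.trans ?_ (hmapw none)
      change twD (G.dU (s0 := ς) 1 _) (0 : Matrix (Fin m) (Fin m) (G.K ς)) w = _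
      rw [twD_zero, Su.dU_one]
    · change w.map (G.Δ.d ς) = C.R + s • C.R.map (0 : Derivation ℚ F F)
      ext i j
      simp [hw, Derivation.leibniz, hw1c, hRc, hs, G.Δ.d_self]
    · have := G.row_Y ς hςt (fun y : Y => G.η y.1.succ) (fun y => G.η_t _) hη 1 (fun _ => 0)
        hUv (Fin.elim0 : Fin 0 → _) (fun z => z.elim0) (fun z => z.elim0) (d - m) hmd e (G.alg _) A w y
      exact this.trans (hmapw (some (some (Sum.inl y))))
    · exact z.elim0
  have hOm0 : Om e w1 u0 ≠ 0 := by
    refine Om_ne_zero _ _ _ fun c B hcB => ?_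
    rw [Fintype.sum_option, Fintype.sum_option, Fintype.sum_sum_type] at hcB
    simp only [Finset.univ_eq_empty, Finset.sum_empty, add_zero] at hcB
    change c none • w1.map (G.Δ.d (G.t (powMon d A))) + (c (some none) • C.R
      + ∑ y : Y, c (some (some (Sum.inl y))) • w1.map (G.Δ.d (G.η y.1.succ))) + B * w1 = 0 at hcB
    rw [G.sum_Y j1 (fun y => c (some (some (Sum.inl y))))] at hcB
    have hn0 : c none = 0 := by
      have := congrArg (xi G.g w1) hcB
      rw [map_add, map_add, map_add, map_smul, map_smul, G.xi_t w1 hP1.2, G.xi_DS w1 hP1,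
        G.xi_Bw w1 hP1, powMon, mv_single, hxi, pl_one c1] at this
      simpa using this
    rw [hn0, zero_smul, zero_add] at hcB
    obtain ⟨q1, q2, q3⟩ := hj1 _ _ _ (by simp) hcB
    refine ⟨?_, q3⟩
    ext o
    rcases o with _ | _ | y | z
    · exact hn0
    · exact q1
    · have := congrFun q2 y.1
      rw [dif_neg y.2] at this
      exact this
    · exact z.elim0
  have hmat : (rowsM w (N.row A w)).submatrix id e
      = (rowsM w1 u0).submatrix id e + s • (rowsM C.R u1).submatrix id e := by
    ext r p
    rcases r with o | ab
    · simp [rowsM, hrow]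
    · simp only [rowsM, Ew, submatrix_apply, of_apply, id, Sum.elim_inr, Matrix.add_apply,
        Matrix.smul_apply, hw]
      split_ifs <;> simp
  have hK : ∀ o i j, G.Δ.d ς (u0 o i j) = 0 ∧ G.Δ.d ς (u1 o i j) = 0 := by
    rintro (_ | _ | y | z) i j
    · exact ⟨G.Δ.presconst _ _ _ (hw1c i j), G.Δ.presconst _ _ _ (hRc i j)⟩
    · exact ⟨hRc i j, map_zero _⟩
    · exact ⟨G.Δ.presconst _ _ _ (hw1c i j), G.Δ.presconst _ _ _ (hRc i j)⟩
    · exact z.elim0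
  refine det_generic (Dconst (G.Δ.d ς)) s (G.Δ.transc ς) _ _ ?_ ?_ hOm0
    ((congrArg Matrix.det hmat).symm.trans h1)
  · rintro (o | ab) p
    · exact (hK o _ _).1
    · simp only [rowsM, Ew, submatrix_apply, of_apply, id, Sum.elim_inr]
      split_ifs
      · exact hw1c _ _
      · exact zero_mem _
  · rintro (o | ab) p
    · exact (hK o _ _).2
    · simp only [rowsM, Ew, submatrix_apply, of_apply, id, Sum.elim_inr]
      split_ifs
      · exact hRc _ _
      · exact zero_mem _
end Ln
end
end Irr
end

section
open Matrix MvPolynomial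
namespace Irr

section
variable {k m : ℕ} {F : Type*} [Field F] [CharZero F] {I : Type*} {d n : ℕ}

lemma pderiv_fix {ι : Type*} (σ : F ≃+* F) (p : MvPolynomial ι F) (i : ι)
    (h : ∀ α, σ (coeff α p) = coeff α p) (α) : σ (coeff α (pderiv i p)) = coeff α (pderiv i p) := by
  have h1 : MvPolynomial.map (σ : F →+* F) p = p := by
    ext α; rw [coeff_map]; exact h α
  have h2 : MvPolynomial.map (σ : F →+* F) (pderiv i p) = pderiv i p := by
    rw [← pderiv_map, h1]
  have := congrArg (coeff α) h2
  rw [coeff_map] at this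
  exact this

lemma count_roots (p : Polynomial F) (hp : p ≠ 0) (Z1 Z2 : Finset F)
    (h1 : ∀ z ∈ Z1, p.IsRoot z) (h2 : ∀ z ∈ Z2, p.IsRoot z)
    (h12 : ∀ z ∈ Z1, z ∈ Z2 → p.derivative.IsRoot z) : Z1.card + Z2.card ≤ p.roots.card := by
  classical
  have h : Z1.val + Z2.val ≤ p.roots := by
    rw [Multiset.le_iff_count]
    intro z
    rw [Multiset.count_add, Polynomial.count_roots]
    have c1 := Multiset.nodup_iff_count_le_one.1 Z1.nodup z
    have c2 := Multiset.nodup_iff_count_le_one.1 Z2.nodup z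
    by_cases z1 : z ∈ Z1
    · have a1 := (Polynomial.rootMultiplicity_pos hp).2 (h1 z z1)
      by_cases z2 : z ∈ Z2
      · have := (Polynomial.one_lt_rootMultiplicity_iff_isRoot hp).2 ⟨h1 z z1, h12 z z1 z2⟩
        omega
      · have : Multiset.count z Z2.val = 0 := Multiset.count_eq_zero.2 z2
        omega
    · have e1 : Multiset.count z Z1.val = 0 := Multiset.count_eq_zero.2 z1
      by_cases z2 : z ∈ Z2
      · have := (Polynomial.rootMultiplicity_pos hp).2 (h2 z z2)
        omega
      · have : Multiset.count z Z2.val = 0 := Multiset.count_eq_zero.2 z2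
        omega
  simpa using Multiset.card_le_card h

namespace Ln
variable {G : Lo F I k m d n} (E : Ln G)

/-- the residual points -/
structure Rs (x : PluckIdx k m → F) : Prop where
  W : x ∈ E.W
  ne : x ≠ 0
  g : eval x G.g = 0
  alt : (∀ θ (c : F), x ≠ c • pl (G.w θ)) ∨ ∀ u ∈ E.W, ∑ i, eval x (pderiv i G.g) * u i = 0

lemma fx_symm (σ : F ≃+* F) (hσ : G.Fx σ) : G.Fx σ.symm := by
  refine ⟨fun α => ?_, fun l α => ?_, fun l => ?_⟩ <;> rw [RingEquiv.symm_apply_eq]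
  · exact (hσ.g α).symm
  · exact (hσ.φ l α).symm
  · exact (hσ.y l).symm

lemma W_map (σ : F ≃+* F) (hσ : G.Fx σ) (x : PluckIdx k m → F) (hx : x ∈ E.W) :
    (fun S => σ (x S)) ∈ E.W := by
  obtain ⟨θ, θ', h⟩ := Fintype.one_lt_card_iff.1 (show 1 < Fintype.card G.Θ by have := E.card5; omega)
  obtain ⟨a, b, rfl⟩ := E.span_pair h x hx
  have h1 : ∀ θ, (fun S => σ (pl (G.w θ) S)) ∈ E.W := by
    intro θ
    obtain ⟨θ', c, h⟩ := G.stab σ hσ θ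
    rw [h]; exact E.W.smul_mem _ (E.mem _)
  have := E.W.add_mem (E.W.smul_mem (σ a) (h1 θ)) (E.W.smul_mem (σ b) (h1 θ'))
  convert this using 1
  ext S; simp

lemma Rs_map (σ : F ≃+* F) (hσ : G.Fx σ) (x : PluckIdx k m → F) (hx : E.Rs x) :
    E.Rs (fun S => σ (x S)) := by
  refine ⟨E.W_map σ hσ x hx.W, fun h => hx.ne ?_, ?_, ?_⟩
  · ext S; simpa using congrFun h S
  · rw [Lo.eval_fix σ _ hσ.g, hx.g, map_zero]
  · rcases hx.alt with h | h
    · left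
      intro θ c hc
      obtain ⟨θ', c', h'⟩ := G.stab _ (fx_symm σ hσ) θ
      apply h θ' (σ.symm c * c')
      rw [mul_smul, ← h']
      ext S
      have := congrArg σ.symm (congrFun hc S)
      simpa using this
    · right
      intro u hu
      have h1 := h _ (E.W_map _ (fx_symm σ hσ) u hu)
      have h2 := congrArg σ h1
      rw [map_sum, map_zero] at h2
      rw [← h2]
      refine Finset.sum_congr rfl fun i _ => ?_
      rw [map_mul, Lo.eval_fix σ _ (pderiv_fix σ _ i hσ.g), RingEquiv.apply_symm_apply]

/-- finite set of representatives -/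
lemma exists_T [IsAlgClosed F] [Infinite I] : ∃ T : Finset (PluckIdx k m → F), T.Nonempty ∧
    (∀ x ∈ T, E.Rs x) ∧ (∀ x ∈ T, ∀ y ∈ T, ∀ c : F, x = c • y → x = y) ∧
    (∀ x, E.Rs x → ∃ y ∈ T, ∃ c : F, x = c • y) ∧ T.card + Fintype.card G.Θ ≤ d := by
  classical
  obtain ⟨b, hb, hgb⟩ := E.g_ne
  have hd0 : 0 < d := by have := E.hd; have := E.hkm; have := E.hk; omega
  have hb0 : b ≠ 0 := by
    rintro rfl
    apply hgb
    have := eval_smul_hom G.g G.hg 0 (0 : PluckIdx k m → F)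
    rw [zero_smul, zero_pow hd0.ne', zero_mul] at this
    exact this
  obtain ⟨θ0⟩ := G.ne
  set a := pl (G.w θ0) with ha
  -- coordinates
  have hθb : ∀ θ (c : F), pl (G.w θ) ≠ c • b := by
    intro θ c h
    have h1 := (G.w_P θ).2
    rw [h, eval_smul_hom G.g G.hg] at h1
    rcases mul_eq_zero.1 h1 with h2 | h2
    · rw [pow_eq_zero_iff hd0.ne'] at h2
      apply (G.w_P θ).1
      rw [h, h2, zero_smul]
    · exact hgb h2
  have hi : LinearIndependent F ![a, b] := by
    rw [LinearIndependent.pair_iff' (G.w_P θ0).1]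
    intro c h
    have hc : c ≠ 0 := by rintro rfl; rw [zero_smul] at h; exact hb0 h.symm
    apply hθb θ0 c⁻¹
    rw [← h, smul_smul, inv_mul_cancel₀ hc, one_smul]
  have hle : Submodule.span F (Set.range ![a, b]) ≤ E.W := by
    rw [Submodule.span_le]
    rintro _ ⟨i, rfl⟩
    fin_cases i
    · exact E.mem _
    · exact hb
  have heq := Submodule.eq_of_le_of_finrank_le hle (by
    rw [finrank_span_eq_card hi]; simpa using E.rank)
  have hsp : ∀ x ∈ E.W, ∃ s t : F, x = s • a + t • b := by
    intro x hx
    rw [← heq, Matrix.range_cons, Matrix.range_cons, Matrix.range_empty, Set.union_empty,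
      ← Set.insert_eq] at hx
    obtain ⟨a, b, h⟩ := Submodule.mem_span_pair.1 hx
    exact ⟨a, b, h.symm⟩
  have hnorm : ∀ x ∈ E.W, x ≠ 0 → eval x G.g = 0 → ∃ c z : F, c ≠ 0 ∧ x = c • (a + z • b) := by
    intro x hx hx0 hg
    obtain ⟨s, t, rfl⟩ := hsp x hx
    have hs : s ≠ 0 := by
      rintro rfl
      rw [zero_smul, zero_add] at hx0 hg
      rw [eval_smul_hom G.g G.hg] at hg
      rcases mul_eq_zero.1 hg with h2 | h2
      · rw [pow_eq_zero_iff hd0.ne'] at h2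
        apply hx0; rw [h2, zero_smul]
      · exact hgb h2
    exact ⟨s, s⁻¹ * t, hs, by rw [smul_add, smul_smul, ← mul_assoc, mul_inv_cancel₀ hs, one_mul]⟩
  have hind : ∀ z z' c : F, a + z • b = c • (a + z' • b) → c = 1 ∧ z = z' := by
    intro z z' c h
    have h1 := (LinearIndependent.pair_iff.1 hi) (1 - c) (z - c * z') (by
      rw [sub_smul, sub_smul, one_smul]
      rw [smul_add, smul_smul] at h
      linear_combination (exp := 1) h)
    have hc : c = 1 := by linear_combination -h1.1
    subst hc
    exact ⟨rfl, by linear_combination h1.2⟩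
  set ψ := lp a b G.g with hψ
  obtain ⟨hdeg, hlc⟩ := lp_deg a b G.g G.hg
  rw [← hψ] at hdeg hlc
  have hψ0 : ψ ≠ 0 := by
    intro h; rw [h, Polynomial.coeff_zero] at hlc; exact hgb hlc.symm
  have hnd : ψ.natDegree = d := le_antisymm hdeg (Polynomial.le_natDegree_of_ne_zero (by rwa [hlc]))
  have hcard : ψ.roots.card = d := by
    rw [← hnd]; exact (IsAlgClosed.splits ψ).natDegree_eq_card_roots.symm
  have hroot : ∀ z, ψ.IsRoot z ↔ eval (a + z • b) G.g = 0 := by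
    intro z; rw [Polynomial.IsRoot, hψ, lp_eval]
  have hgW : ∀ z : F, a + z • b ∈ E.W := fun z => E.W.add_mem (E.mem _) (E.W.smul_mem _ hb)
  have hne0 : ∀ z : F, a + z • b ≠ 0 := by
    intro z h
    have := (LinearIndependent.pair_iff.1 hi) 1 z (by rw [one_smul]; exact h)
    exact one_ne_zero this.1
  have hder : ∀ z, ψ.IsRoot z → (ψ.derivative.IsRoot z ↔
      ∀ u ∈ E.W, ∑ i, eval (a + z • b) (pderiv i G.g) * u i = 0) := by
    intro z hz
    rw [Polynomial.IsRoot, hψ, lp_deriv_eval]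
    refine ⟨fun h u hu => ?_, fun h => h b hb⟩
    have hE := congrArg (eval (a + z • b)) G.hg.sum_X_mul_pderiv
    simp only [map_sum, map_mul, eval_X, map_nsmul] at hE
    rw [(hroot z).1 hz, nsmul_zero] at hE
    obtain ⟨s, t, rfl⟩ := hsp u hu
    have : s • a + t • b = s • (a + z • b) + (t - s * z) • b := by module
    rw [this]
    calc _ = s * ∑ i, (a + z • b) i * eval (a + z • b) (pderiv i G.g)
        + (t - s * z) * ∑ i, eval (a + z • b) (pderiv i G.g) * b i := by
          rw [Finset.mul_sum, Finset.mul_sum, ← Finset.sum_add_distrib]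
          refine Finset.sum_congr rfl fun i _ => ?_
          simp only [Pi.add_apply, Pi.smul_apply, smul_eq_mul]; ring
      _ = 0 := by rw [h, hE, mul_zero, mul_zero, add_zero]
  -- roots from the fiber
  choose c zθ hc hzθ using fun θ => hnorm _ (E.mem θ) (G.w_P θ).1 (G.w_P θ).2
  have hzinj : Function.Injective zθ := by
    intro θ θ' h
    refine G.w_inj θ θ' (c θ * (c θ')⁻¹) ?_
    rw [hzθ θ', hzθ θ, h, smul_smul, mul_assoc, inv_mul_cancel₀ (hc θ'), mul_one]
  have hzroot : ∀ θ, ψ.IsRoot (zθ θ) := by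
    intro θ
    rw [hroot]
    have := (G.w_P θ).2
    rw [hzθ, eval_smul_hom G.g G.hg] at this
    exact (mul_eq_zero.1 this).resolve_left (pow_ne_zero _ (hc θ))
  let Z1 : Finset F := Finset.univ.image zθ
  have hZ1 : Z1.card = Fintype.card G.Θ := by
    rw [Finset.card_image_of_injective _ hzinj]; rfl
  have hZ1r : ∀ z ∈ Z1, ψ.IsRoot z := by
    intro z hz
    obtain ⟨θ, -, rfl⟩ := Finset.mem_image.1 hz
    exact hzroot θ
  have hmem1 : ∀ z, z ∈ Z1 ↔ ∃ θ, ∃ c : F, a + z • b = c • pl (G.w θ) := by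
    intro z
    constructor
    · intro hz
      obtain ⟨θ, -, rfl⟩ := Finset.mem_image.1 hz
      refine ⟨θ, (c θ)⁻¹, ?_⟩
      rw [hzθ, smul_smul, inv_mul_cancel₀ (hc θ), one_smul]
    · rintro ⟨θ, c', h⟩
      rw [hzθ, smul_smul] at h
      rw [(hind _ _ _ h).2]
      exact Finset.mem_image_of_mem _ (Finset.mem_univ _)
  let Z2 : Finset F := ψ.roots.toFinset.filter fun z => z ∉ Z1 ∨ ψ.derivative.IsRoot z
  have hZ2 : ∀ z, z ∈ Z2 ↔ ψ.IsRoot z ∧ (z ∉ Z1 ∨ ψ.derivative.IsRoot z) := by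
    intro z; simp only [Z2, Finset.mem_filter, Multiset.mem_toFinset, Polynomial.mem_roots hψ0]
  have hcount := count_roots ψ hψ0 Z1 Z2 hZ1r (fun z hz => ((hZ2 z).1 hz).1)
    (fun z hz hz2 => ((hZ2 z).1 hz2).2.resolve_left (fun h => h hz))
  have hZ2ne : Z2.Nonempty := by
    by_contra hne
    rw [Finset.not_nonempty_iff_eq_empty] at hne
    have hle' : ψ.roots ≤ Z1.val := by
      rw [Multiset.le_iff_count]
      intro z
      rw [Polynomial.count_roots]
      by_cases hz : ψ.IsRoot z
      · have h2 : z ∉ Z2 := by rw [hne]; exact Finset.notMem_empty _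
        rw [hZ2] at h2
        push Not at h2
        obtain ⟨h3, h4⟩ := h2 hz
        rw [Multiset.count_eq_one_of_mem Z1.nodup h3]
        by_contra hlt
        exact h4 ((Polynomial.one_lt_rootMultiplicity_iff_isRoot hψ0).1 (by omega)).2
      · rw [Polynomial.rootMultiplicity_eq_zero hz]; exact Nat.zero_le _
    have := Multiset.card_le_card hle'
    have hlt := G.card_lt
    change Fintype.card G.Θ < d at hlt
    rw [hcard, Finset.card_val, hZ1] at this
    omega
  have hvinj : Function.Injective fun z : F => a + z • b := by
    intro z z' h
    exact (hind z z' 1 (by rw [one_smul]; exact h)).2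
  have hRs : ∀ z : F, E.Rs (a + z • b) ↔ z ∈ Z2 := by
    intro z
    rw [hZ2, hmem1]
    constructor
    · intro h
      have hr := (hroot z).2 h.g
      refine ⟨hr, ?_⟩
      rcases h.alt with h1 | h1
      · left
        rintro ⟨θ, c, hc⟩
        exact h1 θ c hc
      · right
        exact (hder z hr).2 h1
    · rintro ⟨hr, h⟩
      refine ⟨hgW z, hne0 z, (hroot z).1 hr, ?_⟩
      rcases h with h | h
      · left
        intro θ c hc
        exact h ⟨θ, c, hc⟩
      · right
        exact (hder z hr).1 h
  have hRsc : ∀ (x : PluckIdx k m → F) (c : F), c ≠ 0 → E.Rs (c • x) → E.Rs x := by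
    intro x c hc h
    have hx : x = c⁻¹ • (c • x) := by rw [smul_smul, inv_mul_cancel₀ hc, one_smul]
    refine ⟨?_, ?_, ?_, ?_⟩
    · rw [hx]; exact E.W.smul_mem _ h.W
    · rintro rfl; exact h.ne (smul_zero _)
    · have := h.g
      rw [eval_smul_hom G.g G.hg] at this
      exact (mul_eq_zero.1 this).resolve_left (pow_ne_zero _ hc)
    · rcases h.alt with h1 | h1
      · left
        rintro θ c' rfl
        exact h1 θ (c * c') (smul_smul _ _ _)
      · right
        intro u hu
        have h2 := h1 u hu
        simp only [eval_smul_hom _ (G.hg.pderiv), mul_assoc] at h2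
        rw [← Finset.mul_sum] at h2
        exact (mul_eq_zero.1 h2).resolve_left (pow_ne_zero _ hc)
  refine ⟨Z2.image fun z => a + z • b, hZ2ne.image _, ?_, ?_, ?_, ?_⟩
  · intro x hx
    obtain ⟨z, hz, rfl⟩ := Finset.mem_image.1 hx
    exact (hRs z).2 hz
  · intro x hx y hy c h
    obtain ⟨z, hz, rfl⟩ := Finset.mem_image.1 hx
    obtain ⟨z', hz', rfl⟩ := Finset.mem_image.1 hy
    rw [(hind _ _ _ h).2]
  · intro x hx
    obtain ⟨c, z, hc, rfl⟩ := hnorm x hx.W hx.ne hx.g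
    exact ⟨_, Finset.mem_image_of_mem _ ((hRs z).1 (hRsc _ _ hc hx)), c, rfl⟩
  · rw [Finset.card_image_of_injective _ hvinj]
    omega
end Ln
end
end Irr
end

section
open Matrix MvPolynomial
namespace Irr

section
variable {k m : ℕ} {F : Type*} [Field F] [CharZero F] {I : Type*} {d n : ℕ}

lemma lp_map {K L ι : Type*} [Field K] [Field L] [Fintype ι] (f : K →+* L) (a v : ι → K)
    (g : MvPolynomial ι K) :
    lp (fun i => f (a i)) (fun i => f (v i)) (MvPolynomial.map f g) = (lp a v g).map f := by
  induction g using MvPolynomial.induction_on with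
  | C c => simp [lp]
  | add p q hp hq => simp only [lp, map_add, Polynomial.map_add] at hp hq ⊢; rw [hp, hq]
  | mul_X p i hp =>
    simp only [lp, map_mul, Polynomial.map_mul, MvPolynomial.aeval_X, MvPolynomial.map_X] at hp ⊢
    rw [hp]; simp

/-- choose a basis of the span of a finite family -/
lemma exists_sub {V : Type*} [AddCommGroup V] [Module F V] [FiniteDimensional F V] {J : Type*}
    (ρ : J → V) : ∃ z : Fin (Module.finrank F (Submodule.span F (Set.range ρ))) → J,
      Function.Injective z ∧ LinearIndependent F (ρ ∘ z) := by
  obtain ⟨κ, a, ha, hs, hl⟩ := exists_linearIndependent' F ρ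
  haveI : Finite κ := hl.finite
  haveI := Fintype.ofFinite κ
  have h := finrank_span_eq_card hl
  rw [hs] at h
  let e : Fin (Module.finrank F (Submodule.span F (Set.range ρ))) ≃ κ :=
    (finCongr h).trans (Fintype.equivFin κ).symm
  exact ⟨a ∘ e, ha.comp e.injective, hl.comp e e.injective⟩

/-- complete an independent family -/
lemma exists_compl {V : Type*} [AddCommGroup V] [Module F V] [FiniteDimensional F V] {P J : Type*}
    [Fintype P] (u : P → V) (hu : LinearIndependent F u) (ρ : J → V)
    (hs : Submodule.span F (Set.range u) ⊔ Submodule.span F (Set.range ρ) = ⊤) (c : ℕ)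
    (hc : Fintype.card P + c = Module.finrank F V) :
    ∃ z : Fin c → J, LinearIndependent F (Sum.elim u (ρ ∘ z)) := by
  set U := Submodule.span F (Set.range u) with hU
  obtain ⟨z, -, hl⟩ := exists_sub (F := F) (fun j => U.mkQ (ρ j))
  have h1 : Submodule.span F (Set.range fun j => U.mkQ (ρ j)) = ⊤ := by
    have : (Set.range fun j => U.mkQ (ρ j)) = U.mkQ '' Set.range ρ := by
      rw [← Set.range_comp]; rfl
    rw [this, ← Submodule.map_span, ← Submodule.range_mkQ U, LinearMap.range_eq_map, ← hs,
      Submodule.map_sup]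
    have : Submodule.map U.mkQ U = ⊥ := by simp
    rw [this, bot_sup_eq]
  have h2 : Module.finrank F (Submodule.span F (Set.range fun j => U.mkQ (ρ j))) = c := by
    rw [h1, finrank_top]
    have := Submodule.finrank_quotient_add_finrank U
    have h3 := finrank_span_eq_card hu
    rw [← hU] at h3
    omega
  have hu' : LinearIndependent F (fun x : P => (⟨u x, Submodule.subset_span ⟨x, rfl⟩⟩ : U)) :=
    linearIndependent_span hu
  refine ⟨z ∘ finCongr h2.symm, ?_⟩
  have := LinearIndependent.sumElim_of_quotient hu' (ρ ∘ z ∘ finCongr h2.symm)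
    (hl.comp _ (finCongr h2.symm).injective)
  exact this

namespace Ln
variable {G : Lo F I k m d n} (E : Ln G)

lemma lift (x : PluckIdx k m → F) (hx : x ∈ E.W) (h0 : x ≠ 0) :
    ∃ (w : Matrix (Fin k) (Fin m) F) (A : PluckIdx k m), cs w A = 1 ∧ ∃ c : F, c ≠ 0 ∧ x = c • pl w := by
  obtain ⟨A, hA⟩ := Function.ne_iff.1 h0
  have hA : x A ≠ 0 := hA
  obtain ⟨C⟩ := E.exists_Ch A ⟨x, hx, hA⟩
  obtain ⟨s, hs⟩ := C.all ((x A)⁻¹ • x) (E.W.smul_mem _ hx) (by simp [hA])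
  refine ⟨C.w1 + s • C.R, A, ?_, x A, hA, ?_⟩
  · have h1 := C.hw1
    have h2 := C.hRA
    ext i j
    have h1 := congrFun (congrFun h1 i) j
    have h2 := congrFun (congrFun h2 i) j
    simp only [cs, submatrix_apply, id, Matrix.zero_apply] at h1 h2
    simp [cs, h1, h2]
  · rw [C.hpl, ← hs, smul_smul, mul_inv_cancel₀ hA, one_smul]

lemma kill [IsAlgClosed F] [Infinite I] (A : PluckIdx k m) (C : E.Ch A) (w : Matrix (Fin k) (Fin m) F)
    (hw : cs w A = 1) (hW : pl w ∈ E.W) (c : Fin n → F) (h1 : ∀ i j, G.DS c (w i j) = 0)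
    (h2 : ∀ i, G.DS c (C.R i C.j0) = 0) (h3 : ∀ j, G.DS c (C.R C.i0 j) = 0) : c = 0 := by
  set D := G.DS c with hD
  have hcs : ∀ (w : Matrix (Fin k) (Fin m) F) (s : F), cs w A = 1 → cs (w + s • C.R) A = 1 := by
    intro w s h1
    have h2 := C.hRA
    ext i j
    have h1 := congrFun (congrFun h1 i) j
    have h2 := congrFun (congrFun h2 i) j
    simp only [cs, submatrix_apply, id, Matrix.zero_apply] at h1 h2
    simp [cs, h1, h2]
  obtain ⟨s, hs⟩ := C.all _ hW (pl_one hw)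
  have hw' : w = C.w1 + s • C.R := eq_of_pl_eq _ _ A hw (hcs _ _ C.hw1) (by rw [hs, C.hpl])
  have hline : ∀ t : F, pl (w + t • C.R) = pl w + t • C.v := by
    intro t
    rw [hw', add_assoc, ← add_smul, C.hpl, C.hpl, add_smul, add_assoc]
  have hR : ∀ i j, D (C.R i j) = 0 := by
    intro i j
    rw [C.hR, Derivation.leibniz, h2, h3, smul_zero, smul_zero, add_zero]
  have hDpl : ∀ u : Matrix (Fin k) (Fin m) F, (∀ i j, D (u i j) = 0) → ∀ S, D (pl u S) = 0 := by
    intro u hu S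
    rw [← dpl_der]
    have : u.map D = 0 := by ext i j; exact hu i j
    rw [this, map_zero]
  have hv : ∀ S, D (C.v S) = 0 := by
    intro S
    have := congrFun (hline 1) S
    rw [one_smul, one_smul] at this
    have e : C.v S = pl (w + C.R) S - pl w S := by rw [this]; simp
    rw [e, map_sub, hDpl w h1, hDpl _ (fun i j => by rw [Matrix.add_apply, map_add, h1, hR, add_zero]), sub_zero]
  have hg : ∀ α, D (coeff α G.g) = 0 := by
    intro α
    rw [hD, G.DS_apply]
    exact Finset.sum_eq_zero fun j _ => by rw [G.d_coeff _ _ (G.η_t _), mul_zero]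
  -- a point of the fiber in the chart
  obtain ⟨θ, -, -, hθ, -⟩ := E.exists_two A ⟨_, hW, by rw [pl_one hw]; exact one_ne_zero⟩
  set u := nrm (G.w θ) A with hu
  have cu : cs u A = 1 := cs_nrm _ _ hθ
  have hpu : pl u ∈ E.W := by rw [hu, pl_nrm]; exact E.W.smul_mem _ (E.mem _)
  obtain ⟨s', hs'⟩ := C.all _ hpu (pl_one cu)
  set t := s' - s with ht
  have hut : u = w + t • C.R := by
    rw [hw', add_assoc, ← add_smul, ht, add_sub_cancel]
    exact eq_of_pl_eq _ _ A cu (hcs _ _ C.hw1) (by rw [hs', C.hpl])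
  have hgu : eval (pl u) G.g = 0 := by
    rw [hu, pl_nrm, eval_smul_hom G.g G.hg, (G.w_P θ).2, mul_zero]
  have hroot : (lp (pl w) C.v G.g).IsRoot t := by
    rw [Polynomial.IsRoot, lp_eval, ← hline, ← hut, hgu]
  have hne : lp (pl w) C.v G.g ≠ 0 := by
    intro h0
    obtain ⟨x, hx, hgx⟩ := E.g_ne
    have hall : ∀ y ∈ E.W, y A ≠ 0 → eval y G.g = 0 := by
      intro y hy hyA
      obtain ⟨q, hq⟩ := C.all ((y A)⁻¹ • y) (E.W.smul_mem _ hy) (by simp [hyA])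
      have e1 : (y A)⁻¹ • y = pl w + (q - s) • C.v := by rw [hq, hs]; module
      have e2 : y = y A • (pl w + (q - s) • C.v) := by
        rw [← e1, smul_smul, mul_inv_cancel₀ hyA, one_smul]
      rw [e2, eval_smul_hom G.g G.hg, ← lp_eval, h0, Polynomial.eval_zero, mul_zero]
    have hp : lp x (pl w) G.g = 0 := by
      refine Polynomial.eq_zero_of_infinite_isRoot _ (Set.Infinite.mono (s := {-x A}ᶜ) ?_
        (Set.Finite.infinite_compl (Set.finite_singleton _)))
      intro q hq
      refine (lp_eval _ _ _ _).trans (hall _ (E.W.add_mem hx (E.W.smul_mem _ hW)) fun h => hq ?_)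
      rw [Pi.add_apply, Pi.smul_apply, pl_one hw, smul_eq_mul, mul_one] at h
      exact eq_neg_of_add_eq_zero_right h
    apply hgx
    have := lp_eval x (pl w) G.g 0
    rw [hp, Polynomial.eval_zero, zero_smul, add_zero] at this
    exact this.symm
  have halg : IsAlgebraic (Dconst D) t := by
    have hg' : G.g ∈ (MvPolynomial.map (σ := PluckIdx k m) (algebraMap (Dconst D) F)).range := by
      rw [← SetLike.mem_coe, RingHom.coe_range, mem_range_map_iff_coeffs_subset]
      simp only [Set.subset_def, Finset.mem_coe, mem_coeffs_iff]
      rintro x ⟨α, _, rfl⟩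
      exact ⟨⟨_, hg α⟩, rfl⟩
    obtain ⟨g', hg'⟩ := hg'
    let a' : PluckIdx k m → Dconst D := fun S => ⟨pl w S, hDpl w h1 S⟩
    let v' : PluckIdx k m → Dconst D := fun S => ⟨C.v S, hv S⟩
    have hmap : lp (pl w) C.v G.g = (lp a' v' g').map (algebraMap (Dconst D) F) := by
      rw [← hg']; exact lp_map (algebraMap (Dconst D) F) a' v' g'
    refine ⟨lp a' v' g', fun h => hne (by rw [hmap, h, Polynomial.map_zero]), ?_⟩
    rw [Polynomial.aeval_def, ← Polynomial.eval_map, ← hmap]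
    exact hroot
  have hDt : D t = 0 := der_alg_zero D (Dconst D) (fun x hx => hx) t halg
  obtain ⟨l', hl', hφ⟩ := nrm_φ A θ hθ
  refine G.DS_ker u l' hl' hφ c 0 ?_
  rw [Matrix.zero_mul]
  ext i j
  rw [hut]
  simp only [Matrix.map_apply, Matrix.add_apply, Matrix.smul_apply, smul_eq_mul, Matrix.zero_apply]
  rw [← hD, map_add, Derivation.leibniz, h1, hR, hDt]
  simp

lemma exists_Y [IsAlgClosed F] [Infinite I] (A : PluckIdx k m) (w : Matrix (Fin k) (Fin m) F)
    (hw : cs w A = 1) (hW : pl w ∈ E.W) : ∃ (e : ℕ) (y : Fin e → Fin n), Function.Injective y ∧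
      n + 2 ≤ e + m ∧ LinearIndependent F (fun j => w.map (G.Δ.d (G.η (y j).succ))) := by
  classical
  obtain ⟨C⟩ := E.exists_Ch A ⟨_, hW, by rw [pl_one hw]; exact one_ne_zero⟩
  let ρ : Fin n → Matrix (Fin k) (Fin m) F := fun j => w.map (G.Δ.d (G.η j.succ))
  obtain ⟨z, hz, hl⟩ := exists_sub (F := F) ρ
  refine ⟨_, z, hz, ?_, hl⟩
  let Φ : (Fin n → F) →ₗ[F] Matrix (Fin k) (Fin m) F := Fintype.linearCombination F ρ
  have hΦ : ∀ c, Φ c = w.map (G.DS c) := fun c => by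
    rw [G.map_DS]; exact Fintype.linearCombination_apply F ρ c
  have hr : Module.finrank F Φ.range = Module.finrank F (Submodule.span F (Set.range ρ)) := by
    rw [Fintype.range_linearCombination]
  have hrn := LinearMap.finrank_range_add_finrank_ker Φ
  rw [hr, Module.finrank_fin_fun] at hrn
  let J1 : Finset (Fin k) := Finset.univ.erase C.i0
  let J2 : Finset (Fin m) := (Finset.univ.image (en A))ᶜ.erase C.j0
  have hzero : ∀ i b, C.R i (en A b) = 0 := fun i b => congrFun (congrFun C.hRA i) b
  have hj0 : C.j0 ∈ (Finset.univ.image (en A))ᶜ := by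
    rw [Finset.mem_compl]
    intro h
    obtain ⟨b, -, hb⟩ := Finset.mem_image.1 h
    have := C.hR0
    rw [← hb, hzero] at this
    exact zero_ne_one this
  have hc1 : J1.card = k - 1 := by simp [J1]
  have hc2 : J2.card = m - k - 1 := by
    simp only [J2]
    rw [Finset.card_erase_of_mem hj0, Finset.card_compl, Finset.card_image_of_injective _ (en_inj A)]
    simp
  let Ψ : (Fin n → F) →ₗ[F] (J1 ⊕ J2 → F) :=
    Fintype.linearCombination F (fun j => Sum.elim (fun i : J1 => G.Δ.d (G.η j.succ) (C.R i C.j0))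
      (fun l : J2 => G.Δ.d (G.η j.succ) (C.R C.i0 l)))
  have hΨ1 : ∀ c (i : J1), Ψ c (Sum.inl i) = G.DS c (C.R i C.j0) := by
    intro c i
    simp only [Ψ, Fintype.linearCombination_apply, Finset.sum_apply, Pi.smul_apply, Sum.elim_inl,
      smul_eq_mul, G.DS_apply]
  have hΨ2 : ∀ c (l : J2), Ψ c (Sum.inr l) = G.DS c (C.R C.i0 l) := by
    intro c i
    simp only [Ψ, Fintype.linearCombination_apply, Finset.sum_apply, Pi.smul_apply, Sum.elim_inr,
      smul_eq_mul, G.DS_apply]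
  have hinj : Function.Injective (Ψ.comp Φ.ker.subtype) := by
    rw [injective_iff_map_eq_zero]
    rintro ⟨c, hc⟩ h
    rw [LinearMap.mem_ker, hΦ] at hc
    have h : Ψ c = 0 := h
    apply Subtype.ext
    refine E.kill A C w hw hW c (fun i j => congrFun (congrFun hc i) j) (fun i => ?_) fun j => ?_
    · by_cases hi : i = C.i0
      · rw [hi, C.hR0]; exact Derivation.map_one_eq_zero _
      · rw [← hΨ1 c ⟨i, by simp [J1, hi]⟩, h]; rfl
    · by_cases hj : j = C.j0
      · rw [hj, C.hR0]; exact Derivation.map_one_eq_zero _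
      · by_cases hj' : j ∈ Finset.univ.image (en A)
        · obtain ⟨b, -, hb⟩ := Finset.mem_image.1 hj'
          rw [← hb, hzero, map_zero]
        · rw [← hΨ2 c ⟨j, Finset.mem_erase.2 ⟨hj, Finset.mem_compl.2 hj'⟩⟩, h]; rfl
  have hle := LinearMap.finrank_le_finrank_of_injective hinj
  rw [Module.finrank_pi, Fintype.card_sum, Fintype.card_coe, Fintype.card_coe, hc1, hc2] at hle
  have := E.hk; have := E.hkm
  omega
end Ln
end
end Irr
end

section
open Matrix MvPolynomial
namespace Irr

section
variable {k m : ℕ} {F : Type*} [Field F] [CharZero F] {I : Type*} {d : ℕ}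

/-- elementary matrix or zero -/
def EE (R : Type*) [CommRing R] (o : Option (Fin m × Fin m)) : Matrix (Fin m) (Fin m) R :=
  match o with
  | none => 0
  | some ij => Matrix.single ij.1 ij.2 (1 : R)

/-- associated polynomial -/
noncomputable def hE (g : MvPolynomial (PluckIdx k m) F) (o : Option (Fin m × Fin m)) :
    MvPolynomial (PluckIdx k m) F :=
  match o with
  | none => 0
  | some ij => hp g ij

lemma xi_EE (g : MvPolynomial (PluckIdx k m) F) (w : Matrix (Fin k) (Fin m) F) (o) :
    xi g w (w * EE F o) = eval (pl w) (hE g o) := by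
  rcases o with _ | ij
  · simp [EE, hE]
  · exact xi_single g w ij

lemma hE_hom (g : MvPolynomial (PluckIdx k m) F) (hd : 1 ≤ d) (hg : g.IsHomogeneous d) (o) :
    (hE g o).IsHomogeneous d := by
  rcases o with _ | ij
  · exact isHomogeneous_zero _ _ _
  · exact hp_hom g hd hg ij

lemma hE_coeff (g : MvPolynomial (PluckIdx k m) F) (κ : Subfield F)
    (h : ∀ α, coeff α g ∈ κ) (o) (α) : coeff α (hE g o) ∈ κ := by
  rcases o with _ | ij
  · simp [hE]
  · exact hp_coeff g κ h ij α

lemma EE_map {R S : Type*} [CommRing R] [CommRing S] (f : R →+* S) (o : Option (Fin m × Fin m)) :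
    (EE R o).map f = EE S o := by
  rcases o with _ | ij
  · simp [EE]
  · ext i j
    simp only [EE, Matrix.map_apply, Matrix.single_apply]
    split_ifs <;> simp

lemma exists_mu {P Q K : Type*} [Field K] [Fintype P] [DecidableEq P] [Fintype Q]
    [DecidableEq Q] (ι : K →+* F) (M : Matrix Q Q F) (N : Matrix P P K) :
    ∃ μ : ℕ, IsUnit (M + (μ : F) • (1 : Matrix Q Q F)).det ∧ IsUnit (1 - (μ : K) • N).det := by
  haveI : CharZero K := ⟨fun a b h => Nat.cast_injective (R := F) (by simpa using congrArg ι h)⟩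
  have e : ∀ t : K, N.charpolyRev.eval t = (1 - t • N).det := by
    intro t
    rw [Matrix.charpolyRev, ← Polynomial.coe_evalRingHom, RingHom.map_det]
    congr 1
    ext i j
    simp [Matrix.one_apply, apply_ite]
    ring
  have hN : N.charpolyRev ≠ 0 := by
    intro h
    have := Matrix.eval_charpolyRev (M := N)
    rw [h, Polynomial.eval_zero] at this
    exact zero_ne_one this
  have hM : (-M).charpoly ≠ 0 := (Matrix.charpoly_monic _).ne_zero
  have h1 : {μ : ℕ | (-M).charpoly.IsRoot (μ : F)}.Finite :=
    (Polynomial.finite_setOf_isRoot hM).preimage (Nat.cast_injective.injOn)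
  have h2 : {μ : ℕ | N.charpolyRev.IsRoot (μ : K)}.Finite :=
    (Polynomial.finite_setOf_isRoot hN).preimage (Nat.cast_injective.injOn)
  obtain ⟨μ, -, hμ⟩ := Set.Infinite.exists_notMem_finite Set.infinite_univ (h1.union h2)
  rw [Set.mem_union, not_or] at hμ
  refine ⟨μ, IsUnit.mk0 _ fun h => hμ.1 ?_, IsUnit.mk0 _ fun h => hμ.2 ?_⟩
  · change (-M).charpoly.eval (μ : F) = 0
    rw [Matrix.eval_charpoly, ← h]
    congr 1
    rw [sub_neg_eq_add, add_comm, Matrix.scalar_apply, Matrix.smul_one_eq_diagonal]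
  · change N.charpolyRev.eval (μ : K) = 0
    rw [e, h]

lemma exists_alpha (A : PluckIdx k m) (hd : 0 < d) :
    ∃ α : Fin k × {j : Fin m // j ∉ Set.range (en A)} → Mon k m d, Function.Injective α := by
  have hmem : ∀ x, x ∈ A.1 ↔ x ∈ Set.range (en A) := by
    intro x
    constructor
    · intro hx
      obtain ⟨b, hb⟩ := (A.1.orderIsoOfFin A.2).surjective ⟨x, hx⟩
      exact ⟨b, by rw [en, hb]⟩
    · rintro ⟨b, rfl⟩
      exact (A.1.orderIsoOfFin A.2 b).2
  let A' : Fin k × {j : Fin m // j ∉ Set.range (en A)} → PluckIdx k m := fun q =>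
    ⟨insert q.2.1 (A.1.erase (en A q.1)), by
      have h1 : q.2.1 ∉ A.1 := fun h => q.2.2 ((hmem _).1 h)
      have h2 : en A q.1 ∈ A.1 := (hmem _).2 ⟨_, rfl⟩
      rw [Finset.card_insert_of_notMem (fun h => h1 (Finset.mem_of_mem_erase h)),
        Finset.card_erase_of_mem h2, A.2]
      have := q.1.2
      omega⟩
  refine ⟨fun q => powMon d (A' q), ?_⟩
  intro q q' h
  have h1 := congrArg Subtype.val h
  simp only [powMon] at h1
  rw [Finsupp.single_eq_single_iff] at h1
  have h2 : A' q = A' q' := by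
    rcases h1 with h1 | h1
    · exact h1.1
    · omega
  have h3 : insert q.2.1 (A.1.erase (en A q.1)) = insert q'.2.1 (A.1.erase (en A q'.1)) :=
    congrArg Subtype.val h2
  have hq : q.2.1 ∉ A.1 := fun h => q.2.2 ((hmem _).1 h)
  have e1 : q.2 = q'.2 := by
    apply Subtype.ext
    have := Finset.mem_insert_self q.2.1 (A.1.erase (en A q.1))
    rw [h3, Finset.mem_insert] at this
    rcases this with h | h
    · exact h
    · exact absurd (Finset.mem_of_mem_erase h) hq
  have e2 : q.1 = q'.1 := by
    apply en_inj A
    by_contra hne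
    have hm : en A q.1 ∈ insert q'.2.1 (A.1.erase (en A q'.1)) :=
      Finset.mem_insert_of_mem (Finset.mem_erase.2 ⟨hne, (hmem _).2 ⟨_, rfl⟩⟩)
    rw [← h3, Finset.mem_insert] at hm
    rcases hm with h | h
    · exact q.2.2 ⟨_, h⟩
    · exact (Finset.notMem_erase _ _) h
  exact Prod.ext e2 e1

lemma exists_twist (G : Su F I k m d) (hd : 0 < d) (s0 : I) (hs : s0 ∉ Set.range G.t) (A : PluckIdx k m)
    (w : Matrix (Fin k) (Fin m) F) (hw : cs w A = 1) :
    ∃ (U : Matrix (Mon k m d) (Mon k m d) (G.K s0)) (v : Mon k m d → Matrix (Fin m) (Fin m) (G.K s0)),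
      (∀ w, G.P w → ∀ β, xi G.g w (twD (G.dU U β) (v β) w) = - mv (pl w) β.1) ∧
      ∀ u : Matrix (Fin k) (Fin m) F, ∃ (c : Mon k m d → F) (B : Matrix (Fin k) (Fin k) F),
        u = ∑ β, c β • twD (G.dU U β) (v β) w + B * w := by
  classical
  obtain ⟨α, hα⟩ := exists_alpha (d := d) A hd
  let tw : Mon k m d → Option (Fin m × Fin m) :=
    Function.extend α (fun q => some (en A q.1, q.2.1)) (fun _ => none)
  have htw : ∀ q, tw (α q) = some (en A q.1, q.2.1) := fun q => hα.extend_apply _ _ _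
  have hK : ∀ o γ, coeff γ (hE G.g o) ∈ (G.K s0) := fun o γ =>
    hE_coeff G.g (G.K s0).toSubfield (fun α => G.d_coeff α s0 hs) o γ
  let N : Matrix (Mon k m d) (Mon k m d) (G.K s0) :=
    Matrix.of fun a b => ⟨coeff b.1 (hE G.g (tw a)), hK _ _⟩
  let M : Matrix (Fin k × {j : Fin m // j ∉ Set.range (en A)})
      (Fin k × {j : Fin m // j ∉ Set.range (en A)}) F :=
    Matrix.of fun q q' => G.Δ.d (G.t (α q)) (w q'.1 q'.2.1)
  obtain ⟨μ, hM, hV⟩ := exists_mu (algebraMap (G.K s0) F) M N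
  let V := 1 - (μ : G.K s0) • N
  let U := V⁻¹
  have hUV : U * V = 1 := nonsing_inv_mul _ hV
  have hVU : V * U = 1 := mul_nonsing_inv _ hV
  let v : Mon k m d → Matrix (Fin m) (Fin m) (G.K s0) :=
    fun β => ∑ a, (U β a * μ) • EE (G.K s0) (tw a)
  let Dl : Mon k m d → Matrix (Fin k) (Fin m) F → Matrix (Fin k) (Fin m) F :=
    fun a w => w.map (G.Δ.d (G.t a)) + (μ : F) • (w * EE F (tw a))
  have hkey : ∀ β w, twD (G.dU U β) (v β) w = ∑ a, (U β a : F) • Dl a w := by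
    intro β w
    have h1 : w.map (G.dU U β) = ∑ a, (U β a : F) • w.map (G.Δ.d (G.t a)) := by
      ext i j
      simp [Matrix.sum_apply, G.dU_apply]
    have h2 : (v β).map (algebraMap (G.K s0) F) = ∑ a, ((U β a : F) * μ) • EE F (tw a) := by
      have e : ∀ a, EE F (tw a) = (EE (G.K s0) (tw a)).map (algebraMap (G.K s0) F) :=
        fun a => (EE_map _ _).symm
      simp only [e]
      ext i j
      simp only [v, Matrix.map_apply, Matrix.sum_apply, Matrix.smul_apply, smul_eq_mul, map_sum, map_mul,
        map_natCast]
      rfl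
    rw [twD, h1, h2, Matrix.mul_sum, ← Finset.sum_add_distrib]
    refine Finset.sum_congr rfl fun a _ => ?_
    simp only [Dl]
    rw [Matrix.mul_smul, smul_add, smul_smul]
  refine ⟨U, v, ?_, ?_⟩
  · intro w hw β
    have h1 : ∀ a, xi G.g w (Dl a w) = - ∑ γ, (V a γ : F) * mv (pl w) γ.1 := by
      intro a
      have h2 : eval (pl w) (hE G.g (tw a)) = ∑ γ, (N a γ : F) * mv (pl w) γ.1 :=
        Su.eval_hom _ (hE_hom G.g hd G.hg _) _
      have h3 : mv (pl w) a.1 = ∑ γ, ((1 : Matrix (Mon k m d) (Mon k m d) F) a γ) * mv (pl w) γ.1 := by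
        simp [Matrix.one_apply]
      have h4 : ∀ γ, (V a γ : F) = (1 : Matrix (Mon k m d) (Mon k m d) F) a γ - μ * (N a γ : F) := by
        intro γ
        simp only [V, Matrix.sub_apply, Matrix.smul_apply, smul_eq_mul, Matrix.one_apply]
        split_ifs <;> simp
      simp only [Dl]
      rw [map_add, map_smul, G.xi_t w hw.2, xi_EE, h2, h3]
      simp only [h4, sub_mul, Finset.sum_sub_distrib, Finset.mul_sum, smul_eq_mul, mul_assoc]
      ring
    rw [hkey, map_sum]
    simp only [map_smul, h1, smul_eq_mul, mul_neg, Finset.sum_neg_distrib, Finset.mul_sum]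
    rw [Finset.sum_comm]
    congr 1
    have h5 : ∀ γ, ∑ a, (U β a : F) * ((V a γ : F) * mv (pl w) γ.1)
        = ((1 : Matrix (Mon k m d) (Mon k m d) (G.K s0)) β γ : F) * mv (pl w) γ.1 := by
      intro γ
      rw [← hUV, Matrix.mul_apply]
      push_cast
      rw [Finset.sum_mul]
      exact Finset.sum_congr rfl fun a _ => by ring
    simp only [h5]
    rw [Finset.sum_eq_single β]
    · simp
    · intro γ _ hγ; rw [one_apply_ne hγ.symm]; simp
    · simp
  · intro u
    have hDl : ∀ a, Dl a w = ∑ β, (V a β : F) • twD (G.dU U β) (v β) w := by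
      intro a
      simp only [hkey, Finset.smul_sum, smul_smul]
      rw [Finset.sum_comm]
      have h5 : ∀ γ, ∑ β, ((V a β : F) * (U β γ : F)) • Dl γ w
          = ((1 : Matrix (Mon k m d) (Mon k m d) (G.K s0)) a γ : F) • Dl γ w := by
        intro γ
        rw [← hVU, Matrix.mul_apply]
        push_cast
        rw [Finset.sum_smul]
      simp only [h5]
      rw [Finset.sum_eq_single a]
      · simp
      · intro γ _ hγ; rw [one_apply_ne hγ.symm]; simp
      · simp
    have hwA : ∀ i b, w i (en A b) = (1 : Matrix (Fin k) (Fin k) F) i b := fun i b =>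
      congrFun (congrFun hw i) b
    let B := cs u A
    let u' := u - B * w
    have hu' : ∀ i b, u' i (en A b) = 0 := by
      intro i b
      have : cs (B * w) A = B := by rw [cs_mul, hw, Matrix.mul_one]
      have := congrFun (congrFun this i) b
      change u i (en A b) - (B * w) i (en A b) = 0
      exact sub_eq_zero.2 this.symm
    let x : Fin k × {j : Fin m // j ∉ Set.range (en A)} → F := fun q => u' q.1 q.2.1
    let y := x ᵥ* (M + (μ : F) • (1 : Matrix _ _ F))⁻¹
    have hy : y ᵥ* (M + (μ : F) • (1 : Matrix _ _ F)) = x := by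
      simp only [y]
      rw [Matrix.vecMul_vecMul, nonsing_inv_mul _ hM, Matrix.vecMul_one]
    have hent : ∀ q i j, (w * EE F (tw (α q))) i j = if q.2.1 = j then w i (en A q.1) else 0 := by
      intro q i j
      rw [htw]
      simp only [EE, Matrix.mul_apply, Matrix.single_apply]
      split_ifs with h
      · rw [Finset.sum_eq_single (en A q.1)]
        · simp [h]
        · intro b _ hb; simp [hb.symm]
        · simp
      · exact Finset.sum_eq_zero fun b _ => by simp [h]
    have hsum : u' = ∑ q, y q • Dl (α q) w := by
      ext i j
      rw [Matrix.sum_apply]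
      simp only [Dl, Matrix.smul_apply, Matrix.add_apply, Matrix.map_apply, hent, smul_eq_mul]
      by_cases hj : j ∈ Set.range (en A)
      · obtain ⟨b, rfl⟩ := hj
        rw [hu']
        symm
        refine Finset.sum_eq_zero fun q _ => ?_
        have e1 : q.2.1 ≠ en A b := fun h => q.2.2 ⟨b, h.symm⟩
        rw [if_neg e1, hwA, Matrix.one_apply]
        split_ifs <;> simp
      · have := congrFun hy (i, ⟨j, hj⟩)
        simp only [vecMul, dotProduct, Matrix.add_apply, Matrix.smul_apply, M, Matrix.of_apply,
          smul_eq_mul] at this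
        change x (i, ⟨j, hj⟩) = _
        rw [← this]
        refine Finset.sum_congr rfl fun q _ => ?_
        congr 3
        rw [Matrix.one_apply]
        by_cases h : q.2.1 = j
        · rw [if_pos h, hwA, Matrix.one_apply]
          congr 1
          simp only [eq_iff_iff]
          constructor
          · rintro rfl; rfl
          · rintro rfl; exact Prod.ext rfl (Subtype.ext h)
        · rw [if_neg h, if_neg]
          rintro rfl; exact h rfl
    refine ⟨fun β => ∑ q, y q * V (α q) β, B, ?_⟩
    have : u = u' + B * w := by simp only [u']; abel
    rw [this, hsum]
    congr 1
    simp only [hDl, Finset.smul_sum, smul_smul, Finset.sum_smul]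
    rw [Finset.sum_comm]
end
end Irr
end

section
open Matrix MvPolynomial
namespace Irr

section
variable {k m : ℕ} {F : Type*} [Field F] [CharZero F] {I : Type*} {d n : ℕ}

/-- multiply by a variable -/
noncomputable def mkMon (hd : 0 < d) (b : PluckIdx k m) (P : Mon k m (d - 1)) : Mon k m d :=
  ⟨Finsupp.single b 1 + P.1, by
    have := P.2
    simp only [Finsupp.add_apply, Finset.sum_add_distrib, this]
    simp [Finsupp.single_apply]; omega⟩

/-- row coefficients -/
noncomputable def rc (K : Type*) [Field K] (hd : 0 < d) (A : PluckIdx k m) (z : PluckIdx k m × Mon k m (d - 1))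
    (β : Mon k m d) : MvPolynomial (PluckIdx k m) K :=
  (if β = mkMon hd z.1 z.2 then X A else 0) - (if β = mkMon hd A z.2 then X z.1 else 0)

lemma rc_hom (K : Type*) [Field K] (hd : 0 < d) (A : PluckIdx k m) (z : PluckIdx k m × Mon k m (d - 1))
    (β : Mon k m d) : (rc K hd A z β).IsHomogeneous 1 := by
  rw [rc]
  refine IsHomogeneous.sub ?_ ?_ <;> split_ifs
  · exact isHomogeneous_X _ _
  · exact isHomogeneous_zero _ _ _
  · exact isHomogeneous_X _ _
  · exact isHomogeneous_zero _ _ _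

lemma rc_sum {K : Type*} [Field K] [Algebra K F] {V : Type*} [AddCommGroup V] [Module F V]
    (hd : 0 < d) (A : PluckIdx k m) (z : PluckIdx k m × Mon k m (d - 1))
    (x : PluckIdx k m → F) (T : Mon k m d → V) :
    ∑ β, aeval x (rc K hd A z β) • T β = x A • T (mkMon hd z.1 z.2) - x z.1 • T (mkMon hd A z.2) := by
  simp only [rc, map_sub, sub_smul, Finset.sum_sub_distrib]
  congr 1
  · rw [Finset.sum_eq_single (mkMon hd z.1 z.2)]
    · simp
    · intro b _ hb; simp [hb]
    · simp
  · rw [Finset.sum_eq_single (mkMon hd A z.2)]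
    · simp
    · intro b _ hb; simp [hb]
    · simp

lemma rc_zero {K : Type*} [Field K] [Algebra K F]
    (hd : 0 < d) (A : PluckIdx k m) (z : PluckIdx k m × Mon k m (d - 1))
    (x : PluckIdx k m → F) : ∑ β, aeval x (rc K hd A z β) * mv x β.1 = 0 := by
  have := rc_sum (K := K) hd A z x (fun β => mv x β.1)
  simp only [smul_eq_mul] at this
  rw [this]
  simp only [mkMon, mv_add, mv_single]
  ring

lemma span_rows {V : Type*} [AddCommGroup V] [Module F V] (hd : 0 < d) (A : PluckIdx k m)
    (x : PluckIdx k m → F) (T : Mon k m d → V) (S : Submodule F V) (h0 : T (powMon d A) ∈ S)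
    (h : ∀ z : PluckIdx k m × Mon k m (d - 1), T (mkMon hd z.1 z.2) - x z.1 • T (mkMon hd A z.2) ∈ S) :
    ∀ β, T β ∈ S := by
  have key : ∀ (l : ℕ) (β : Mon k m d), d ≤ β.1 A + l → T β ∈ S := by
    intro l
    induction l with
    | zero =>
      intro β hβ
      have hs := β.2
      rw [← Finset.add_sum_erase _ _ (Finset.mem_univ A)] at hs
      have h2 : ∑ i ∈ Finset.univ.erase A, β.1 i = 0 := by omega
      rw [Finset.sum_eq_zero_iff] at h2
      have : β = powMon d A := by
        apply Subtype.ext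
        ext i
        simp only [powMon, Finsupp.single_apply]
        split_ifs with hi
        · subst hi; omega
        · exact h2 i (by simp [Ne.symm hi])
      rw [this]; exact h0
    | succ l ih =>
      intro β hβ
      by_cases hb : d ≤ β.1 A + l
      · exact ih β hb
      have : ∃ b, b ≠ A ∧ β.1 b ≠ 0 := by
        by_contra hcon
        push Not at hcon
        have hs := β.2
        rw [Finset.sum_eq_single A (fun b _ hb => hcon b hb) (by simp)] at hs
        omega
      obtain ⟨b, hbA, hb0⟩ := this
      have hle : Finsupp.single b 1 ≤ β.1 := by
        rw [Finsupp.single_le_iff]; omega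
      have hβ' : Finsupp.single b 1 + (β.1 - Finsupp.single b 1) = β.1 := add_tsub_cancel_of_le hle
      let P : Mon k m (d - 1) := ⟨β.1 - Finsupp.single b 1, by
        have := β.2
        rw [← hβ'] at this
        simp only [Finsupp.add_apply, Finset.sum_add_distrib] at this
        simp [Finsupp.single_apply] at this ⊢
        omega⟩
      have e1 : mkMon hd b P = β := Subtype.ext hβ'
      have h1 := h (b, P)
      simp only [e1] at h1
      have h2 := ih (mkMon hd A P) (by
        simp [mkMon, P, Finsupp.single_apply, hbA]; omega)
      have := S.add_mem h1 (S.smul_mem (x b) h2)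
      simpa using this
  exact fun β => key d β (by omega)

namespace Ln
variable {G : Lo F I k m d n} (E : Ln G)

lemma indep_u (w : Matrix (Fin k) (Fin m) F) (A : PluckIdx k m) (hw : cs w A = 1) (hP : G.P w)
    (T0 : Matrix (Fin k) (Fin m) F) (hT : xi G.g w T0 = -1) {e : ℕ} (y : Fin e → Fin n)
    (hy : LinearIndependent F (fun j => w.map (G.Δ.d (G.η (y j).succ)))) :
    LinearIndependent F (Sum.elim (fun o : Option (Fin e) => o.elim T0
      (fun j => w.map (G.Δ.d (G.η (y j).succ)))) (Ew w)) := by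
  rw [Fintype.linearIndependent_iff]
  intro c hc
  rw [Fintype.sum_sum_type, Fintype.sum_option] at hc
  simp only [Sum.elim_inl, Sum.elim_inr, Option.elim] at hc
  let B : Matrix (Fin k) (Fin k) F := of fun a b => c (Sum.inr (a, b))
  have hB : ∑ ab, c (Sum.inr ab) • Ew w ab = B * w := by
    rw [mul_eq_sum_Ew]; rfl
  rw [hB] at hc
  have h0 : c (Sum.inl none) = 0 := by
    have := congrArg (xi G.g w) hc
    rw [map_add, map_add, map_smul, hT, G.xi_Bw w hP, map_sum, Finset.sum_eq_zero] at this
    · simpa using this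
    · intro j _
      rw [map_smul, G.xi_d w hP.2 _ (G.η_t _), smul_zero]
  rw [h0, zero_smul, zero_add] at hc
  have hB0 : B = 0 := by
    have h1 : cs (∑ j, c (Sum.inl (some j)) • w.map (G.Δ.d (G.η (y j).succ)) + B * w) A = 0 := by
      rw [hc]; rfl
    ext a b
    have h2 := congrFun (congrFun h1 a) b
    have h3 : cs (B * w) A = B := by rw [cs_mul, hw, Matrix.mul_one]
    have h4 : (B * w) a (en A b) = B a b := congrFun (congrFun h3 a) b
    have h5 : w a (en A b) = (1 : Matrix (Fin k) (Fin k) F) a b := congrFun (congrFun hw a) b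
    simp only [cs, submatrix_apply, id, Matrix.add_apply, Matrix.sum_apply, Matrix.smul_apply,
      Matrix.map_apply, h4, h5] at h2
    rw [Finset.sum_eq_zero, zero_add] at h2
    · exact h2
    · intro j _
      rw [Matrix.one_apply]; split_ifs <;> simp
  rw [hB0, Matrix.zero_mul, add_zero] at hc
  have h2 := Fintype.linearIndependent_iff.1 hy _ hc
  rintro ((_ | j) | ⟨a, b⟩)
  · exact h0
  · exact h2 j
  · exact congrFun (congrFun hB0 a) b

end Ln
end
end Irr
end

section
open Matrix MvPolynomial
namespace Irr

section
variable {k m : ℕ} {F : Type*} [Field F] [CharZero F] {I : Type*} {d n : ℕ}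

namespace Ln
variable {G : Lo F I k m d n}

/-- degree count for the auxiliary polynomial -/
lemma exists_f {ι : Type*} [Fintype ι] [DecidableEq ι] (T : Finset (ι → F)) (p : ι → F)
    (hsep : ∀ q ∈ T, q ≠ p → ∀ c : F, p ≠ c • q) (A : ι) (hA : p A ≠ 0) (r : ℕ)
    (hp : p ∈ T) (hr : T.card ≤ r + 1) :
    ∃ f : MvPolynomial ι F, f.IsHomogeneous r ∧ eval p f ≠ 0 ∧ ∀ q ∈ T, q ≠ p → eval q f = 0 := by
  classical
  have : ∀ q, ∃ a : Module.Dual F (ι → F), (q ∈ T → q ≠ p → a q = 0) ∧ a p ≠ 0 := by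
    intro q
    by_cases h : q ∈ T ∧ q ≠ p
    · obtain ⟨a, h1, h2⟩ := exists_dual_sep (Submodule.span F {q}) p (by
        intro h'
        obtain ⟨c, hc⟩ := Submodule.mem_span_singleton.1 h'
        exact hsep q h.1 h.2 c hc.symm)
      exact ⟨a, fun _ _ => h1 _ (Submodule.mem_span_singleton_self _), h2⟩
    · exact ⟨LinearMap.proj A, fun h1 h2 => absurd ⟨h1, h2⟩ h, hA⟩
  choose a ha1 ha2 using this
  obtain ⟨f, hf, hf'⟩ := exists_poly_list
    ((T.erase p).toList.map a ++ List.replicate (r - (T.erase p).card) (LinearMap.proj A))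
  refine ⟨f, ?_, ?_, ?_⟩
  · convert hf using 1
    simp only [List.length_append, List.length_map, Finset.length_toList, List.length_replicate]
    rw [Finset.card_erase_of_mem hp]; omega
  · rw [hf']
    refine List.prod_ne_zero ?_
    intro h0
    simp only [List.map_append, List.map_map, List.map_replicate, List.mem_append, List.mem_map,
      List.mem_replicate, Function.comp] at h0
    rcases h0 with ⟨q, -, h⟩ | ⟨-, h⟩
    · exact ha2 q h
    · exact hA h.symm
  · intro q hq hne
    rw [hf']
    apply List.prod_eq_zero
    simp only [List.map_append, List.map_map, List.map_replicate, List.mem_append, List.mem_map,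
      Function.comp]
    left
    exact ⟨q, by simp [hq, hne], ha1 q hq hne⟩

lemma false_of (E : Ln G) [IsAlgClosed F] [Infinite I] : False := by
  classical
  obtain ⟨T, hTne, hTR, hTinj, hTall, hTcard⟩ := E.exists_T
  have hTm : T.card + 2 ≤ m := by have := E.card_ge; omega
  have hd0 : 0 < d := by have := E.hd; have := E.hkm; have := E.hk; omega
  choose w' A hwA c hc0 hxc using fun x : T => E.lift x.1 (hTR _ x.2).W (hTR _ x.2).ne
  have hP : ∀ x, G.P (w' x) := by
    intro x
    refine ⟨fun h => (hTR _ x.2).ne (by rw [hxc, h, smul_zero]), ?_⟩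
    have := (hTR _ x.2).g
    rw [hxc, eval_smul_hom _ G.hg] at this
    exact (mul_eq_zero.1 this).resolve_left (pow_ne_zero _ (hc0 x))
  have hWw : ∀ x, pl (w' x) ∈ E.W := by
    intro x
    have h1 : pl (w' x) = (c x)⁻¹ • x.1 := by
      rw [hxc x, smul_smul, inv_mul_cancel₀ (hc0 x), one_smul]
    rw [h1]
    exact E.W.smul_mem _ (hTR _ x.2).W
  have hinj : ∀ x x' (a : F), pl (w' x) = a • pl (w' x') → x = x' := by
    intro x x' a h
    apply Subtype.ext
    refine hTinj _ x.2 _ x'.2 (c x * a * (c x')⁻¹) ?_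
    rw [hxc x, hxc x', h, smul_smul, smul_smul, mul_assoc (c x * a), inv_mul_cancel₀ (hc0 x'), mul_one]
  obtain ⟨p0, hp0⟩ := hTne
  let p : T := ⟨p0, hp0⟩
  have hA1 : ∀ x, pl (w' x) (A x) = 1 := fun x => pl_one (hwA x)
  obtain ⟨e0, y, hy, he, hyl⟩ := E.exists_Y (A p) (w' p) (hwA p) (hWw p)
  have hn := G.hn
  have hnk : m ≤ n + 1 := by
    obtain ⟨k', rfl⟩ := Nat.exists_eq_add_of_le E.hk
    obtain ⟨m', rfl⟩ := Nat.exists_eq_add_of_le E.hkm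
    have : 2 + k' + 2 + m' - (2 + k') = 2 + m' := by omega
    rw [hn, this]
    ring_nf; nlinarith [Nat.zero_le (k' * m')]
  have hen : e0 ≤ n := by
    have := Fintype.card_le_of_injective y hy
    simpa using this
  obtain ⟨e, rfl⟩ : ∃ e, e0 = e + 1 := ⟨e0 - 1, by omega⟩
  let s0 := G.η (y 0).succ
  obtain ⟨U, v, hUv, hsp⟩ := exists_twist G.toSu hd0 s0 (G.η_t _) (A p) (w' p) (hwA p)
  let Tw : Mon k m d → Matrix (Fin k) (Fin m) F := fun β => twD (G.dU U β) (v β) (w' p)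
  let u : Option (Fin (e + 1)) ⊕ (Fin k × Fin k) → Matrix (Fin k) (Fin m) F :=
    Sum.elim (fun o => o.elim (Tw (powMon d (A p)))
      (fun j => (w' p).map (G.Δ.d (G.η (y j).succ)))) (Ew (w' p))
  have hu : LinearIndependent F u := by
    apply Ln.indep_u (w' p) (A p) (hwA p) (hP p) _ _ y hyl
    simp only [Tw]
    rw [hUv _ (hP p), powMon, mv_single, hA1, one_pow]
  let ρ : PluckIdx k m × Mon k m (d - 1) → Matrix (Fin k) (Fin m) F := fun z =>
    ∑ β, aeval (pl (w' p)) (rc (G.K s0) hd0 (A p) z β) • Tw β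
  have hkm' : k * m = n + 1 + k * k := by
    rw [hn, ← mul_add, Nat.sub_add_cancel (by have := E.hkm; omega)]
  have hs : Submodule.span F (Set.range u) ⊔ Submodule.span F (Set.range ρ) = ⊤ := by
    rw [eq_top_iff]
    rintro x -
    obtain ⟨a, B, hx⟩ := hsp x
    set S := Submodule.span F (Set.range u) ⊔ Submodule.span F (Set.range ρ) with hS
    have hu' : ∀ o, u o ∈ S := fun o => Submodule.mem_sup_left (Submodule.subset_span ⟨o, rfl⟩)
    have hT : ∀ β, Tw β ∈ S := by
      apply span_rows hd0 (A p) (pl (w' p)) Tw S (hu' (Sum.inl none))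
      intro z
      have : ρ z ∈ S := Submodule.mem_sup_right (Submodule.subset_span ⟨z, rfl⟩)
      simp only [ρ] at this
      rw [rc_sum, hA1, one_smul] at this
      exact this
    rw [hx, mul_eq_sum_Ew]
    exact S.add_mem (S.sum_mem fun β _ => S.smul_mem _ (hT β))
      (S.sum_mem fun ab _ => S.smul_mem _ (hu' (Sum.inr ab)))
  obtain ⟨z, hz⟩ := exists_compl u hu ρ hs (n - (e + 1)) (by
    simp only [Fintype.card_sum, Fintype.card_option, Fintype.card_prod, Fintype.card_fin,
      Module.finrank_matrix, Module.finrank_self, mul_one]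
    omega)
  obtain ⟨eq⟩ := exists_e (k := k) (m := m) (Fin e) (Fin (n - (e + 1))) (by have := E.hkm; omega) (by
    rw [← hn, Fintype.card_fin, Fintype.card_fin]; omega)
  have hdd := E.hd
  have hm4 : 4 ≤ m := by have := E.hkm; have := E.hk; omega
  have hηs : ∀ j : Fin e, G.η (y j.succ).succ ≠ s0 := fun j h =>
    Fin.succ_ne_zero j (hy (Fin.succ_injective _ (G.η_inj h)))
  let N := G.mkN s0 (G.η_t _) (fun j : Fin e => G.η (y j.succ).succ) (fun j => G.η_t _) hηs U v hUv
    (fun i => rc (G.K s0) hd0 (A p) (z i)) (fun i => rc_hom _ _ _ _) (fun i => rc_zero _ _ _)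
    (d - m - (n - (e + 1))) (by rw [Fintype.card_fin]; omega) eq (G.alg _)
  haveI : IsAlgClosed (G.K s0) := isAlgClosed_Dconst _
  obtain ⟨f, hf, hfp, hfq⟩ := exists_f T p.1
    (fun q hq hne c hcq => hne (hTinj _ p.2 _ hq c hcq).symm) (A p)
    (by rw [hxc p, Pi.smul_apply, hA1]; simpa using hc0 p) (d - m - (n - (e + 1))) p.2 (by omega)
  have hfz : ∀ x, eval x.1 f = c x ^ (d - m - (n - (e + 1))) * eval (pl (w' x)) f := by
    intro x
    conv_lhs => rw [hxc x]
    rw [eval_smul_hom f hf]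
  have h1 := N.null_trace' f hf w' hP A (fun x => by rw [hA1]; exact one_ne_zero)
    (fun σ => galois_perm σ.toRingEquiv w' (fun x => (hP x).1) hinj (by
      intro x
      obtain ⟨x', hx', a, ha⟩ := hTall _ (E.Rs_map σ.toRingEquiv (G.fx_of (y 0) σ) _ (hTR _ x.2))
      refine ⟨⟨x', hx'⟩, (σ (c x))⁻¹ * a * c ⟨x', hx'⟩, ?_⟩
      have h2 := hxc ⟨x', hx'⟩
      have h3 := hxc x
      have h4 : σ (c x) ≠ 0 := by simpa using hc0 x
      ext S
      have h5 := congrFun ha S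
      have h6 := congrFun h3 S
      have h7 := congrFun h2 S
      simp only [Pi.smul_apply, smul_eq_mul] at h5 h6 h7 ⊢
      rw [h6, h7] at h5
      have h8 : σ (c x) * σ (pl (w' x) S) = a * (c ⟨x', hx'⟩ * pl (w' ⟨x', hx'⟩) S) := by
        rw [← h5, ← map_mul]; rfl
      change σ (pl (w' x) S) = _
      field_simp
      linear_combination h8))
  rw [Finset.sum_eq_single p] at h1
  · rw [mul_eq_zero] at h1
    rcases h1 with h1 | h1
    · exact hfp (by rw [hfz, h1, mul_zero])
    · rw [NTD.tau, div_eq_zero_iff] at h1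
      rcases h1 with h1 | h1
      swap
      · rw [hA1, one_pow] at h1; exact one_ne_zero h1
      revert h1
      refine Om_ne_zero _ _ _ fun a B hcB => ?_
      rw [Fintype.linearIndependent_iff] at hz
      have h2 := hz (Sum.elim (Sum.elim (fun o => o.elim (a none)
        (Fin.cons (a (some none)) (fun j => a (some (some (Sum.inl j)))))) (fun ab => B ab.1 ab.2))
        (fun i => a (some (some (Sum.inr i))))) (by
          rw [← hcB, mul_eq_sum_Ew, Fintype.sum_option, Fintype.sum_option, Fintype.sum_sum_type,
            Fintype.sum_sum_type, Fintype.sum_sum_type, Fintype.sum_option, Fin.sum_univ_succ]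
          have hY : ∀ j, N.row (A p) (w' p) (some (some (Sum.inl j)))
            = (w' p).map (G.Δ.d (G.η (y j.succ).succ)) := fun j => G.row_Y _ _ _ _ _ _ _ _ _ _ _ _ _ _ _ _ _ _
          have hZ : ∀ i, N.row (A p) (w' p) (some (some (Sum.inr i))) = ρ (z i) :=
            fun i => G.row_Z _ _ _ _ _ _ _ _ _ _ _ _ _ _ _ _ _ _
          have h00 : N.row (A p) (w' p) none = Tw (powMon d (A p)) := rfl
          have h01 : N.row (A p) (w' p) (some none) = (w' p).map (G.Δ.d s0) := rfl
          simp only [hY, hZ, h00, h01, u, Sum.elim_inl, Sum.elim_inr, Option.elim, Fin.cons_zero,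
            Fin.cons_succ, Function.comp]
          abel)
      refine ⟨?_, ?_⟩
      · ext o
        rcases o with _ | _ | j | i
        · exact h2 (Sum.inl (Sum.inl none))
        · exact h2 (Sum.inl (Sum.inl (some 0)))
        · exact h2 (Sum.inl (Sum.inl (some j.succ)))
        · exact h2 (Sum.inr i)
      · ext i j
        exact h2 (Sum.inl (Sum.inr (i, j)))
  · intro x _ hx
    have h2 := hfq x.1 x.2 (fun h => hx (Subtype.ext h))
    rw [hfz] at h2
    rw [(mul_eq_zero.1 h2).resolve_left (pow_ne_zero _ (hc0 x)), zero_mul]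
  · simp
end Ln

lemma Lo.false_of [IsAlgClosed F] [Infinite I] (G : Lo F I k m d n) (hk : 2 ≤ k) (hkm : k + 2 ≤ m)
    (hd : 3 * m ≤ d + 5) : False := by
  obtain ⟨E⟩ := exists_Ln G hk hkm hd
  exact E.false_of
end
end Irr
end

section
open Matrix MvPolynomial
namespace Irr

section
variable {k m : ℕ} {d n : ℕ}

lemma generic_ne {F : Type*} [Field F] [CharZero F] {I : Type*} (Δ : DB F I) {ι : Type*} [Fintype ι]
    (η : ι → I) (hη : Function.Injective η) (e : ℕ) : ∀ q : MvPolynomial ι F, q.IsHomogeneous e →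
    (∀ l α, Δ.d (η l) (coeff α q) = 0) → eval (fun l => Δ.b (η l)) q = 0 → q = 0 := by
  classical
  induction e with
  | zero =>
    intro q hq _ h0
    obtain ⟨c, rfl⟩ : ∃ c, q = C c :=
      ⟨_, totalDegree_eq_zero_iff_eq_C.1 ((totalDegree_zero_iff_isHomogeneous _).2 hq)⟩
    rw [eval_C] at h0
    rw [h0, map_zero]
  | succ e ih =>
    intro q hq hc h0
    have h1 : ∀ l, pderiv l q = 0 := by
      intro l
      refine ih _ (by simpa using hq.pderiv) ?_ ?_
      · intro l' α
        rw [coeff_pderiv, Derivation.leibniz, hc, smul_zero, add_zero]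
        have : Δ.d (η l') (((α l : ℕ) : F) + 1) = 0 := by
          rw [← Nat.cast_succ]; exact Derivation.map_natCast _ _
        rw [this, smul_zero]
      · have := der_eval (Δ.d (η l)) (fun l => Δ.b (η l)) q _ (Finset.Subset.refl _)
        rw [h0, map_zero, Finset.sum_eq_zero (fun β _ => by rw [hc, zero_mul]), zero_add,
          Finset.sum_eq_single l] at this
        · rw [Δ.d_self, mul_one] at this; exact this.symm
        · intro i _ hi
          rw [Δ.d_ne _ _ fun h => hi (hη h).symm, mul_zero]
        · simp
    have h2 := hq.sum_X_mul_pderiv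
    simp only [h1, mul_zero, Finset.sum_const_zero] at h2
    have := h2.symm
    rw [nsmul_eq_mul, mul_eq_zero] at this
    rcases this with h | h
    · exfalso
      have h3 := congrArg (eval (0 : ι → F)) h
      rw [map_natCast, map_zero] at h3
      exact Nat.cast_ne_zero.2 (Nat.succ_ne_zero e) h3
    · exact h

lemma exists_η {I : Type*} [Infinite I] (B : Set I) (hB : B.Finite) (n : ℕ) :
    ∃ η : Fin n → I, Function.Injective η ∧ ∀ l, η l ∉ B := by
  haveI : Infinite ↥(Bᶜ) := hB.infinite_compl.to_subtype
  let f := Infinite.natEmbedding ↥(Bᶜ)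
  exact ⟨fun l => (f l.1).1, fun a b h => Fin.ext (f.injective (Subtype.ext h)), fun l => (f l.1).2⟩

lemma bad_finite {I : Type*} (Δ : DB ℂ I) {ι : Type*} (p : MvPolynomial ι ℂ) :
    {i | ∃ α, Δ.d i (coeff α p) ≠ 0}.Finite := by
  refine Set.Finite.subset (p.support.finite_toSet.biUnion
    (t := fun α => {i | Δ.d i (coeff α p) ≠ 0}) fun α _ => Δ.finite_supp _) ?_
  rintro i ⟨α, h⟩
  refine Set.mem_biUnion (x := α) ?_ h
  rw [Finset.mem_coe, mem_support_iff]
  intro h0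
  rw [h0] at h
  exact h (map_zero _)

lemma no_small (g : MvPolynomial (PluckIdx k m) ℂ) (hg : g.IsHomogeneous d)
    (hai : AlgebraicIndependent ℚ (fun α : Mon k m d => coeff α.1 g))
    (hk : 2 ≤ k) (hkm : k + 2 ≤ m) (hd : 3 * m ≤ d + 5) (hn : n + 1 = k * (m - k))
    (φ : RatMapTo (PluckIdx k m) n) (δ : ℕ) (hδ : δ < d)
    (h : φ.DominantOfDegree (GrassSet k m ∩ ZeroSet g) δ) : False := by
  classical
  obtain ⟨hδ0, V, ⟨Y, ⟨fs, hfs, rfl⟩, hY, hYV⟩, hV⟩ := h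
  obtain ⟨s, hsub, hs⟩ := exists_isTranscendenceBasis_superset hai.coe_range
  haveI : Infinite s := by
    rw [Cardinal.infinite_iff]
    have := IsAlgClosed.cardinal_eq_cardinal_transcendence_basis_of_aleph0_lt' _ hs (by simp) (by
      rw [Cardinal.mk_complex]; exact Cardinal.aleph0_lt_continuum)
    rw [← this, Cardinal.mk_complex]
    exact Cardinal.aleph0_le_continuum
  obtain ⟨Δ, hΔ⟩ := exists_DB _ hs
  let t : Mon k m d → s := fun α => ⟨coeff α.1 g, hsub ⟨α, rfl⟩⟩
  have t_inj : Function.Injective t := fun a b h => hai.injective (congrArg Subtype.val h)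
  obtain ⟨x0, -, hx0⟩ := Set.not_subset.1 hY
  simp only [Set.mem_setOf_eq, not_forall] at hx0
  obtain ⟨q, hq, hqx⟩ := hx0
  obtain ⟨eq, hqe⟩ := hfs q hq
  have hq0 : q ≠ 0 := by
    rintro rfl
    exact hqx (fun v hv _ => map_zero _)
  obtain ⟨η, η_inj, hη⟩ := exists_η (Set.range t ∪ ({i | ∃ α, Δ.d i (coeff α q) ≠ 0} ∪
    ⋃ l, {i | ∃ α, Δ.d i (coeff α (φ.F l)) ≠ 0}))
    ((Set.finite_range t).union ((bad_finite Δ q).union (Set.finite_iUnion fun l => bad_finite Δ _))) (n + 1)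
  simp only [Set.mem_union, not_or, Set.mem_iUnion, not_exists, Set.mem_setOf_eq, not_not] at hη
  let y : Fin (n + 1) → ℂ := fun l => Δ.b (η l)
  have hqy : eval y q ≠ 0 := fun h0 => hq0 (generic_ne Δ η η_inj eq q hqe (fun l α => (hη l).2.1 α) h0)
  have hy0 : y ≠ 0 := by
    intro h0
    have := Δ.d_self (η 0)
    have h1 : Δ.b (η 0) = 0 := congrFun h0 0
    rw [h1, map_zero] at this
    exact zero_ne_one this
  have hyV : Projectivization.mk ℂ y hy0 ∈ V := by
    apply hYV
    refine ⟨trivial, fun h0 => ?_⟩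
    exact hqy (h0 q hq y hy0 rfl)
  obtain ⟨hfin, hcard⟩ := hV _ hyV
  set Fb := φ.fiber (GrassSet k m ∩ ZeroSet g) (Projectivization.mk ℂ y hy0) with hFb
  have hmem : ∀ θ : Fb, ∃ (w : Matrix (Fin k) (Fin m) ℂ) (hw : pl w ≠ 0),
      Projectivization.mk ℂ (pl w) hw = θ.1 ∧ eval (pl w) g = 0 ∧
      ∃ a : ℂ, a ≠ 0 ∧ ∀ l, eval (pl w) (φ.F l) = a * y l := by
    rintro ⟨x, ⟨⟨w, hw, hwx⟩, hz⟩, hm⟩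
    refine ⟨w, hw, hwx, hz _ hw hwx, ?_⟩
    obtain ⟨hv, he⟩ := hm _ hw hwx
    rw [Projectivization.mk_eq_mk_iff'] at he
    obtain ⟨a, ha⟩ := he
    refine ⟨a, ?_, fun l => (congrFun ha l).symm⟩
    rintro rfl
    rw [zero_smul] at ha
    exact hv ha.symm
  choose w hw0 hwx hwg lam hlam hwφ using hmem
  haveI : Fintype Fb := hfin.fintype
  have hc : Fintype.card Fb = δ := by
    rw [← hcard, ← Nat.card_coe_set_eq, Nat.card_eq_fintype_card]
  let L : Lo ℂ s k m d n :=
  { Δ := Δ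
    g := g
    hg := hg
    t := t
    t_inj := t_inj
    ht := fun α => by rw [hΔ]
    hn := hn
    φ := φ.F
    e := φ.e
    φ_hom := φ.homog
    η := η
    η_inj := η_inj
    η_t := fun l h => (hη l).1 h
    φ_d := fun l l' α => (hη l).2.2 l' α
    Θ := Fb
    fin := inferInstance
    ne := Fintype.card_pos_iff.1 (by omega)
    card_lt := by omega
    w := w
    w_P := fun θ => ⟨hw0 θ, hwg θ⟩
    lam := lam
    lam_ne := hlam
    w_φ := hwφ
    w_inj := by
      intro θ θ' c h
      apply Subtype.ext
      rw [← hwx θ, ← hwx θ', Projectivization.mk_eq_mk_iff']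
      exact ⟨c, h.symm⟩
    w_all := by
      intro w' hP l' hl' hφ
      have hin : Projectivization.mk ℂ (pl w') hP.1 ∈ Fb := by
        refine ⟨⟨⟨w', hP.1, rfl⟩, ?_⟩, ?_⟩
        · intro v hv hvx
          rw [Projectivization.mk_eq_mk_iff'] at hvx
          obtain ⟨a, rfl⟩ := hvx
          rw [eval_smul_hom g hg]
          rw [show eval (pl w') g = 0 from hP.2, mul_zero]
        · intro v hv hvx
          rw [Projectivization.mk_eq_mk_iff'] at hvx
          obtain ⟨a, rfl⟩ := hvx
          have ha : a ≠ 0 := by rintro rfl; simp at hv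
          have he : φ.evalVec (a • pl w') = (a ^ φ.e * l') • y := by
            ext l
            change eval _ (φ.F l) = a ^ φ.e * l' * y l
            rw [eval_smul_hom _ (φ.homog l), hφ, mul_assoc]
          have hne : φ.evalVec (a • pl w') ≠ 0 := by
            rw [he]; exact smul_ne_zero (mul_ne_zero (pow_ne_zero _ ha) hl') hy0
          refine ⟨hne, ?_⟩
          rw [Projectivization.mk_eq_mk_iff']
          exact ⟨_, he.symm⟩
      refine ⟨⟨_, hin⟩, ?_⟩
      have := hwx ⟨_, hin⟩
      rw [Projectivization.mk_eq_mk_iff'] at this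
      obtain ⟨a, ha⟩ := this
      have ha0 : a ≠ 0 := by
        rintro rfl
        rw [zero_smul] at ha
        exact hw0 _ ha.symm
      refine ⟨a⁻¹, ?_⟩
      rw [← ha, smul_smul, inv_mul_cancel₀ ha0, one_smul] }
  exact L.false_of hk hkm hd
end
end Irr
end

section
open Matrix MvPolynomial
namespace Irr

section
variable {k m : ℕ}

lemma exists_bad (k m d : ℕ) : ∃ B : ℕ → Set (MvPolynomial (PluckIdx k m) ℂ),
      (∀ i, CoeffPolyProperClosed d (B i)) ∧
      ∀ g : MvPolynomial (PluckIdx k m) ℂ, g ∉ ⋃ i, B i →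
        AlgebraicIndependent ℚ (fun α : Mon k m d => coeff α.1 g) := by
  classical
  let κ := Fintype.card (Mon k m d)
  let e : Fin κ ≃ Mon k m d := (Fintype.equivFin _).symm
  let S := {Q : MvPolynomial (Fin κ) ℚ // Q ≠ 0}
  haveI : Countable (MvPolynomial (Fin κ) ℚ) := by
    rw [← Cardinal.mk_le_aleph0_iff]
    exact MvPolynomial.cardinalMk_le_max.trans (by simp)
  haveI : Countable S := Subtype.countable
  haveI : Nonempty S := ⟨⟨1, one_ne_zero⟩⟩
  obtain ⟨f, hf⟩ := exists_surjective_nat S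
  let P : ℕ → MvPolynomial (Fin κ) ℂ := fun i => MvPolynomial.map (algebraMap ℚ ℂ) (f i).1
  refine ⟨fun i => {g | eval (fun j => coeff (e j).1 g) (P i) = 0}, ?_, ?_⟩
  · intro i
    refine ⟨κ, fun j => (e j).1, P i, fun g hg => hg, ?_⟩
    have hP : P i ≠ 0 := by
      intro h
      exact (f i).2 (MvPolynomial.map_injective _
        (algebraMap ℚ ℂ).injective (by rw [map_zero]; exact h))
    obtain ⟨x, hx⟩ : ∃ x, eval x (P i) ≠ 0 := by
      by_contra hcon
      push Not at hcon
      exact hP (MvPolynomial.funext fun x => by rw [hcon, map_zero])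
    refine ⟨∑ j, monomial (e j).1 (x j), ?_, ?_⟩
    · refine IsHomogeneous.sum _ _ _ fun j _ => isHomogeneous_monomial _ ?_
      rw [Finsupp.degree_eq_sum]; exact (e j).2
    · convert hx using 2
      have : (fun j => coeff (e j).1 (∑ j, monomial (e j).1 (x j))) = x := by
        ext j
        rw [coeff_sum, Finset.sum_eq_single j]
        · simp
        · intro b _ hb
          rw [coeff_monomial, if_neg]
          intro h
          exact hb (e.injective (Subtype.ext h))
        · simp
      rw [this]
  · intro g hg
    rw [← algebraicIndependent_equiv e, algebraicIndependent_iff]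
    intro Q hQ
    by_contra hne
    apply hg
    obtain ⟨i, hi⟩ := hf ⟨Q, hne⟩
    refine Set.mem_iUnion.2 ⟨i, ?_⟩
    change eval _ (MvPolynomial.map (algebraMap ℚ ℂ) (f i).1) = 0
    rw [hi, eval_map, ← aeval_def]
    exact hQ
end
end Irr
end

section
open Matrix MvPolynomial
namespace Irr

section
variable {k m : ℕ} {d n : ℕ}

lemma exists_scale (s : MvPolynomial (Fin (n+1)) ℂ) (e : ℕ) (y : Fin (n+1) → ℂ)
    (h : eval y (homogeneousComponent e s) ≠ 0) : ∃ c : ℂ, c ≠ 0 ∧ eval (c • y) s ≠ 0 := by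
  let P : Polynomial ℂ := ∑ i ∈ Finset.range (s.totalDegree + 1),
    Polynomial.monomial i (eval y (homogeneousComponent i s))
  have hP : ∀ c, P.eval c = eval (c • y) s := by
    intro c
    conv_rhs => rw [← sum_homogeneousComponent s]
    rw [map_sum, Polynomial.eval_finset_sum]
    refine Finset.sum_congr rfl fun i _ => ?_
    rw [eval_smul_hom _ (homogeneousComponent_isHomogeneous i s), Polynomial.eval_monomial, mul_comm]
  have he : e ∈ Finset.range (s.totalDegree + 1) := by
    rw [Finset.mem_range]
    by_contra hlt
    rw [homogeneousComponent_eq_zero _ _ (by omega), map_zero] at h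
    exact h rfl
  have hP0 : P * Polynomial.X ≠ 0 := by
    refine mul_ne_zero (fun h0 => h ?_) Polynomial.X_ne_zero
    have := congrArg (fun p => Polynomial.coeff p e) h0
    simpa [P, Polynomial.finset_sum_coeff, Polynomial.coeff_monomial, he] using this
  by_contra hc
  push Not at hc
  apply hP0
  apply Polynomial.funext
  intro c
  rw [Polynomial.eval_mul, Polynomial.eval_X, Polynomial.eval_zero, hP]
  by_cases h0 : c = 0
  · rw [h0, mul_zero]
  · rw [hc c h0, zero_mul]

lemma dense_of (s : MvPolynomial (Fin (n+1)) ℂ) (y0 : Fin (n+1) → ℂ) (hy0 : y0 ≠ 0)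
    (h : eval y0 s ≠ 0) (V : Set (PPt (Fin (n+1))))
    (hV : ∀ y hy, eval y s ≠ 0 → Projectivization.mk ℂ y hy ∈ V) :
    ContainsDenseOpenOf Set.univ V := by
  refine ⟨_, ⟨Set.range fun e => homogeneousComponent e s, ?_, rfl⟩, ?_, ?_⟩
  · rintro _ ⟨e, rfl⟩
    exact ⟨e, homogeneousComponent_isHomogeneous e s⟩
  · intro hs
    apply h
    rw [← sum_homogeneousComponent s, map_sum]
    exact Finset.sum_eq_zero fun e _ => hs (Set.mem_univ (Projectivization.mk ℂ y0 hy0)) _ ⟨e, rfl⟩ _ hy0 rfl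
  · rintro x ⟨-, hx⟩
    simp only [Set.mem_setOf_eq, not_forall, PVanish] at hx
    obtain ⟨_, ⟨e, rfl⟩, v, hv, rfl, hne⟩ := hx
    obtain ⟨c, hc, hcs⟩ := exists_scale s e v hne
    have := hV (c • v) (smul_ne_zero hc hv) hcs
    convert this using 1
    rw [Projectivization.mk_eq_mk_iff']
    exact ⟨c⁻¹, by rw [smul_smul, inv_mul_cancel₀ hc, one_smul]⟩

lemma card_roots_of (p : Polynomial ℂ) (hp : p.natDegree ≤ d) (hd : p.coeff d ≠ 0) :
    Polynomial.resultant p (Polynomial.derivative p) d (d-1) ≠ 0 ↔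
      ∀ z, p.eval z = 0 → (Polynomial.derivative p).eval z ≠ 0 := by
  have hnd : p.natDegree = d := le_antisymm hp (Polynomial.le_natDegree_of_ne_zero hd)
  have hp0 : p ≠ 0 := by rintro rfl; simp at hd
  have := Polynomial.resultant_eq_prod_eval p (Polynomial.derivative p) (d-1)
    (by rw [← hnd]; exact Polynomial.natDegree_derivative_le p) (IsAlgClosed.splits p)
  rw [hnd] at this
  rw [this]
  rw [mul_ne_zero_iff, ne_eq (Multiset.prod _), Multiset.prod_eq_zero_iff]
  constructor
  · rintro ⟨-, h⟩ z hz h0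
    apply h
    rw [Multiset.mem_map]
    exact ⟨z, (Polynomial.mem_roots hp0).2 hz, h0⟩
  · intro h
    refine ⟨pow_ne_zero _ (Polynomial.leadingCoeff_ne_zero.2 hp0), ?_⟩
    rw [Multiset.mem_map]
    rintro ⟨z, hz, h0⟩
    exact h z ((Polynomial.mem_roots hp0).1 hz) h0

lemma ncard_roots (p : Polynomial ℂ) (hp : p.natDegree ≤ d) (hd : p.coeff d ≠ 0)
    (h : ∀ z, p.eval z = 0 → (Polynomial.derivative p).eval z ≠ 0) :
    {z | p.eval z = 0}.Finite ∧ {z | p.eval z = 0}.ncard = d := by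
  classical
  have hnd : p.natDegree = d := le_antisymm hp (Polynomial.le_natDegree_of_ne_zero hd)
  have hp0 : p ≠ 0 := by rintro rfl; simp at hd
  have hs : {z | p.eval z = 0} = ↑p.roots.toFinset := by
    ext z; simp [hp0]
  have hnod : p.roots.Nodup := by
    rw [Multiset.nodup_iff_count_le_one]
    intro z
    rw [Polynomial.count_roots]
    by_contra hlt
    have := (Polynomial.one_lt_rootMultiplicity_iff_isRoot hp0).1 (not_le.1 hlt)
    exact h z this.1 this.2
  rw [hs]
  refine ⟨Finset.finite_toSet _, ?_⟩
  rw [Set.ncard_coe_finset, Multiset.toFinset_card_of_nodup hnod, ← hnd]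
  exact (IsAlgClosed.splits p).natDegree_eq_card_roots.symm

lemma exists_P (Wg : Matrix (Fin k) (Fin m) (MvPolynomial (Fin (n+1)) ℂ)) (R : Matrix (Fin k) (Fin m) ℂ)
    (g : MvPolynomial (PluckIdx k m) ℂ) : ∃ P : Polynomial (MvPolynomial (Fin (n+1)) ℂ), ∀ y z,
      (P.map (eval y)).eval z = eval (pl (Wg.map (eval y) + z • R)) g := by
  let M : Matrix (Fin k) (Fin m) (Polynomial (MvPolynomial (Fin (n+1)) ℂ)) :=
    Matrix.of fun i j => Polynomial.C (Wg i j) + Polynomial.X * Polynomial.C (C (R i j))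
  refine ⟨eval₂ (Polynomial.C.comp C) (fun S => (M.submatrix id (en S)).det) g, fun y z => ?_⟩
  let ψ : Polynomial (MvPolynomial (Fin (n+1)) ℂ) →+* ℂ :=
    (Polynomial.evalRingHom z).comp (Polynomial.mapRingHom (eval y))
  change ψ _ = _
  rw [hom_eval₂]
  have h1 : ψ.comp (Polynomial.C.comp C) = RingHom.id ℂ := by
    ext c; simp [ψ]
  have h2 : (fun S => ψ ((M.submatrix id (en S)).det)) = pl (Wg.map (eval y) + z • R) := by
    ext S
    rw [RingHom.map_det, pl_eq, plT]
    congr 1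
    ext i j
    simp [ψ, M]
    ring
  rw [h1]
  change eval₂ (RingHom.id ℂ) (fun S => ψ ((M.submatrix id (en S)).det)) g = _
  rw [h2]
  rfl

end
end Irr
end

section
open Matrix MvPolynomial
namespace Irr

section
variable {k m : ℕ} {d n : ℕ}

lemma pl_smul_mat (c : ℂ) (w : Matrix (Fin k) (Fin m) ℂ) : pl (c • w) = c ^ k • pl w := by
  ext S
  change ((c • w).submatrix id (en S)).det = c ^ k * (w.submatrix id (en S)).det
  rw [show (c • w).submatrix id (en S) = c • (w.submatrix id (en S)) from rfl, det_smul,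
    Fintype.card_fin]

/-- the free chart coordinates -/
abbrev Qs (A : PluckIdx k m) (i0 : Fin k) (j0 : Fin m) : Type :=
  {q : Fin k × Fin m // q.2 ∉ A.1 ∧ q ≠ (i0, j0)}

open Classical in
/-- the parametrized matrix -/
noncomputable def Wm {S : Type*} [Zero S] {A : PluckIdx k m} {i0 : Fin k} {j0 : Fin m}
    (ε : Fin n ≃ Qs A i0 j0) (y : Fin (n+1) → S) : Matrix (Fin k) (Fin m) S :=
  Matrix.of fun i j => if en A i = j then y 0 else
    if h : j ∉ A.1 ∧ (i, j) ≠ (i0, j0) then y (ε.symm ⟨(i, j), h⟩).succ else 0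

variable {A : PluckIdx k m} {i0 : Fin k} {j0 : Fin m} (ε : Fin n ≃ Qs A i0 j0)

lemma Wm_map (y : Fin (n+1) → ℂ) : (Wm ε (fun l => (X l : MvPolynomial (Fin (n+1)) ℂ))).map (eval y)
    = Wm ε y := by
  ext i j
  simp only [Wm, Matrix.map_apply, of_apply]
  split_ifs <;> simp

lemma en_mem (A : PluckIdx k m) (i : Fin k) : en A i ∈ A.1 := (A.1.orderIsoOfFin A.2 i).2

lemma exists_en (A : PluckIdx k m) (j : Fin m) (h : j ∈ A.1) : ∃ i, en A i = j := by
  obtain ⟨i, hi⟩ := (A.1.orderIsoOfFin A.2).surjective ⟨j, h⟩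
  exact ⟨i, congrArg Subtype.val hi⟩

/-- the line of matrices -/
noncomputable def lw (y : Fin (n+1) → ℂ) (z : ℂ) : Matrix (Fin k) (Fin m) ℂ :=
  Wm ε y + z • (Matrix.single i0 j0 1 : Matrix (Fin k) (Fin m) ℂ)

lemma cs_Wm (hj0 : j0 ∉ A.1) (y : Fin (n+1) → ℂ) (z : ℂ) :
    cs (lw ε y z) A = y 0 • (1 : Matrix (Fin k) (Fin k) ℂ) := by
  ext i i'
  have h1 : j0 ≠ en A i' := fun h => hj0 (h ▸ en_mem A i')
  have h2 : ¬ (en A i' ∉ A.1 ∧ (i, en A i') ≠ (i0, j0)) := fun h => h.1 (en_mem A i')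
  have h3 : Matrix.single i0 j0 (1:ℂ) i (en A i') = 0 := by
    rw [Matrix.single_apply, if_neg fun h => h1 h.2]
  simp only [cs, submatrix_apply, id, lw, Matrix.add_apply, Matrix.smul_apply, Wm, of_apply, dif_neg h2,
    h3, smul_zero, add_zero, (en_inj A).eq_iff, Matrix.one_apply]
  split_ifs <;> simp

lemma Wm_ε (y : Fin (n+1) → ℂ) (z : ℂ) (l : Fin n) :
    (lw ε y z) (ε l).1.1 (ε l).1.2 = y l.succ := by
  have h1 : en A (ε l).1.1 ≠ (ε l).1.2 := fun h => (ε l).2.1 (h ▸ en_mem _ _)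
  have h2 := (ε l).2
  have h3 : Matrix.single i0 j0 (1:ℂ) (ε l).1.1 (ε l).1.2 = 0 := by
    rw [Matrix.single_apply, if_neg]
    rintro ⟨a, b⟩
    exact h2.2 (Prod.ext a.symm b.symm)
  simp only [lw, Matrix.add_apply, Matrix.smul_apply, h3, smul_zero, add_zero, Wm, of_apply, if_neg h1]
  rw [dif_pos h2]
  simp

lemma Wm_0 (hj0 : j0 ∉ A.1) (y : Fin (n+1) → ℂ) (z : ℂ) :
    (lw ε y z) i0 j0 = z := by
  have h1 : en A i0 ≠ j0 := fun h => hj0 (h ▸ en_mem _ _)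
  simp [lw, Wm, h1]

lemma eq_Wm (hj0 : j0 ∉ A.1) (y : Fin (n+1) → ℂ) (N : Matrix (Fin k) (Fin m) ℂ)
    (h : cs N A = y 0 • 1) (hN : ∀ l, N (ε l).1.1 (ε l).1.2 = y l.succ) :
    N = lw ε y (N i0 j0) := by
  ext i j
  by_cases hj : j ∈ A.1
  · obtain ⟨i', rfl⟩ := exists_en A j hj
    have h1 := congrFun (congrFun h i) i'
    have h2 := congrFun (congrFun (cs_Wm ε hj0 y (N i0 j0)) i) i'
    rw [← h2] at h1
    exact h1
  · by_cases hq : (i, j) = (i0, j0)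
    · obtain ⟨rfl, rfl⟩ := Prod.mk.inj hq
      rw [Wm_0 ε hj0]
    · have h1 := hN (ε.symm ⟨(i, j), hj, hq⟩)
      have h2 := Wm_ε ε y (N i0 j0) (ε.symm ⟨(i, j), hj, hq⟩)
      rw [← h2] at h1
      simpa only [Equiv.apply_symm_apply] using h1

/-- the projection -/
noncomputable def prj : RatMapTo (PluckIdx k m) n where
  F := Fin.cons (X A) fun l => ∑ S, C ((lam ℂ (Function.update (en A) (ε l).1.1 (ε l).1.2) S : ℤ) : ℂ) * X S
  e := 1
  homog := by
    intro l
    refine Fin.cases ?_ (fun l => ?_) l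
    · exact isHomogeneous_X _ _
    · rw [Fin.cons_succ]
      refine IsHomogeneous.sum _ _ _ fun S _ => ?_
      have := (isHomogeneous_C (PluckIdx k m)
        ((lam ℂ (Function.update (en A) (ε l).1.1 (ε l).1.2) S : ℤ) : ℂ)).mul (isHomogeneous_X ℂ S)
      rwa [zero_add] at this

lemma prj_zero (w : Matrix (Fin k) (Fin m) ℂ) : eval (pl w) ((prj ε).F 0) = pl w A := by
  simp [prj]

lemma prj_succ (w : Matrix (Fin k) (Fin m) ℂ) (l : Fin n) : eval (pl w) ((prj ε).F l.succ)
    = plT w (Function.update (en A) (ε l).1.1 (ε l).1.2) := by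
  rw [plT_lam]
  simp [prj]

variable (g : MvPolynomial (PluckIdx k m) ℂ) (hg : g.IsHomogeneous d)

lemma pl_Wm_A (hj0 : j0 ∉ A.1) (y : Fin (n+1) → ℂ) (z : ℂ) :
    pl (lw ε y z) A = y 0 ^ k := by
  rw [← det_cs, cs_Wm ε hj0, det_smul, det_one, Fintype.card_fin, mul_one]

lemma pl_Wm_ne (hj0 : j0 ∉ A.1) (y : Fin (n+1) → ℂ) (h0 : y 0 ≠ 0) (z : ℂ) :
    pl (lw ε y z) ≠ 0 := by
  intro h
  have := pl_Wm_A ε hj0 y z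
  rw [h] at this
  exact pow_ne_zero k h0 this.symm

lemma cs_inv_Wm (hj0 : j0 ∉ A.1) (y : Fin (n+1) → ℂ) (h0 : y 0 ≠ 0) (z : ℂ) :
    cs ((y 0)⁻¹ • (lw ε y z)) A = 1 := by
  change (y 0)⁻¹ • cs (lw ε y z) A = 1
  rw [cs_Wm ε hj0, smul_smul, inv_mul_cancel₀ h0, one_smul]

lemma prj_Wm (hj0 : j0 ∉ A.1) (y : Fin (n+1) → ℂ) (h0 : y 0 ≠ 0) (z : ℂ) :
    ∃ a : ℂ, a ≠ 0 ∧ ∀ l, eval (pl (lw ε y z)) ((prj ε).F l) = a * y l := by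
  refine ⟨y 0 ^ k * (y 0)⁻¹, mul_ne_zero (pow_ne_zero _ h0) (inv_ne_zero h0), fun l => ?_⟩
  refine Fin.cases ?_ (fun l => ?_) l
  · rw [prj_zero, pl_Wm_A ε hj0, mul_assoc, inv_mul_cancel₀ h0, mul_one]
  · rw [prj_succ]
    have h1 := plT_update _ A (cs_inv_Wm ε hj0 y h0 z) (ε l).1.1 (ε l).1.2
    rw [Matrix.smul_apply, Wm_ε, smul_eq_mul, plT_lam, pl_smul_mat] at h1
    have h2 : y 0 ^ k * (y 0)⁻¹ ^ k = 1 := by rw [← mul_pow, mul_inv_cancel₀ h0, one_pow]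
    rw [mul_assoc, ← h1, plT_lam, Finset.mul_sum]
    refine Finset.sum_congr rfl fun S _ => ?_
    rw [Pi.smul_apply, smul_eq_mul]
    linear_combination (-(lam ℂ (Function.update (en A) (ε l).1.1 (ε l).1.2) S : ℂ)
      * pl (lw ε y z) S) * h2

lemma fiber_eq (hg : g.IsHomogeneous d) (hj0 : j0 ∉ A.1) (y : Fin (n+1) → ℂ) (h0 : y 0 ≠ 0) (hy : y ≠ 0) :
    (prj ε).fiber (GrassSet k m ∩ ZeroSet g) (Projectivization.mk ℂ y hy)
    = (fun z => Projectivization.mk ℂ _ (pl_Wm_ne ε hj0 y h0 z)) ''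
      {z | eval (pl (lw ε y z)) g = 0} := by
  ext x
  constructor
  · rintro ⟨⟨⟨w, hw, hwx⟩, hz⟩, hm⟩
    revert w
    intro (w : Matrix (Fin k) (Fin m) ℂ) hw hwx
    change pl w ≠ 0 at hw
    have hwg : eval (pl w) g = 0 := hz _ hw hwx
    obtain ⟨hv, he⟩ := hm _ hw hwx
    rw [Projectivization.mk_eq_mk_iff'] at he
    obtain ⟨a, ha⟩ := he
    have ha0 : a ≠ 0 := by
      rintro rfl
      rw [zero_smul] at ha
      exact hv ha.symm
    have ha' : ∀ l, eval (pl w) ((prj ε).F l) = a * y l := fun l => (congrFun ha l).symm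
    have hA : pl w A = a * y 0 := by rw [← ha', prj_zero]
    have hA0 : pl w A ≠ 0 := by rw [hA]; exact mul_ne_zero ha0 h0
    have hN := eq_Wm ε hj0 y (y 0 • nrm w A) (by
      change y 0 • cs (nrm w A) A = _
      rw [cs_nrm w A hA0]) (by
      intro l
      rw [Matrix.smul_apply, nrm_apply w A hA0, ← prj_succ, ha', hA, smul_eq_mul]
      field_simp)
    have hpl : pl (y 0 • nrm w A) = (y 0 ^ k * (pl w A)⁻¹) • pl w := by
      rw [pl_smul_mat, pl_nrm, smul_smul]
    refine ⟨(y 0 • nrm w A) i0 j0, ?_, ?_⟩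
    · change eval _ g = 0
      rw [← hN, hpl, eval_smul_hom g hg, hwg, mul_zero]
    · rw [← hwx]
      change Projectivization.mk ℂ _ _ = Projectivization.mk ℂ (pl w) _
      rw [Projectivization.mk_eq_mk_iff']
      exact ⟨y 0 ^ k * (pl w A)⁻¹, by rw [← hN, hpl]⟩
  · rintro ⟨z, hz, rfl⟩
    change eval _ g = 0 at hz
    refine ⟨⟨⟨_, pl_Wm_ne ε hj0 y h0 z, rfl⟩, ?_⟩, ?_⟩
    · intro v hv hvx
      rw [Projectivization.mk_eq_mk_iff'] at hvx
      obtain ⟨a, rfl⟩ := hvx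
      rw [eval_smul_hom g hg, hz, mul_zero]
    · intro v hv hvx
      rw [Projectivization.mk_eq_mk_iff'] at hvx
      obtain ⟨a, rfl⟩ := hvx
      have ha : a ≠ 0 := by rintro rfl; simp at hv
      obtain ⟨l', hl', hφ⟩ := prj_Wm ε hj0 y h0 z
      have he : (prj ε).evalVec (a • pl (lw ε y z)) = (a ^ (prj ε).e * l') • y := by
        ext l
        change eval _ ((prj ε).F l) = a ^ (prj ε).e * l' * y l
        rw [eval_smul_hom _ ((prj ε).homog l), hφ, mul_assoc]
      have hne : (prj ε).evalVec (a • pl (lw ε y z)) ≠ 0 := by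
        rw [he]; exact smul_ne_zero (mul_ne_zero (pow_ne_zero _ ha) hl') hy
      refine ⟨hne, ?_⟩
      rw [Projectivization.mk_eq_mk_iff']
      exact ⟨_, he.symm⟩

lemma fiber_inj (hj0 : j0 ∉ A.1) (y : Fin (n+1) → ℂ) (h0 : y 0 ≠ 0) :
    Function.Injective (fun z => Projectivization.mk ℂ _ (pl_Wm_ne ε hj0 y h0 z)) := by
  intro z z' h
  rw [Projectivization.mk_eq_mk_iff'] at h
  obtain ⟨a, ha⟩ := h
  have h1 := congrFun ha A
  rw [Pi.smul_apply, pl_Wm_A ε hj0, pl_Wm_A ε hj0, smul_eq_mul] at h1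
  have ha1 : a = 1 := mul_right_cancel₀ (pow_ne_zero k h0) (by rw [h1, one_mul])
  rw [ha1, one_smul] at ha
  have h2 := eq_of_pl_eq _ _ A (cs_inv_Wm ε hj0 y h0 z) (cs_inv_Wm ε hj0 y h0 z')
    (by rw [pl_smul_mat, pl_smul_mat, ha])
  have h3 := congrFun (congrFun h2 i0) j0
  rw [Matrix.smul_apply, Matrix.smul_apply, Wm_0 ε hj0, Wm_0 ε hj0, smul_eq_mul, smul_eq_mul] at h3
  exact mul_left_cancel₀ (inv_ne_zero h0) h3

end
end Irr
end

section
open Matrix MvPolynomial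
namespace Irr

section
variable {k m : ℕ} {d n : ℕ}

lemma exists_Su (g : MvPolynomial (PluckIdx k m) ℂ) (hg : g.IsHomogeneous d)
    (hai : AlgebraicIndependent ℚ (fun α : Mon k m d => coeff α.1 g)) :
    ∃ (s : Set ℂ) (G : Su ℂ s k m d), G.g = g := by
  obtain ⟨s, hsub, hs⟩ := exists_isTranscendenceBasis_superset hai.coe_range
  obtain ⟨Δ, hΔ⟩ := exists_DB _ hs
  exact ⟨s, ⟨Δ, g, hg, fun α => ⟨coeff α.1 g, hsub ⟨α, rfl⟩⟩,
    fun a b h => hai.injective (congrArg Subtype.val h), fun α => by rw [hΔ]⟩, rfl⟩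

variable {A : PluckIdx k m} {i0 : Fin k} {j0 : Fin m} (ε : Fin n ≃ Qs A i0 j0)

/-- the special point -/
def ys (n : ℕ) : Fin (n+1) → ℂ := Pi.single 0 1

lemma lw_line (y : Fin (n+1) → ℂ) : ∃ v : PluckIdx k m → ℂ, ∀ z, pl (lw ε y z) = pl (Wm ε y) + z • v := by
  refine pl_line (Wm ε y) (Matrix.single i0 j0 1) i0 (fun i => if i = i0 then 1 else 0) ?_
  intro i j
  by_cases h : i = i0
  · subst h; simp
  · simp [h, Matrix.single_apply, Ne.symm h]

lemma Wm_ys_map (D : Derivation ℚ ℂ ℂ) : (Wm ε (ys n)).map D = 0 := by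
  ext i j
  simp only [Wm, Matrix.map_apply, of_apply, Matrix.zero_apply]
  split_ifs <;> simp [ys]

lemma single_map_D (D : Derivation ℚ ℂ ℂ) :
    (Matrix.single i0 j0 1 : Matrix (Fin k) (Fin m) ℂ).map D = 0 := by
  ext i j
  simp only [Matrix.map_apply, Matrix.single_apply, Matrix.zero_apply]
  split_ifs <;> simp

lemma lw_ys_map (D : Derivation ℚ ℂ ℂ) (z : ℂ) : (lw ε (ys n) z).map D
    = D z • (Matrix.single i0 j0 1 : Matrix (Fin k) (Fin m) ℂ) := by
  ext i j
  have h1 := congrFun (congrFun (Wm_ys_map ε D) i) j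
  have h2 := congrFun (congrFun (single_map_D (i0 := i0) (j0 := j0) D) i) j
  simp only [Matrix.map_apply, Matrix.zero_apply] at h1 h2
  simp only [lw, Matrix.map_apply, Matrix.add_apply, Matrix.smul_apply, map_add, h1, smul_eq_mul,
    Derivation.leibniz, h2, mul_zero, zero_add]
  ring

lemma lw_add (y : Fin (n+1) → ℂ) (z s : ℂ) :
    lw ε y z + s • (Matrix.single i0 j0 1 : Matrix (Fin k) (Fin m) ℂ) = lw ε y (z + s) := by
  rw [lw, lw, add_assoc, add_smul]

lemma special {s : Set ℂ} (G : Su ℂ s k m d) (hj0 : j0 ∉ A.1) (v : PluckIdx k m → ℂ)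
    (hv : ∀ z, pl (lw ε (ys n) z) = pl (Wm ε (ys n)) + z • v) :
    eval v G.g ≠ 0 ∧ ∀ z, eval (pl (lw ε (ys n) z)) G.g = 0 →
      (Polynomial.derivative (lp (pl (Wm ε (ys n))) v G.g)).eval z ≠ 0 := by
  classical
  have h01 : ys n 0 ≠ 0 := by simp [ys]
  have hy1 : ys n 0 = 1 := by simp [ys]
  constructor
  · intro h0
    have hv0 : v ≠ 0 := by
      rintro rfl
      have h1 : pl (lw ε (ys n) 0) = pl (lw ε (ys n) 1) := by rw [hv, hv]; simp
      have := fiber_inj ε hj0 (ys n) h01 (a₁ := 0) (a₂ := 1) (by simp only [h1])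
      exact zero_ne_one this
    obtain ⟨S, hS⟩ := Function.ne_iff.1 hv0
    have hDv : ∀ (D : Derivation ℚ ℂ ℂ) T, D (v T) = 0 := by
      intro D T
      have h1 : v T = pl (lw ε (ys n) 1) T - pl (lw ε (ys n) 0) T := by
        rw [hv, hv]; simp
      rw [h1, map_sub, ← dpl_der, ← dpl_der, lw_ys_map, lw_ys_map]
      simp
    have := der_eval (G.Δ.d (G.t (powMon d S))) v G.g _ G.supp
    rw [h0, map_zero, sum_mon (fun β => G.Δ.d (G.t (powMon d S)) (coeff β G.g) * ∏ i, v i ^ β i)] at this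
    simp only [hDv, mul_zero, Finset.sum_const_zero, add_zero, ← G.ht] at this
    rw [Finset.sum_eq_single (powMon d S)] at this
    · rw [G.Δ.d_self, one_mul] at this
      have h2 : mv v (powMon d S).1 = 0 := this.symm
      rw [powMon, mv_single] at h2
      exact hS (eq_zero_of_pow_eq_zero h2)
    · intro β _ hβ
      rw [G.Δ.d_ne _ _ fun h => hβ (G.t_inj h).symm, zero_mul]
    · simp
  · intro z hz hd0
    have h1 := G.xi_t _ hz (powMon d A)
    have h2 : ∀ s : ℂ, pl (lw ε (ys n) z + s • (Matrix.single i0 j0 1 : Matrix (Fin k) (Fin m) ℂ))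
        = pl (lw ε (ys n) z) + s • v := by
      intro s
      rw [lw_add, hv, hv, add_smul, add_assoc]
    have h3 : xi G.g (lw ε (ys n) z) (Matrix.single i0 j0 1) = 0 := by
      rw [lp_deriv_eval] at hd0
      rw [xi_apply, ← hd0, ← hv]
      exact Finset.sum_congr rfl fun S _ => by rw [dpl_line _ _ _ h2]
    rw [lw_ys_map, map_smul, h3, smul_zero, powMon, mv_single, pl_Wm_A ε hj0, hy1, one_pow, one_pow] at h1
    norm_num at h1

lemma exists_A (hk : 1 ≤ k) (hkm : k < m) (hn : n + 1 = k * (m - k)) :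
    ∃ (A : PluckIdx k m) (i0 : Fin k) (j0 : Fin m), j0 ∉ A.1 ∧ Nonempty (Fin n ≃ Qs A i0 j0) := by
  classical
  obtain ⟨S, -, hS⟩ := Finset.exists_subset_card_eq (s := (Finset.univ : Finset (Fin m))) (n := k)
    (by rw [Finset.card_univ, Fintype.card_fin]; omega)
  obtain ⟨j0, hj0⟩ : ∃ j0, j0 ∉ S := by
    by_contra h
    push Not at h
    have : S = Finset.univ := Finset.eq_univ_iff_forall.2 h
    rw [this, Finset.card_univ, Fintype.card_fin] at hS
    omega
  refine ⟨⟨S, hS⟩, ⟨0, by omega⟩, j0, hj0, ⟨?_⟩⟩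
  symm
  apply Fintype.equivFinOfCardEq
  rw [Fintype.card_subtype]
  have : (Finset.univ.filter fun q : Fin k × Fin m => q.2 ∉ S ∧ q ≠ (⟨0, by omega⟩, j0))
      = (Finset.univ ×ˢ Sᶜ).erase (⟨0, by omega⟩, j0) := by
    ext q
    simp [and_comm]
  rw [this, Finset.card_erase_of_mem (by simp [hj0]), Finset.card_product, Finset.card_compl, hS]
  simp
  omega

lemma upper (g : MvPolynomial (PluckIdx k m) ℂ) (hg : g.IsHomogeneous d)
    (hai : AlgebraicIndependent ℚ (fun α : Mon k m d => coeff α.1 g))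
    (hd : 1 ≤ d) (hk : 1 ≤ k) (hkm : k < m) (hn : n + 1 = k * (m - k)) :
    ∃ φ : RatMapTo (PluckIdx k m) n, φ.DominantOfDegree (GrassSet k m ∩ ZeroSet g) d := by
  obtain ⟨A, i0, j0, hj0, ⟨ε⟩⟩ := exists_A hk hkm hn
  obtain ⟨s, G, rfl⟩ := exists_Su g hg hai
  obtain ⟨P, hP⟩ := exists_P (Wm ε (fun l => (X l : MvPolynomial (Fin (n+1)) ℂ)))
    (Matrix.single i0 j0 1) G.g
  have hP' : ∀ y z, (P.map (eval y)).eval z = eval (pl (lw ε y z)) G.g := by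
    intro y z
    rw [hP, Wm_map]; rfl
  have hlp : ∀ y v, (∀ z, pl (lw ε y z) = pl (Wm ε y) + z • v) → P.map (eval y) = lp (pl (Wm ε y)) v G.g := by
    intro y v h
    apply Polynomial.funext
    intro z
    rw [hP', lp_eval, h]
  have hcoeff : ∀ y, (P.map (eval y)).natDegree ≤ d := by
    intro y
    obtain ⟨v, hv⟩ := lw_line ε y
    rw [hlp y v hv]
    exact (lp_deg _ _ _ hg).1
  let r : MvPolynomial (Fin (n+1)) ℂ := X 0 * P.coeff d
    * Polynomial.resultant P (Polynomial.derivative P) d (d-1)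
  have hr : ∀ y, eval y r = y 0 * (P.map (eval y)).coeff d
      * Polynomial.resultant (P.map (eval y)) (Polynomial.derivative (P.map (eval y))) d (d-1) := by
    intro y
    rw [Polynomial.derivative_map, Polynomial.resultant_map_map, Polynomial.coeff_map]
    simp [r]
  have hs0 : ys n ≠ 0 := by
    intro h
    have := congrFun h 0
    simp [ys] at this
  refine ⟨prj ε, hd, _, dense_of r (ys n) hs0 ?_ {x | ((prj ε).fiber (GrassSet k m ∩ ZeroSet G.g) x).Finite ∧
    ((prj ε).fiber (GrassSet k m ∩ ZeroSet G.g) x).ncard = d} ?_, fun y hy => hy⟩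
  · obtain ⟨v, hv⟩ := lw_line ε (ys n)
    obtain ⟨h1, h2⟩ := special ε G hj0 v hv
    have hc : (P.map (eval (ys n))).coeff d ≠ 0 := by
      rw [hlp _ v hv, (lp_deg _ _ _ hg).2]; exact h1
    rw [hr]
    refine mul_ne_zero (mul_ne_zero (by simp [ys]) hc) ?_
    rw [card_roots_of _ (hcoeff _) hc]
    intro z hz
    rw [hP'] at hz
    rw [hlp _ v hv]
    exact h2 z hz
  · intro y hy hne
    rw [hr] at hne
    have h3 := right_ne_zero_of_mul hne
    have h12 := left_ne_zero_of_mul hne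
    have h1 := left_ne_zero_of_mul h12
    have h2 := right_ne_zero_of_mul h12
    rw [card_roots_of _ (hcoeff _) h2] at h3
    obtain ⟨h4, h5⟩ := ncard_roots _ (hcoeff y) h2 h3
    simp only [hP'] at h4 h5
    simp only [Set.mem_setOf_eq]
    rw [fiber_eq ε G.g hg hj0 y h1 hy]
    refine ⟨h4.image _, ?_⟩
    rw [Set.ncard_image_of_injective _ (fiber_inj ε hj0 y h1), h5]

end
end Irr
end

/-- **Theorem D.** Let `G = Gr(k,m) ⊂ ℙ` be the Plücker-embedded
Grassmannian with `k ≠ 1` and `k ≠ m − 1`, and let `X` be a very general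
hypersurface in `|O_G(d)|`.  If `d ≥ 3m − 5` then `irr(X) = d`, where
`dim X = k(m−k) − 1`.  "Very general" is formalized by a countable family of
proper Zariski-closed subsets of the space of degree-`d` forms outside whose
union the conclusion holds. -/
theorem irr_very_general_hypersurface_in_grassmannian
    (k m d : ℕ) (hk0 : 0 < k) (hkm : k < m) (hk1 : k ≠ 1) (hk2 : k ≠ m - 1)
    (hd : 3 * m ≤ d + 5) :
    ∃ B : ℕ → Set (MvPolynomial (PluckIdx k m) ℂ),
      (∀ i, CoeffPolyProperClosed d (B i)) ∧
      ∀ g : MvPolynomial (PluckIdx k m) ℂ, g.IsHomogeneous d → g ∉ ⋃ i, B i →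
        irr (k * (m - k) - 1) (GrassSet k m ∩ ZeroSet g) = d := by
  obtain ⟨B, hB, hB'⟩ := Irr.exists_bad k m d
  refine ⟨B, hB, fun g hg hgB => ?_⟩
  have hai := hB' g hgB
  have hpos : 0 < k * (m - k) := Nat.mul_pos hk0 (by omega)
  have hn : k * (m - k) - 1 + 1 = k * (m - k) := by omega
  have hup := Irr.upper g hg hai (by omega) (by omega) hkm hn
  refine le_antisymm (Nat.sInf_le hup) (le_csInf ⟨d, hup⟩ ?_)
  rintro δ ⟨φ, hφ⟩
  by_contra hlt
  exact Irr.no_small g hg hai (by omega) (by omega) hd hn φ δ (not_le.1 hlt) hφ
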